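/- arXiv:2407.11092 — 3 statements merged into one kernel-verified Lean document; each statement's English description precedes it below -/
import Mathlib

section
/- Let T be a tree (a connected acyclic finite simple graph) on m ≥ 2 vertices and let N ≥ 1. Then Conf_T(ℝ^N) is homeomorphic to ℝ^N × (ℝ^N ∖ {0})^{m−1}; consequently Conf_T(ℝ^N) is homotopy equivalent to the torus (S^{N−1})^{m−1}, and for N ≥ 2 the rank of H_d(Conf_T(ℝ^N); ℤ) equals binom(m−1, j) when d = j(N−1) for some 0 ≤ j ≤ m−1 and is 0 otherwise, i.e. its Poincaré polynomial is (1+t^{N−1})^{m−1}. -/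
/-!
STATEMENT 3: For a tree T on m ≥ 2 vertices and N ≥ 1, Conf_T(ℝ^N) is
homeomorphic to ℝ^N × (ℝ^N∖{0})^{m−1}, hence homotopy equivalent to the torus
(S^{N−1})^{m−1}; for N ≥ 2 its homology is free with Poincaré polynomial
(1+t^{N−1})^{m−1}.
-/

open CategoryTheory

/-- Singular homology with integer coefficients, as a functor. -/
noncomputable def singularHomologyFunctor (d : ℕ) : TopCat ⥤ ModuleCat ℤ :=
  TopCat.toSSet ⋙ ((SimplicialObject.whiskering _ _).obj (ModuleCat.free ℤ)) ⋙
    AlgebraicTopology.alternatingFaceMapComplex (ModuleCat ℤ) ⋙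
    HomologicalComplex.homologyFunctor (ModuleCat ℤ) (ComplexShape.down ℕ) d

/-- `SH d X` is the `d`-th integral singular homology group of `X`. -/
noncomputable abbrev SH (d : ℕ) (X : Type) [TopologicalSpace X] : ModuleCat ℤ :=
  (singularHomologyFunctor d).obj (TopCat.of X)

/-- The chromatic configuration space `Conf_Γ(ℝ^N)`. -/
abbrev chromConf (N m : ℕ) (G : SimpleGraph (Fin m)) : Type :=
  {x : Fin m → EuclideanSpace ℝ (Fin N) // ∀ i j, G.Adj i j → x i ≠ x j}

namespace HomologicalComplex

variable (K : ChainComplex (ModuleCat.{0} ℤ) ℕ)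

theorem homologyπ_surjective (n : ℕ) : Function.Surjective (K.homologyπ n) :=
  (ModuleCat.epi_iff_surjective _).1 inferInstance

theorem iCycles_injective (n : ℕ) : Function.Injective (K.iCycles n) :=
  (ModuleCat.mono_iff_injective _).1 inferInstance

theorem exists_iCycles_eq {n : ℕ} (c : K.X n) (hc : ∀ m, K.d n m c = 0) :
    ∃ z : K.cycles n, K.iCycles n z = c := by
  have h := ShortComplex.exact_of_f_is_kernel
    (ShortComplex.mk (K.iCycles n) (K.d n _) (K.iCycles_d n ((ComplexShape.down ℕ).next n)))
    (K.cyclesIsKernel n _ rfl)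
  exact (ShortComplex.moduleCat_exact_iff _).1 h c (hc _)

theorem d_iCycles_apply (n m : ℕ) (z : K.cycles n) : K.d n m (K.iCycles n z) = 0 := by
  rw [← ModuleCat.comp_apply, K.iCycles_d]; rfl

theorem homologyπ_eq_zero_iff {n : ℕ} (z : K.cycles n) :
    K.homologyπ n z = 0 ↔ ∃ w : K.X (n + 1), K.d (n + 1) n w = K.iCycles n z := by
  have h := ShortComplex.exact_of_g_is_cokernel
    (ShortComplex.mk (K.toCycles (n + 1) n) (K.homologyπ n) (by simp))
    (K.homologyIsCokernel (n + 1) n (by simp))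
  constructor
  · intro hz
    obtain ⟨w, hw⟩ := (ShortComplex.moduleCat_exact_iff _).1 h z hz
    refine ⟨w, ?_⟩
    rw [← hw, ← ModuleCat.comp_apply]
    simp
  · rintro ⟨w, hw⟩
    have : K.toCycles (n + 1) n w = z := by
      apply K.iCycles_injective
      rw [← hw, ← ModuleCat.comp_apply]
      simp
    rw [← this, ← ModuleCat.comp_apply]
    simp

variable {K} {L : ChainComplex (ModuleCat.{0} ℤ) ℕ}

theorem homologyMap_homologyπ_apply (j : K ⟶ L) (n : ℕ) (z : K.cycles n) :
    homologyMap j n (K.homologyπ n z) = L.homologyπ n (cyclesMap j n z) := by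
  rw [← ModuleCat.comp_apply, ← ModuleCat.comp_apply, homologyπ_naturality]

theorem iCycles_cyclesMap_apply (j : K ⟶ L) (n : ℕ) (z : K.cycles n) :
    L.iCycles n (cyclesMap j n z) = j.f n (K.iCycles n z) := by
  rw [← ModuleCat.comp_apply, ← ModuleCat.comp_apply, cyclesMap_i]

theorem f_d_apply (j : K ⟶ L) (n m : ℕ) (z : K.X n) :
    L.d n m (j.f n z) = j.f m (K.d n m z) := by
  rw [← ModuleCat.comp_apply, ← ModuleCat.comp_apply, j.comm]

theorem d_d_apply (n m k : ℕ) (z : K.X n) : K.d m k (K.d n m z) = 0 := by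
  rw [← ModuleCat.comp_apply, K.d_comp_d]; rfl

/-- An injective chain map is an isomorphism on homology as soon as every relative cycle
is a relative boundary. -/
theorem isIso_homologyMap_of_injective (j : K ⟶ L)
    (hj : ∀ n, Function.Injective (j.f n))
    (h : ∀ n (c : L.X n), (∀ m, ∃ y, j.f m y = L.d n m c) →
      ∃ (e : L.X (n + 1)) (y : K.X n), j.f n y = c - L.d (n + 1) n e) (n : ℕ) :
    IsIso (homologyMap j n) := by
  rw [ConcreteCategory.isIso_iff_bijective]
  constructor
  · rw [injective_iff_map_eq_zero]
    intro x hx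
    obtain ⟨z, rfl⟩ := K.homologyπ_surjective n x
    rw [homologyMap_homologyπ_apply, homologyπ_eq_zero_iff] at hx
    obtain ⟨e, he⟩ := hx
    rw [iCycles_cyclesMap_apply] at he
    rw [homologyπ_eq_zero_iff]
    have hd : ∀ m, ∃ y, j.f m y = L.d (n + 1) m e := by
      intro m
      by_cases hm : n = m
      · subst hm
        exact ⟨_, he.symm⟩
      · refine ⟨0, ?_⟩
        rw [L.shape]
        · simp
        · simpa using Ne.symm hm
    obtain ⟨f, y, hy⟩ := h _ e hd
    refine ⟨y, hj n ?_⟩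
    rw [← f_d_apply, hy, map_sub, he, d_d_apply, sub_zero]
  · intro x
    obtain ⟨z, rfl⟩ := L.homologyπ_surjective n x
    obtain ⟨e, y, hy⟩ := h n (L.iCycles n z) (fun m => ⟨0, by rw [d_iCycles_apply, map_zero]⟩)
    obtain ⟨w, hw⟩ := K.exists_iCycles_eq y (fun m => hj m (by
      rw [← f_d_apply, hy, map_sub, d_iCycles_apply, d_d_apply, sub_zero, map_zero]))
    refine ⟨K.homologyπ n w, ?_⟩
    rw [homologyMap_homologyπ_apply, ← sub_eq_zero, ← map_sub, homologyπ_eq_zero_iff]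
    refine ⟨-e, ?_⟩
    rw [map_sub, iCycles_cyclesMap_apply, hw, hy, map_neg]
    abel

end HomologicalComplex

namespace HomologicalComplex

section MayerVietoris

variable {I A B X : ChainComplex (ModuleCat.{0} ℤ) ℕ} (α : I ⟶ A) (β : I ⟶ B) (i : A ⟶ X)
  (j : B ⟶ X)

theorem desc_f_apply (n : ℕ) (w : (A ⊞ B).X n) : (Limits.biprod.desc i j).f n w =
    i.f n ((Limits.biprod.fst : A ⊞ B ⟶ A).f n w) +
      j.f n ((Limits.biprod.snd : A ⊞ B ⟶ B).f n w) := by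
  have : (Limits.biprod.desc i j) = Limits.biprod.fst ≫ i + Limits.biprod.snd ≫ j := by
    apply Limits.biprod.hom_ext' <;> simp
  rw [this]
  rfl

theorem exists_desc_f_eq (n : ℕ) (a : A.X n) (b : B.X n) :
    ∃ w : (A ⊞ B).X n, (Limits.biprod.desc i j).f n w = i.f n a + j.f n b := by
  refine ⟨(Limits.biprod.inl : A ⟶ A ⊞ B).f n a + (Limits.biprod.inr : B ⟶ A ⊞ B).f n b, ?_⟩
  have e1 : i = Limits.biprod.inl ≫ (Limits.biprod.desc i j) := by simp
  have e2 : j = Limits.biprod.inr ≫ (Limits.biprod.desc i j) := by simp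
  have h1 : i.f n a = (Limits.biprod.inl ≫ (Limits.biprod.desc i j)).f n a := by rw [← e1]
  have h2 : j.f n b = (Limits.biprod.inr ≫ (Limits.biprod.desc i j)).f n b := by rw [← e2]
  rw [h1, h2, map_add]
  rfl

theorem homologyMap_desc_apply (n : ℕ) (w : (A ⊞ B).homology n) :
    homologyMap (Limits.biprod.desc i j) n w =
    homologyMap i n (homologyMap (Limits.biprod.fst : A ⊞ B ⟶ A) n w) +
      homologyMap j n (homologyMap (Limits.biprod.snd : A ⊞ B ⟶ B) n w) := by
  have : (Limits.biprod.desc i j) = Limits.biprod.fst ≫ i + Limits.biprod.snd ≫ j := by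
    apply Limits.biprod.hom_ext' <;> simp
  rw [this, homologyMap_add, homologyMap_comp, homologyMap_comp]
  rfl

theorem exists_homology_biprod (n : ℕ) (a : A.homology n) (b : B.homology n) :
    ∃ w : (A ⊞ B).homology n, homologyMap (Limits.biprod.fst : A ⊞ B ⟶ A) n w = a ∧
      homologyMap (Limits.biprod.snd : A ⊞ B ⟶ B) n w = b := by
  refine ⟨homologyMap (Limits.biprod.inl : A ⟶ A ⊞ B) n a +
    homologyMap (Limits.biprod.inr : B ⟶ A ⊞ B) n b, ?_, ?_⟩
  · rw [map_add, ← ModuleCat.comp_apply, ← ModuleCat.comp_apply, ← homologyMap_comp,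
      ← homologyMap_comp]
    simp
  · rw [map_add, ← ModuleCat.comp_apply, ← ModuleCat.comp_apply, ← homologyMap_comp,
      ← homologyMap_comp]
    simp

theorem homology_biprod_ext (n : ℕ) (w w' : (A ⊞ B).homology n)
    (h₁ : homologyMap (Limits.biprod.fst : A ⊞ B ⟶ A) n w =
      homologyMap (Limits.biprod.fst : A ⊞ B ⟶ A) n w')
    (h₂ : homologyMap (Limits.biprod.snd : A ⊞ B ⟶ B) n w =
      homologyMap (Limits.biprod.snd : A ⊞ B ⟶ B) n w') : w = w' := by
  have key : ∀ w : (A ⊞ B).homology n, w = homologyMap (Limits.biprod.inl : A ⟶ A ⊞ B) n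
      (homologyMap (Limits.biprod.fst : A ⊞ B ⟶ A) n w) +
      homologyMap (Limits.biprod.inr : B ⟶ A ⊞ B) n
      (homologyMap (Limits.biprod.snd : A ⊞ B ⟶ B) n w) := by
    intro w
    rw [← ModuleCat.comp_apply, ← ModuleCat.comp_apply, ← homologyMap_comp, ← homologyMap_comp,
      ← LinearMap.add_apply, ← ModuleCat.hom_add, ← homologyMap_add, Limits.biprod.total]
    simp
  rw [key w, key w', h₁, h₂]

theorem homologyMap_zero_surjective {K L : ChainComplex (ModuleCat.{0} ℤ) ℕ} (f : K ⟶ L)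
    (hf : Function.Surjective (f.f 0)) : Function.Surjective (homologyMap f 0) := by
  intro x
  obtain ⟨z, rfl⟩ := L.homologyπ_surjective 0 x
  obtain ⟨y, hy⟩ := hf (L.iCycles 0 z)
  obtain ⟨w, rfl⟩ := K.exists_iCycles_eq y (fun m => by rw [K.shape _ _ (by simp)]; rfl)
  refine ⟨K.homologyπ 0 w, ?_⟩
  rw [homologyMap_homologyπ_apply]
  congr 1
  apply L.iCycles_injective
  rw [iCycles_cyclesMap_apply, hy]

theorem exists_linearMap_of_shortExact {S : ShortComplex (ChainComplex (ModuleCat.{0} ℤ) ℕ)}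
    (hS : S.ShortExact) (n : ℕ) :
    ∃ δ : S.X₃.homology (n + 1) →ₗ[ℤ] S.X₁.homology n,
      (∀ x, δ x = 0 ↔ ∃ w, homologyMap S.g (n + 1) w = x) ∧
      (∀ u, (∃ x, δ x = u) ↔ homologyMap S.f n u = 0) := by
  have hr : (ComplexShape.down ℕ).Rel (n + 1) n := by simp
  refine ⟨(hS.δ (n + 1) n hr).hom, fun x => ⟨?_, ?_⟩, fun u => ⟨?_, ?_⟩⟩
  · exact (ShortComplex.moduleCat_exact_iff _).1 (hS.homology_exact₃ (n + 1) n hr) x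
  · rintro ⟨w, rfl⟩
    exact congrArg (fun f => f.hom w) (hS.comp_δ (n + 1) n hr)
  · rintro ⟨x, rfl⟩
    exact congrArg (fun f => f.hom x) (hS.δ_comp (n + 1) n hr)
  · exact (ShortComplex.moduleCat_exact_iff _).1 (hS.homology_exact₁ (n + 1) n hr) u

/-- A commutative square of chain complexes is *excisive* if it is degreewise a pullback of
injections and if every chain of the target whose boundary is small is small up to a boundary,
where a chain is small if it is a sum of chains from the two sides. -/
structure Excisive : Prop where
  comm : α ≫ i = β ≫ j
  injective : ∀ n, Function.Injective (α.f n)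
  exists_of_eq : ∀ n (a : A.X n) (b : B.X n), i.f n a = j.f n b → ∃ u, α.f n u = a ∧ β.f n u = b
  exists_small : ∀ n (c : X.X n), (∀ m, ∃ a b, i.f m a + j.f m b = X.d n m c) →
    ∃ (e : X.X (n + 1)) (a : A.X n) (b : B.X n), i.f n a + j.f n b = c - X.d (n + 1) n e

variable {α β i j} (h : Excisive α β i j)

include h

theorem Excisive.exact : (ShortComplex.mk (Limits.biprod.lift α (-β)) (Limits.biprod.desc i j)
    (by simp [h.comm])).Exact := by
  apply HomologicalComplex.exact_of_degreewise_exact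
  intro n
  rw [ShortComplex.moduleCat_exact_iff]
  intro x hx
  have hx' : i.f n ((Limits.biprod.fst : A ⊞ B ⟶ A).f n x) =
      j.f n (-(Limits.biprod.snd : A ⊞ B ⟶ B).f n x) := by
    have : (Limits.biprod.desc i j) = Limits.biprod.fst ≫ i + Limits.biprod.snd ≫ j := by
      apply Limits.biprod.hom_ext' <;> simp
    change (Limits.biprod.desc i j).f n x = 0 at hx
    rw [this] at hx
    rw [map_neg, ← add_eq_zero_iff_eq_neg]
    exact hx
  obtain ⟨u, hu, hu'⟩ := h.exists_of_eq n _ _ hx'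
  refine ⟨u, ?_⟩
  change (Limits.biprod.lift α (-β)).f n u = x
  have e : (Limits.biprod.lift α (-β)) = α ≫ Limits.biprod.inl - β ≫ Limits.biprod.inr := by
    apply Limits.biprod.hom_ext <;> simp
  have e2 : x = (𝟙 (A ⊞ B) : A ⊞ B ⟶ A ⊞ B).f n x := rfl
  rw [e2, ← Limits.biprod.total, e]
  change (Limits.biprod.inl : A ⟶ A ⊞ B).f n (α.f n u) -
    (Limits.biprod.inr : B ⟶ A ⊞ B).f n (β.f n u) =
    (Limits.biprod.inl : A ⟶ A ⊞ B).f n _ + (Limits.biprod.inr : B ⟶ A ⊞ B).f n _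
  rw [hu, hu', map_neg, sub_neg_eq_add]
  rfl

theorem Excisive.mono : Mono (Limits.biprod.lift α (-β)) := by
  have : Mono α := by
    have : ∀ n, Mono (α.f n) := fun n => (ModuleCat.mono_iff_injective _).2 (h.injective n)
    exact HomologicalComplex.mono_of_mono_f _ this
  have e : Limits.biprod.lift α (-β) ≫ Limits.biprod.fst = α := by simp
  exact mono_of_mono_fac e

theorem Excisive.isIso_homologyMap (n : ℕ) : IsIso (homologyMap (Limits.cokernel.desc
    (Limits.biprod.lift α (-β)) (Limits.biprod.desc i j) (by simp [h.comm])) n) := by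
  set q := Limits.cokernel.desc
    (Limits.biprod.lift α (-β)) (Limits.biprod.desc i j) (by simp [h.comm]) with hq
  have hqπ : Limits.cokernel.π (Limits.biprod.lift α (-β)) ≫ q = Limits.biprod.desc i j := by
    simp [hq]
  have hqa : ∀ n w, q.f n ((Limits.cokernel.π (Limits.biprod.lift α (-β))).f n w) =
      (Limits.biprod.desc i j).f n w := fun n w => by rw [← hqπ]; rfl
  have hmono : Mono q := h.exact.mono_cokernelDesc
  refine isIso_homologyMap_of_injective q
    (fun n => (ModuleCat.mono_iff_injective _).1 inferInstance) (fun n c hc => ?_) n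
  obtain ⟨e, a, b, hab⟩ := h.exists_small n c (fun m => by
    obtain ⟨y, hy⟩ := hc m
    obtain ⟨w, rfl⟩ := (ModuleCat.epi_iff_surjective
      ((Limits.cokernel.π (Limits.biprod.lift α (-β))).f m)).1 inferInstance y
    exact ⟨_, _, by rw [← hy, hqa, desc_f_apply]⟩)
  obtain ⟨w, hw⟩ := exists_desc_f_eq (i := i) (j := j) n a b
  exact ⟨e, (Limits.cokernel.π (Limits.biprod.lift α (-β))).f n w, by rw [hqa, hw, hab]⟩

theorem Excisive.shortExact : (ShortComplex.mk (Limits.biprod.lift α (-β))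
    (Limits.cokernel.π (Limits.biprod.lift α (-β))) (by simp)).ShortExact :=
  have := h.mono
  { exact := ShortComplex.exact_cokernel _
    mono_f := this
    epi_g := by dsimp; infer_instance }

theorem Excisive.exists_of_homology_add_eq_zero (n : ℕ) (a : A.homology n) (b : B.homology n)
    (hab : homologyMap i n a + homologyMap j n b = 0) :
    ∃ u, homologyMap α n u = a ∧ homologyMap β n u = -b := by
  have := h.isIso_homologyMap n
  obtain ⟨w, rfl, rfl⟩ := exists_homology_biprod n a b
  rw [← homologyMap_desc_apply] at hab
  have e : Limits.biprod.desc i j = Limits.cokernel.π (Limits.biprod.lift α (-β)) ≫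
    Limits.cokernel.desc (Limits.biprod.lift α (-β)) (Limits.biprod.desc i j)
      (by simp [h.comm]) := by simp
  rw [e, homologyMap_comp, ModuleCat.comp_apply] at hab
  have hw := (ConcreteCategory.isIso_iff_bijective _).1 this |>.1 (hab.trans (map_zero _).symm)
  obtain ⟨u, hu⟩ := (ShortComplex.moduleCat_exact_iff _).1 (h.shortExact.homology_exact₂ n) w hw
  refine ⟨u, ?_, ?_⟩
  · rw [← hu]
    change _ = homologyMap (Limits.biprod.fst : A ⊞ B ⟶ A) n 
      (homologyMap (Limits.biprod.lift α (-β)) n u)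
    rw [← ModuleCat.comp_apply, ← homologyMap_comp]
    simp
  · rw [← hu]
    change _ = - homologyMap (Limits.biprod.snd : A ⊞ B ⟶ B) n 
      (homologyMap (Limits.biprod.lift α (-β)) n u)
    rw [← ModuleCat.comp_apply, ← homologyMap_comp]
    simp

theorem Excisive.exists_boundary_of_quotient (n : ℕ) :
    ∃ (P : ChainComplex (ModuleCat.{0} ℤ) ℕ) (π : A ⊞ B ⟶ P)
      (e : P.homology (n + 1) ≃ₗ[ℤ] X.homology (n + 1))
      (δ : P.homology (n + 1) →ₗ[ℤ] I.homology n),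
      (∀ w, e (homologyMap π (n + 1) w) = homologyMap (Limits.biprod.desc i j) (n + 1) w) ∧
      (∀ x, δ x = 0 ↔ ∃ w, homologyMap π (n + 1) w = x) ∧
      (∀ u, (∃ x, δ x = u) ↔ homologyMap (Limits.biprod.lift α (-β)) n u = 0) := by
  have := h.isIso_homologyMap (n + 1)
  obtain ⟨δ, hδ₁, hδ₂⟩ := exists_linearMap_of_shortExact h.shortExact n
  refine ⟨_, Limits.cokernel.π (Limits.biprod.lift α (-β)),
    (asIso (homologyMap (Limits.cokernel.desc (Limits.biprod.lift α (-β))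
      (Limits.biprod.desc i j) _) (n + 1))).toLinearEquiv, δ, fun w => ?_,
      hδ₁, hδ₂⟩
  have : Limits.biprod.desc i j = Limits.cokernel.π (Limits.biprod.lift α (-β)) ≫
      Limits.cokernel.desc (Limits.biprod.lift α (-β)) (Limits.biprod.desc i j)
        (by simp [h.comm]) := by simp
  conv_rhs => rw [this, homologyMap_comp]
  rfl

theorem Excisive.exists_boundary (n : ℕ) : ∃ δ : X.homology (n + 1) →ₗ[ℤ] I.homology n,
    (∀ x, δ x = 0 ↔ ∃ a b, homologyMap i (n + 1) a + homologyMap j (n + 1) b = x) ∧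
    (∀ u, (∃ x, δ x = u) ↔ homologyMap α n u = 0 ∧ homologyMap β n u = 0) := by
  obtain ⟨P, π, e, δ, he, hδ₁, hδ₂⟩ := h.exists_boundary_of_quotient n
  refine ⟨δ ∘ₗ e.symm.toLinearMap, fun x => (hδ₁ _).trans ⟨?_, ?_⟩, fun u => ?_⟩
  · rintro ⟨w, hw⟩
    refine ⟨_, _, (homologyMap_desc_apply i j (n + 1) w).symm.trans ?_⟩
    rw [← he, hw]
    exact e.apply_symm_apply x
  · rintro ⟨a, b, rfl⟩
    obtain ⟨w, rfl, rfl⟩ := exists_homology_biprod (n + 1) a b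
    refine ⟨w, ?_⟩
    rw [← homologyMap_desc_apply, ← he]
    exact (e.symm_apply_apply _).symm
  · have h1 : (∃ x, (δ ∘ₗ e.symm.toLinearMap) x = u) ↔ ∃ x, δ x = u :=
      ⟨fun ⟨x, hx⟩ => ⟨_, hx⟩, fun ⟨x, hx⟩ => ⟨e x, by simpa using hx⟩⟩
    rw [h1, hδ₂]
    have hf : homologyMap (Limits.biprod.fst : A ⊞ B ⟶ A) n
        (homologyMap (Limits.biprod.lift α (-β)) n u) = homologyMap α n u := by
      rw [← ModuleCat.comp_apply, ← homologyMap_comp]; simp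
    have hs : homologyMap (Limits.biprod.snd : A ⊞ B ⟶ B) n
        (homologyMap (Limits.biprod.lift α (-β)) n u) = -homologyMap β n u := by
      rw [← ModuleCat.comp_apply, ← homologyMap_comp]; simp
    constructor
    · intro h0
      rw [← hf, ← neg_eq_zero (a := homologyMap β n u), ← hs, h0]
      exact ⟨map_zero _, map_zero _⟩
    · rintro ⟨h1, h2⟩
      apply homology_biprod_ext
      · rw [hf, h1, map_zero]
      · rw [hs, h2, map_zero, neg_zero]

theorem Excisive.exists_of_homology_zero (x : X.homology 0) :
    ∃ a b, homologyMap i 0 a + homologyMap j 0 b = x := by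
  have := h.isIso_homologyMap 0
  set q := Limits.cokernel.desc
    (Limits.biprod.lift α (-β)) (Limits.biprod.desc i j) (by simp [h.comm]) with hq
  have hqπ : Limits.cokernel.π (Limits.biprod.lift α (-β)) ≫ q = Limits.biprod.desc i j := by
    simp [hq]
  obtain ⟨y, rfl⟩ := (ConcreteCategory.isIso_iff_bijective _).1 this |>.2 x
  obtain ⟨w, rfl⟩ := homologyMap_zero_surjective (Limits.cokernel.π (Limits.biprod.lift α (-β)))
    ((ModuleCat.epi_iff_surjective _).1 inferInstance) y
  refine ⟨_, _, (homologyMap_desc_apply i j 0 w).symm.trans ?_⟩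
  rw [← hqπ, homologyMap_comp]
  rfl

end MayerVietoris

end HomologicalComplex

/-- Formal integral combinations of `k`-tuples of elements of `P`. -/
abbrev TupleChain (P : Type) (k : ℕ) : Type := (Fin k → P) →₀ ℤ

namespace TupleChain

variable {P Q : Type} {k : ℕ}

/-- The alternating sum of the faces of a tuple. -/
noncomputable def boundary (P : Type) (k : ℕ) : TupleChain P (k + 1) →ₗ[ℤ] TupleChain P k :=
  Finsupp.linearCombination ℤ fun v =>
    ∑ i : Fin (k + 1), (-1 : ℤ) ^ (i : ℕ) • Finsupp.single (v ∘ i.succAbove) 1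

/-- The cone with apex `p`. -/
noncomputable def cone (p : P) (k : ℕ) : TupleChain P k →ₗ[ℤ] TupleChain P (k + 1) :=
  Finsupp.lmapDomain ℤ ℤ fun v : Fin k → P => (Fin.cons p v : Fin (k + 1) → P)

theorem boundary_single (v : Fin (k + 1) → P) : boundary P k (Finsupp.single v 1) =
    ∑ i : Fin (k + 1), (-1 : ℤ) ^ (i : ℕ) • Finsupp.single (v ∘ i.succAbove) 1 := by
  simp [boundary]

theorem cone_single (p : P) (v : Fin k → P) :
    cone p k (Finsupp.single v 1) = Finsupp.single (Fin.cons p v : Fin (k + 1) → P) 1 := by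
  simp [cone]

theorem boundary_cone_zero (p : P) (c : TupleChain P 0) : boundary P 0 (cone p 0 c) = c := by
  have : boundary P 0 ∘ₗ cone p 0 = LinearMap.id := by
    ext v : 2
    simp only [LinearMap.comp_apply, Finsupp.lsingle_apply, cone_single, boundary_single,
      LinearMap.id_apply]
    simp
  exact LinearMap.congr_fun this c

theorem boundary_cone (p : P) (c : TupleChain P (k + 1)) :
    boundary P (k + 1) (cone p (k + 1) c) = c - cone p k (boundary P k c) := by
  have : boundary P (k + 1) ∘ₗ cone p (k + 1) = LinearMap.id - cone p k ∘ₗ boundary P k := by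
    ext v : 2
    simp only [LinearMap.comp_apply, Finsupp.lsingle_apply, cone_single, boundary_single,
      LinearMap.id_apply, LinearMap.sub_apply, map_sum, map_smul]
    rw [Fin.sum_univ_succ, sub_eq_add_neg, ← Finset.sum_neg_distrib]
    congr 1
    · simp only [Fin.val_zero, pow_zero, one_smul]
      congr 1
    · refine Finset.sum_congr rfl fun i _ => ?_
      rw [Fin.val_succ, pow_succ, mul_neg_one, neg_smul]
      congr 3
      funext j
      refine Fin.cases ?_ (fun j => ?_) j <;> simp
  exact LinearMap.congr_fun this c

theorem boundary_boundary (c : TupleChain P (k + 2)) :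
    boundary P k (boundary P (k + 1) c) = 0 := by
  induction k with
  | zero =>
    induction c using Finsupp.induction_linear with
    | zero => simp
    | add f g hf hg => rw [map_add, map_add, hf, hg, add_zero]
    | single v a =>
      rw [← mul_one a, ← smul_eq_mul, ← Finsupp.smul_single, map_smul, map_smul,
        ← Fin.cons_self_tail v, ← cone_single, boundary_cone, map_sub, boundary_cone_zero,
        sub_self, smul_zero]
  | succ k ih =>
    induction c using Finsupp.induction_linear with
    | zero => simp
    | add f g hf hg => rw [map_add, map_add, hf, hg, add_zero]
    | single v a =>
      rw [← mul_one a, ← smul_eq_mul, ← Finsupp.smul_single, map_smul, map_smul,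
        ← Fin.cons_self_tail v, ← cone_single, boundary_cone, map_sub, boundary_cone, ih,
        map_zero, sub_zero, sub_self, smul_zero]

/-- The map induced on chains of tuples by a map of points. -/
noncomputable def map (f : P → Q) (k : ℕ) : TupleChain P k →ₗ[ℤ] TupleChain Q k :=
  Finsupp.lmapDomain ℤ ℤ (f ∘ ·)

theorem map_single (f : P → Q) (v : Fin k → P) :
    map f k (Finsupp.single v 1) = Finsupp.single (f ∘ v) 1 := by
  simp [map]

theorem map_boundary (f : P → Q) (c : TupleChain P (k + 1)) :
    map f k (boundary P k c) = boundary Q k (map f (k + 1) c) := by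
  have : map f k ∘ₗ boundary P k = boundary Q k ∘ₗ map f (k + 1) := by
    ext v : 2
    simp only [LinearMap.comp_apply, Finsupp.lsingle_apply, boundary_single, map_single,
      map_sum, map_smul]
    rfl
  exact LinearMap.congr_fun this c

theorem map_cone (f : P → Q) (p : P) (c : TupleChain P k) :
    map f (k + 1) (cone p k c) = cone (f p) k (map f k c) := by
  have : map f (k + 1) ∘ₗ cone p k = cone (f p) k ∘ₗ map f k := by
    ext v : 2
    simp only [LinearMap.comp_apply, Finsupp.lsingle_apply, cone_single, map_single]
    congr 1
    funext j
    refine Fin.cases ?_ (fun j => ?_) j <;> simp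
  exact LinearMap.congr_fun this c

section Subdivision

variable (b : ∀ k, (Fin (k + 1) → P) → P)

/-- Barycentric subdivision of chains of tuples, where `b` assigns to a tuple its barycenter. -/
noncomputable def sd : ∀ k, TupleChain P k →ₗ[ℤ] TupleChain P k
  | 0 => LinearMap.id
  | k + 1 => Finsupp.linearCombination ℤ fun v =>
      cone (b k v) k (sd k (boundary P k (Finsupp.single v 1)))

/-- The chain homotopy from the identity to the barycentric subdivision. -/
noncomputable def sdHomotopy : ∀ k, TupleChain P k →ₗ[ℤ] TupleChain P (k + 1)
  | 0 => 0
  | k + 1 => Finsupp.linearCombination ℤ fun v =>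
      cone (b k v) (k + 1) (Finsupp.single v 1 -
        sdHomotopy k (boundary P k (Finsupp.single v 1)))

theorem sd_single (v : Fin (k + 1) → P) : sd b (k + 1) (Finsupp.single v 1) =
    cone (b k v) k (sd b k (boundary P k (Finsupp.single v 1))) := by
  simp [sd]

theorem sdHomotopy_single (v : Fin (k + 1) → P) : sdHomotopy b (k + 1) (Finsupp.single v 1) =
    cone (b k v) (k + 1) (Finsupp.single v 1 -
        sdHomotopy b k (boundary P k (Finsupp.single v 1))) := by
  simp [sdHomotopy]

theorem boundary_sd (c : TupleChain P (k + 1)) :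
    boundary P k (sd b (k + 1) c) = sd b k (boundary P k c) := by
  have : boundary P k ∘ₗ sd b (k + 1) = sd b k ∘ₗ boundary P k := by
    clear c
    induction k with
    | zero =>
      ext v : 2
      simp only [LinearMap.comp_apply, Finsupp.lsingle_apply, sd_single, boundary_cone_zero]
    | succ k ih =>
      ext v : 2
      simp only [LinearMap.comp_apply, Finsupp.lsingle_apply, sd_single (k := k + 1),
        boundary_cone]
      rw [← LinearMap.comp_apply (boundary P k), ih, LinearMap.comp_apply, boundary_boundary,
        map_zero, map_zero, sub_zero]
  exact LinearMap.congr_fun this c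

theorem boundary_sdHomotopy_zero (c : TupleChain P 1) :
    boundary P 1 (sdHomotopy b 1 c) = c - sd b 1 c := by
  have : boundary P 1 ∘ₗ sdHomotopy b 1 = LinearMap.id - sd b 1 := by
    ext v : 2
    simp only [LinearMap.comp_apply, Finsupp.lsingle_apply, sdHomotopy_single, sd_single,
      LinearMap.sub_apply, LinearMap.id_apply, boundary_cone]
    simp [sdHomotopy, sd]
  exact LinearMap.congr_fun this c

theorem boundary_sdHomotopy (c : TupleChain P (k + 2)) :
    boundary P (k + 2) (sdHomotopy b (k + 2) c) =
      c - sd b (k + 2) c - sdHomotopy b (k + 1) (boundary P (k + 1) c) := by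
  induction k with
  | zero =>
    have : boundary P 2 ∘ₗ sdHomotopy b 2 =
        LinearMap.id - sd b 2 - sdHomotopy b 1 ∘ₗ boundary P 1 := by
      ext v : 2
      simp only [LinearMap.comp_apply, Finsupp.lsingle_apply, sdHomotopy_single (k := 1),
        sd_single (k := 1), LinearMap.sub_apply, LinearMap.id_apply, boundary_cone, map_sub,
        boundary_sdHomotopy_zero]
      abel
    exact LinearMap.congr_fun this c
  | succ k ih =>
    have : boundary P (k + 3) ∘ₗ sdHomotopy b (k + 3) =
        LinearMap.id - sd b (k + 3) - sdHomotopy b (k + 2) ∘ₗ boundary P (k + 2) := by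
      ext v : 2
      simp only [LinearMap.comp_apply, Finsupp.lsingle_apply, sdHomotopy_single (k := k + 2),
        sd_single (k := k + 2), LinearMap.sub_apply, LinearMap.id_apply, boundary_cone, map_sub,
        ih, boundary_boundary, map_zero]
      abel
    exact LinearMap.congr_fun this c

variable {b} {b' : ∀ k, (Fin (k + 1) → Q) → Q} {f : P → Q}
  (hf : ∀ k v, f (b k v) = b' k (f ∘ v))

include hf

theorem map_sd (c : TupleChain P k) : map f k (sd b k c) = sd b' k (map f k c) := by
  have : map f k ∘ₗ sd b k = sd b' k ∘ₗ map f k := by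
    clear c
    induction k with
    | zero => rfl
    | succ k ih =>
      ext v : 2
      simp only [LinearMap.comp_apply, Finsupp.lsingle_apply, sd_single, map_cone, map_single, hf]
      rw [← LinearMap.comp_apply (map f k), ih, LinearMap.comp_apply, map_boundary, map_single]
  exact LinearMap.congr_fun this c

theorem map_sdHomotopy (c : TupleChain P k) :
    map f (k + 1) (sdHomotopy b k c) = sdHomotopy b' k (map f k c) := by
  have : map f (k + 1) ∘ₗ sdHomotopy b k = sdHomotopy b' k ∘ₗ map f k := by
    clear c
    induction k with
    | zero => simp [sdHomotopy]
    | succ k ih =>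
      ext v : 2
      simp only [LinearMap.comp_apply, Finsupp.lsingle_apply, sdHomotopy_single, map_cone,
        map_single, hf, map_sub]
      rw [← LinearMap.comp_apply (map f (k + 1)), ih, LinearMap.comp_apply, map_boundary,
        map_single]
  exact LinearMap.congr_fun this c

end Subdivision

end TupleChain

/-- The standard topological simplex. -/
abbrev TopSimplex (n : ℕ) : Type := stdSimplex ℝ (Fin (n + 1))

namespace TopSimplex

variable {n m N : ℕ}

/-- The affine map between standard simplices with prescribed values on the vertices. -/
noncomputable def affine (v : Fin (n + 1) → TopSimplex N) : C(TopSimplex n, TopSimplex N) where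
  toFun t := ⟨∑ i, t i • (v i : Fin (N + 1) → ℝ),
    (convex_stdSimplex ℝ (Fin (N + 1))).sum_mem (fun i _ => stdSimplex.zero_le t i) (stdSimplex.sum_eq_one t)
      fun i _ => (v i).2⟩
  continuous_toFun := by
    refine Continuous.subtype_mk (continuous_finsetSum _ fun i _ => ?_) _
    exact ((continuous_apply i).comp continuous_subtype_val).smul continuous_const

theorem affine_coe (v : Fin (n + 1) → TopSimplex N) (t : TopSimplex n) :
    (affine v t : Fin (N + 1) → ℝ) = ∑ i, t i • (v i : Fin (N + 1) → ℝ) := rfl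

theorem affine_apply (v : Fin (n + 1) → TopSimplex N) (t : TopSimplex n) (k : Fin (N + 1)) :
    affine v t k = ∑ i, t i * v i k := by
  rw [affine_coe, Finset.sum_apply]
  rfl

theorem affine_affine (u : Fin (n + 1) → TopSimplex N) (v : Fin (m + 1) → TopSimplex n)
    (t : TopSimplex m) : affine u (affine v t) = affine (affine u ∘ v) t := by
  refine stdSimplex.ext (funext fun k => ?_)
  simp only [affine_apply, Function.comp_apply, Finset.sum_mul, Finset.mul_sum]
  rw [Finset.sum_comm]
  simp only [mul_assoc]

theorem affine_comp_affine (u : Fin (n + 1) → TopSimplex N) (v : Fin (m + 1) → TopSimplex n) :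
    (affine u).comp (affine v) = affine (affine u ∘ v) :=
  ContinuousMap.ext (affine_affine u v)

theorem affine_vertex (v : Fin (n + 1) → TopSimplex N) (i : Fin (n + 1)) :
    affine v (stdSimplex.vertex i) = v i := by
  refine stdSimplex.ext (funext fun k => ?_)
  simp only [affine_apply]
  rw [Finset.sum_eq_single i]
  · simp
  · intro j _ hj
    simp [hj]
  · simp

theorem affine_comp_vertex (v : Fin (n + 1) → TopSimplex N) :
    affine v ∘ stdSimplex.vertex = v :=
  funext (affine_vertex v)

theorem affine_map_vertex (f : Fin (n + 1) → Fin (m + 1)) (t : TopSimplex n) :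
    affine (fun i => stdSimplex.vertex (f i)) t = stdSimplex.map f t := by
  refine stdSimplex.ext (funext fun k => ?_)
  simp only [affine_apply, stdSimplex.map_coe, FunOnFinite.linearMap_apply_apply]
  simp [Finset.sum_filter, Pi.single_apply, eq_comm]

theorem affine_vertex_eq_id :
    affine (stdSimplex.vertex : Fin (n + 1) → TopSimplex n) = ContinuousMap.id _ := by
  ext1 t
  have := affine_map_vertex (n := n) (m := n) id t
  rw [stdSimplex.map_id_apply] at this
  exact this

/-- The barycenter of a tuple of points of a simplex. -/
noncomputable def center (n : ℕ) (v : Fin (n + 1) → TopSimplex N) : TopSimplex N :=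
  affine v stdSimplex.barycenter

theorem affine_center (u : Fin (n + 1) → TopSimplex N) (m : ℕ)
    (v : Fin (m + 1) → TopSimplex n) : affine u (center m v) = center m (affine u ∘ v) :=
  affine_affine u v _

/-- The points of the affine simplex spanned by `v` lie in every closed ball containing `v`. -/
theorem dist_affine_le (v : Fin (n + 1) → TopSimplex N) (p : TopSimplex N) (r : ℝ)
    (h : ∀ i, dist (v i) p ≤ r) (t : TopSimplex n) : dist (affine v t) p ≤ r := by
  have := (convex_closedBall (p : Fin (N + 1) → ℝ) r).sum_mem (t := Finset.univ)
    (w := fun i => t i) (z := fun i => (v i : Fin (N + 1) → ℝ))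
    (fun i _ => stdSimplex.zero_le t i) (stdSimplex.sum_eq_one t) fun i _ => h i
  exact this

theorem dist_center_le (v : Fin (n + 1) → TopSimplex N) (D : ℝ)
    (h : ∀ i j, dist (v i) (v j) ≤ D) (i : Fin (n + 1)) :
    dist (center n v) (v i) ≤ n / (n + 1) * D := by
  have hn : (0 : ℝ) < n + 1 := by positivity
  have hD : 0 ≤ D := dist_nonneg.trans (h i i)
  rw [Subtype.dist_eq, dist_pi_le_iff (by positivity)]
  intro k
  have hk : center n v k = ∑ j, (n + 1 : ℝ)⁻¹ * v j k := by
    rw [center, affine_apply]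
    refine Finset.sum_congr rfl fun j _ => ?_
    congr 1
    exact (stdSimplex.barycenter_apply j).trans (by simp)
  have h1 : (center n v k : ℝ) - v i k = (n + 1 : ℝ)⁻¹ * ∑ j ∈ Finset.univ.erase i, (v j k - v i k) := by
    rw [← Finset.add_sum_erase _ _ (Finset.mem_univ i)] at hk
    rw [hk, Finset.sum_sub_distrib, ← Finset.mul_sum]
    simp
    field_simp
    ring
  change |center n v k - v i k| ≤ _
  rw [h1, abs_mul, abs_of_pos (inv_pos.2 hn)]
  have h2 : |∑ j ∈ Finset.univ.erase i, (v j k - v i k)| ≤ n * D := by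
    refine (Finset.abs_sum_le_sum_abs _ _).trans ((Finset.sum_le_card_nsmul _ _ D ?_).trans ?_)
    · intro j _
      exact (dist_le_pi_dist (v j : Fin (N + 1) → ℝ) (v i) k).trans (h j i)
    · simp
  calc (n + 1 : ℝ)⁻¹ * |∑ j ∈ Finset.univ.erase i, (v j k - v i k)|
      ≤ (n + 1 : ℝ)⁻¹ * (n * D) := by gcongr
    _ = _ := by ring

end TopSimplex

theorem Finsupp.map_mem_supported {α β : Type} {S : Set α} {T : Set β}
    (F : (α →₀ ℤ) →ₗ[ℤ] (β →₀ ℤ))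
    (hF : ∀ a ∈ S, F (Finsupp.single a 1) ∈ Finsupp.supported ℤ ℤ T) {c : α →₀ ℤ}
    (hc : c ∈ Finsupp.supported ℤ ℤ S) : F c ∈ Finsupp.supported ℤ ℤ T := by
  have : Finsupp.supported ℤ ℤ S ≤ (Finsupp.supported ℤ ℤ T).comap F := by
    rw [Finsupp.supported_eq_span_single, Submodule.span_le]
    rintro _ ⟨a, ha, rfl⟩
    exact hF a ha
  exact this hc

namespace TupleChain

variable {N k n : ℕ}

theorem boundary_single_mem_supported {P : Type} {S : Set (Fin k → P)} (v : Fin (k + 1) → P)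
    (h : ∀ i : Fin (k + 1), v ∘ i.succAbove ∈ S) :
    boundary P k (Finsupp.single v 1) ∈ Finsupp.supported ℤ ℤ S := by
  rw [boundary_single]
  exact Submodule.sum_mem _ fun i _ =>
    Submodule.smul_mem _ _ (Finsupp.single_mem_supported ℤ _ (h i))

theorem sd_single_mem_of_dist_le (v : Fin k → TopSimplex N) (p : TopSimplex N) (r : ℝ)
    (h : ∀ i, dist (v i) p ≤ r) :
    sd TopSimplex.center k (Finsupp.single v 1) ∈
      Finsupp.supported ℤ ℤ {w : Fin k → TopSimplex N | ∀ i, dist (w i) p ≤ r} := by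
  induction k with
  | zero => exact Finsupp.single_mem_supported ℤ _ h
  | succ k ih =>
    rw [sd_single]
    refine Finsupp.map_mem_supported (S := {w : Fin k → TopSimplex N | ∀ i, dist (w i) p ≤ r})
      _ (fun w hw => ?_) (Finsupp.map_mem_supported _ (fun w hw => ih w hw)
        (boundary_single_mem_supported _ fun i j => h _))
    rw [cone_single]
    refine Finsupp.single_mem_supported ℤ _ fun i => ?_
    refine Fin.cases ?_ (fun j => ?_) i
    · exact TopSimplex.dist_affine_le v p r h _
    · exact hw j

/-- Barycentric subdivision shrinks the diameter by a definite factor. -/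
theorem sd_single_mem_of_diam_le (hk : k ≤ n + 1) (v : Fin k → TopSimplex N) (D : ℝ)
    (hD : 0 ≤ D) (h : ∀ i j, dist (v i) (v j) ≤ D) :
    sd TopSimplex.center k (Finsupp.single v 1) ∈
      Finsupp.supported ℤ ℤ {w : Fin k → TopSimplex N |
        ∀ i j, dist (w i) (w j) ≤ n / (n + 1) * D} := by
  induction k with
  | zero => exact Finsupp.single_mem_supported ℤ _ fun i => i.elim0
  | succ k ih =>
    have hkn : (k : ℝ) / (k + 1) * D ≤ n / (n + 1) * D := by
      have : (k : ℝ) ≤ n := by exact_mod_cast Nat.le_of_succ_le_succ hk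
      gcongr ?_ * D
      rw [div_le_div_iff₀ (by positivity) (by positivity)]
      linarith
    have hp : ∀ i, dist (v i) (TopSimplex.center k v) ≤ n / (n + 1) * D := fun i => by
      rw [dist_comm]
      exact (TopSimplex.dist_center_le v D h i).trans hkn
    rw [sd_single]
    refine Finsupp.map_mem_supported
      (S := {w : Fin k → TopSimplex N | ∀ i j, dist (w i) (w j) ≤ n / (n + 1) * D} ∩
        {w : Fin k → TopSimplex N | ∀ i, dist (w i) (TopSimplex.center k v) ≤ n / (n + 1) * D})
      _ (fun w hw => ?_) ?_
    · rw [cone_single]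
      refine Finsupp.single_mem_supported ℤ _ fun i j => ?_
      refine Fin.cases ?_ (fun i => ?_) i <;> refine Fin.cases ?_ (fun j => ?_) j
      · simp only [Fin.cons_zero, dist_self]
        positivity
      · simp only [Fin.cons_zero, Fin.cons_succ]
        rw [dist_comm]
        exact hw.2 j
      · exact hw.2 i
      · exact hw.1 i j
    · rw [Finsupp.supported_inter]
      constructor
      · exact Finsupp.map_mem_supported
          (S := {w : Fin k → TopSimplex N | ∀ i j, dist (w i) (w j) ≤ D}) _
          (fun w hw => ih (by lia) w hw)
          (boundary_single_mem_supported _ fun i j l => h _ _)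
      · exact Finsupp.map_mem_supported
          (S := {w : Fin k → TopSimplex N |
            ∀ i, dist (w i) (TopSimplex.center k v) ≤ n / (n + 1) * D}) _
          (fun w hw => sd_single_mem_of_dist_le w _ _ hw)
          (boundary_single_mem_supported _ fun i j => hp _)

theorem iterate_sd_mem_of_diam_le (v : Fin (n + 1) → TopSimplex N) (D : ℝ)
    (hD : 0 ≤ D) (h : ∀ i j, dist (v i) (v j) ≤ D) (l : ℕ) :
    (sd TopSimplex.center (n + 1))^[l] (Finsupp.single v 1) ∈
      Finsupp.supported ℤ ℤ {w : Fin (n + 1) → TopSimplex N |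
        ∀ i j, dist (w i) (w j) ≤ ((n : ℝ) / (n + 1)) ^ l * D} := by
  induction l with
  | zero => exact Finsupp.single_mem_supported ℤ _ (by simpa using h)
  | succ l ih =>
    rw [Function.iterate_succ_apply']
    refine Finsupp.map_mem_supported _ (fun w hw => ?_) ih
    have := sd_single_mem_of_diam_le le_rfl w _ (by positivity) hw
    rwa [← mul_assoc, ← pow_succ'] at this

end TupleChain

/-- Singular chains with integral coefficients. -/
abbrev SingularChain (X : Type) [TopologicalSpace X] (n : ℕ) : Type := C(TopSimplex n, X) →₀ ℤ

namespace SingularChain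

variable {X Y Z : Type} [TopologicalSpace X] [TopologicalSpace Y] [TopologicalSpace Z] {n N : ℕ}

/-- The chain map induced by a continuous map. -/
noncomputable def map (f : C(X, Y)) (n : ℕ) : SingularChain X n →ₗ[ℤ] SingularChain Y n :=
  Finsupp.lmapDomain ℤ ℤ f.comp

theorem map_single (f : C(X, Y)) (σ : C(TopSimplex n, X)) :
    map f n (Finsupp.single σ 1) = Finsupp.single (f.comp σ) 1 := by
  simp [map]

theorem map_map (g : C(Y, Z)) (f : C(X, Y)) (c : SingularChain X n) :
    map g n (map f n c) = map (g.comp f) n c :=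
  (Finsupp.mapDomain_comp (f := f.comp) (g := g.comp)).symm

/-- The inclusion of a face of the standard simplex. -/
noncomputable def face (i : Fin (n + 2)) : C(TopSimplex n, TopSimplex (n + 1)) :=
  TopSimplex.affine (stdSimplex.vertex ∘ i.succAbove)

/-- The boundary of a singular chain. -/
noncomputable def boundary (X : Type) [TopologicalSpace X] (n : ℕ) :
    SingularChain X (n + 1) →ₗ[ℤ] SingularChain X n :=
  Finsupp.linearCombination ℤ fun σ =>
    ∑ i : Fin (n + 2), (-1 : ℤ) ^ (i : ℕ) • Finsupp.single (σ.comp (face i)) 1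

theorem boundary_single (σ : C(TopSimplex (n + 1), X)) :
    boundary X n (Finsupp.single σ 1) =
      ∑ i : Fin (n + 2), (-1 : ℤ) ^ (i : ℕ) • Finsupp.single (σ.comp (face i)) 1 := by
  simp [boundary]

theorem map_boundary (f : C(X, Y)) (c : SingularChain X (n + 1)) :
    map f n (boundary X n c) = boundary Y n (map f (n + 1) c) := by
  have : map f n ∘ₗ boundary X n = boundary Y n ∘ₗ map f (n + 1) := by
    ext v : 2
    simp only [LinearMap.comp_apply, Finsupp.lsingle_apply, boundary_single, map_single,
      map_sum, map_smul]
    rfl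
  exact LinearMap.congr_fun this c

/-- The affine singular chain defined by a chain of tuples of points. -/
noncomputable def ofTuple (N n : ℕ) :
    TupleChain (TopSimplex N) (n + 1) →ₗ[ℤ] SingularChain (TopSimplex N) n :=
  Finsupp.lmapDomain ℤ ℤ TopSimplex.affine

theorem ofTuple_single (v : Fin (n + 1) → TopSimplex N) :
    ofTuple N n (Finsupp.single v 1) = Finsupp.single (TopSimplex.affine v) 1 := by
  simp [ofTuple]

theorem ofTuple_boundary (c : TupleChain (TopSimplex N) (n + 2)) :
    ofTuple N n (TupleChain.boundary _ _ c) = boundary _ _ (ofTuple N (n + 1) c) := by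
  have : ofTuple N n ∘ₗ TupleChain.boundary _ _ = boundary _ _ ∘ₗ ofTuple N (n + 1) := by
    ext v : 2
    simp only [LinearMap.comp_apply, Finsupp.lsingle_apply, boundary_single, ofTuple_single,
      map_sum, map_smul, TupleChain.boundary_single]
    refine Finset.sum_congr rfl fun i _ => ?_
    rw [face, TopSimplex.affine_comp_affine, ← Function.comp_assoc,
      TopSimplex.affine_comp_vertex]
  exact LinearMap.congr_fun this c

theorem map_ofTuple (u : Fin (n + 1) → TopSimplex N) {m : ℕ}
    (c : TupleChain (TopSimplex n) (m + 1)) :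
    map (TopSimplex.affine u) m (ofTuple n m c) =
      ofTuple N m (TupleChain.map (TopSimplex.affine u) (m + 1) c) := by
  have : map (TopSimplex.affine u) m ∘ₗ ofTuple n m =
      ofTuple N m ∘ₗ TupleChain.map (TopSimplex.affine u) (m + 1) := by
    ext v : 2
    simp only [LinearMap.comp_apply, Finsupp.lsingle_apply, map_single, ofTuple_single,
      TupleChain.map_single, TopSimplex.affine_comp_affine]
  exact LinearMap.congr_fun this c

/-- The tautological chain of the standard simplex. -/
noncomputable def vertices (n : ℕ) : TupleChain (TopSimplex n) (n + 1) :=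
  Finsupp.single stdSimplex.vertex 1

theorem map_ofTuple_vertices (σ : C(TopSimplex n, X)) :
    map σ n (ofTuple n n (vertices n)) = Finsupp.single σ 1 := by
  rw [vertices, ofTuple_single, map_single, TopSimplex.affine_vertex_eq_id, ContinuousMap.comp_id]

theorem tupleMap_vertices (v : Fin (n + 1) → TopSimplex N) :
    TupleChain.map (TopSimplex.affine v) (n + 1) (vertices n) = Finsupp.single v 1 := by
  rw [vertices, TupleChain.map_single, TopSimplex.affine_comp_vertex]

/-- Barycentric subdivision of singular chains. -/
noncomputable def sd (X : Type) [TopologicalSpace X] (n : ℕ) :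
    SingularChain X n →ₗ[ℤ] SingularChain X n :=
  Finsupp.linearCombination ℤ fun σ =>
    map σ n (ofTuple n n (TupleChain.sd TopSimplex.center (n + 1) (vertices n)))

/-- The chain homotopy from the identity to barycentric subdivision. -/
noncomputable def sdHomotopy (X : Type) [TopologicalSpace X] (n : ℕ) :
    SingularChain X n →ₗ[ℤ] SingularChain X (n + 1) :=
  Finsupp.linearCombination ℤ fun σ =>
    map σ (n + 1) (ofTuple n (n + 1)
      (TupleChain.sdHomotopy TopSimplex.center (n + 1) (vertices n)))

theorem sd_single (σ : C(TopSimplex n, X)) : sd X n (Finsupp.single σ 1) =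
    map σ n (ofTuple n n (TupleChain.sd TopSimplex.center (n + 1) (vertices n))) := by
  simp [sd]

theorem sdHomotopy_single (σ : C(TopSimplex n, X)) : sdHomotopy X n (Finsupp.single σ 1) =
    map σ (n + 1) (ofTuple n (n + 1)
      (TupleChain.sdHomotopy TopSimplex.center (n + 1) (vertices n))) := by
  simp [sdHomotopy]

theorem map_sd (f : C(X, Y)) (c : SingularChain X n) :
    map f n (sd X n c) = sd Y n (map f n c) := by
  have : map f n ∘ₗ sd X n = sd Y n ∘ₗ map f n := by
    ext v : 2
    simp only [LinearMap.comp_apply, Finsupp.lsingle_apply, map_single, sd_single, map_map]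
  exact LinearMap.congr_fun this c

theorem map_sdHomotopy (f : C(X, Y)) (c : SingularChain X n) :
    map f (n + 1) (sdHomotopy X n c) = sdHomotopy Y n (map f n c) := by
  have : map f (n + 1) ∘ₗ sdHomotopy X n = sdHomotopy Y n ∘ₗ map f n := by
    ext v : 2
    simp only [LinearMap.comp_apply, Finsupp.lsingle_apply, map_single, sdHomotopy_single, map_map]
  exact LinearMap.congr_fun this c

theorem sd_ofTuple (c : TupleChain (TopSimplex N) (n + 1)) :
    sd _ n (ofTuple N n c) = ofTuple N n (TupleChain.sd TopSimplex.center (n + 1) c) := by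
  have : sd _ n ∘ₗ ofTuple N n = ofTuple N n ∘ₗ TupleChain.sd TopSimplex.center (n + 1) := by
    ext v : 2
    simp only [LinearMap.comp_apply, Finsupp.lsingle_apply, ofTuple_single]
    rw [sd_single, map_ofTuple, TupleChain.map_sd (TopSimplex.affine_center v), tupleMap_vertices]
  exact LinearMap.congr_fun this c

theorem sdHomotopy_ofTuple (c : TupleChain (TopSimplex N) (n + 1)) :
    sdHomotopy _ n (ofTuple N n c) =
      ofTuple N (n + 1) (TupleChain.sdHomotopy TopSimplex.center (n + 1) c) := by
  have : sdHomotopy _ n ∘ₗ ofTuple N n =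
      ofTuple N (n + 1) ∘ₗ TupleChain.sdHomotopy TopSimplex.center (n + 1) := by
    ext v : 2
    simp only [LinearMap.comp_apply, Finsupp.lsingle_apply, ofTuple_single]
    rw [sdHomotopy_single, map_ofTuple, TupleChain.map_sdHomotopy (TopSimplex.affine_center v),
      tupleMap_vertices]
  exact LinearMap.congr_fun this c

theorem boundary_sd (c : SingularChain X (n + 1)) :
    boundary X n (sd X (n + 1) c) = sd X n (boundary X n c) := by
  have : boundary X n ∘ₗ sd X (n + 1) = sd X n ∘ₗ boundary X n := by
    ext σ : 2
    simp only [LinearMap.comp_apply, Finsupp.lsingle_apply]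
    rw [sd_single, ← map_boundary, ← ofTuple_boundary, TupleChain.boundary_sd, ← sd_ofTuple,
      map_sd, ofTuple_boundary, map_boundary, map_ofTuple_vertices]
  exact LinearMap.congr_fun this c

theorem boundary_sdHomotopy_zero (c : SingularChain X 0) :
    boundary X 0 (sdHomotopy X 0 c) = c - sd X 0 c := by
  have : boundary X 0 ∘ₗ sdHomotopy X 0 = LinearMap.id - sd X 0 := by
    ext σ : 2
    simp only [LinearMap.comp_apply, Finsupp.lsingle_apply, LinearMap.sub_apply,
      LinearMap.id_apply]
    rw [sdHomotopy_single, ← map_boundary, ← ofTuple_boundary,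
      TupleChain.boundary_sdHomotopy_zero, map_sub, map_sub, map_ofTuple_vertices, sd_single]
  exact LinearMap.congr_fun this c

theorem boundary_sdHomotopy (c : SingularChain X (n + 1)) :
    boundary X (n + 1) (sdHomotopy X (n + 1) c) =
      c - sd X (n + 1) c - sdHomotopy X n (boundary X n c) := by
  have : boundary X (n + 1) ∘ₗ sdHomotopy X (n + 1) =
      LinearMap.id - sd X (n + 1) - sdHomotopy X n ∘ₗ boundary X n := by
    ext σ : 2
    simp only [LinearMap.comp_apply, Finsupp.lsingle_apply, LinearMap.sub_apply,
      LinearMap.id_apply]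
    rw [sdHomotopy_single, ← map_boundary, ← ofTuple_boundary,
      TupleChain.boundary_sdHomotopy, map_sub, map_sub, map_sub, map_sub, map_ofTuple_vertices,
      sd_single, ← sdHomotopy_ofTuple, map_sdHomotopy, ofTuple_boundary, map_boundary,
      map_ofTuple_vertices]
  exact LinearMap.congr_fun this c

/-- The chains all of whose simplices are contained in one of the sets `A` and `B`. -/
def small (A B : Set X) (n : ℕ) : Submodule ℤ (SingularChain X n) :=
  Finsupp.supported ℤ ℤ {σ | Set.range σ ⊆ A ∨ Set.range σ ⊆ B}

theorem map_mem_small {A B : Set X} {m : ℕ} (σ : C(TopSimplex m, X))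
    (hσ : Set.range σ ⊆ A ∨ Set.range σ ⊆ B) (c : SingularChain (TopSimplex m) n) :
    map σ n c ∈ small A B n := by
  refine Finsupp.map_mem_supported (S := Set.univ) _ (fun τ _ => ?_) (by simp)
  rw [map_single]
  refine Finsupp.single_mem_supported ℤ _ ?_
  have h : Set.range (σ.comp τ) ⊆ Set.range σ := Set.range_comp_subset_range τ σ
  exact hσ.imp h.trans h.trans

theorem sd_mem_small {A B : Set X} {c : SingularChain X n} (hc : c ∈ small A B n) :
    sd X n c ∈ small A B n :=
  Finsupp.map_mem_supported _ (fun σ hσ => by rw [sd_single]; exact map_mem_small σ hσ _) hc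

theorem sdHomotopy_mem_small {A B : Set X} {c : SingularChain X n} (hc : c ∈ small A B n) :
    sdHomotopy X n c ∈ small A B (n + 1) :=
  Finsupp.map_mem_supported _
    (fun σ hσ => by rw [sdHomotopy_single]; exact map_mem_small σ hσ _) hc

theorem iterate_sd_mem_small {A B : Set X} {c : SingularChain X n} (hc : c ∈ small A B n)
    (l : ℕ) : (sd X n)^[l] c ∈ small A B n := by
  induction l with
  | zero => exact hc
  | succ l ih => rw [Function.iterate_succ_apply']; exact sd_mem_small ih

theorem iterate_sd_single (σ : C(TopSimplex n, X)) (l : ℕ) :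
    (sd X n)^[l] (Finsupp.single σ 1) = map σ n (ofTuple n n
      ((TupleChain.sd TopSimplex.center (n + 1))^[l] (vertices n))) := by
  induction l with
  | zero => exact (map_ofTuple_vertices σ).symm
  | succ l ih =>
    rw [Function.iterate_succ_apply', Function.iterate_succ_apply', ih, ← sd_ofTuple, map_sd]

theorem exists_iterate_sd_single_mem_small {A B : Set X} (hA : IsOpen A) (hB : IsOpen B)
    (hAB : A ∪ B = Set.univ) (σ : C(TopSimplex n, X)) :
    ∃ l, (sd X n)^[l] (Finsupp.single σ 1) ∈ small A B n := by
  obtain ⟨δ, hδ, hδ'⟩ := lebesgue_number_lemma_of_metric (s := (Set.univ : Set (TopSimplex n)))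
    (c := fun b : Bool => cond b (σ ⁻¹' A) (σ ⁻¹' B)) isCompact_univ
    (fun b => by
      cases b
      · exact hB.preimage σ.continuous
      · exact hA.preimage σ.continuous)
    (fun x _ => by
      have : σ x ∈ A ∪ B := hAB ▸ Set.mem_univ _
      rcases this with h | h
      · exact Set.mem_iUnion.2 ⟨true, h⟩
      · exact Set.mem_iUnion.2 ⟨false, h⟩)
  have hr : (n : ℝ) / (n + 1) < 1 := by
    rw [div_lt_one (by positivity)]
    linarith
  set D := Metric.diam (Set.univ : Set (TopSimplex n)) with hD
  have hD0 : 0 ≤ D := Metric.diam_nonneg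
  obtain ⟨l, hl⟩ := exists_pow_lt_of_lt_one (show 0 < δ / (D + 1) by positivity) hr
  have hlD : ((n : ℝ) / (n + 1)) ^ l * D < δ := by
    rw [lt_div_iff₀ (by positivity)] at hl
    have : 0 ≤ ((n : ℝ) / (n + 1)) ^ l := by positivity
    nlinarith
  refine ⟨l, ?_⟩
  rw [iterate_sd_single]
  refine Finsupp.map_mem_supported (map σ n ∘ₗ ofTuple n n) (fun w hw => ?_)
    (TupleChain.iterate_sd_mem_of_diam_le stdSimplex.vertex D hD0 (fun i j =>
      Metric.dist_le_diam_of_mem isCompact_univ.isBounded (Set.mem_univ _) (Set.mem_univ _)) l)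
  rw [LinearMap.comp_apply, ofTuple_single, map_single]
  refine Finsupp.single_mem_supported ℤ _ ?_
  obtain ⟨b, hb⟩ := hδ' (w 0) (Set.mem_univ _)
  have hw' : ∀ t, TopSimplex.affine w t ∈ cond b (σ ⁻¹' A) (σ ⁻¹' B) := fun t =>
    hb ((TopSimplex.dist_affine_le w _ _ (fun i => hw i 0) t).trans_lt hlD)
  cases b
  · right
    rintro _ ⟨t, rfl⟩
    exact hw' t
  · left
    rintro _ ⟨t, rfl⟩
    exact hw' t

theorem exists_iterate_sd_mem_small {A B : Set X} (hA : IsOpen A) (hB : IsOpen B)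
    (hAB : A ∪ B = Set.univ) (c : SingularChain X n) :
    ∃ l, (sd X n)^[l] c ∈ small A B n := by
  induction c using Finsupp.induction_linear with
  | zero => exact ⟨0, Submodule.zero_mem _⟩
  | add f g hf hg =>
    obtain ⟨l, hl⟩ := hf
    obtain ⟨m, hm⟩ := hg
    refine ⟨l + m, ?_⟩
    rw [iterate_map_add]
    refine Submodule.add_mem _ ?_ ?_
    · rw [Nat.add_comm l m, Function.iterate_add_apply]
      exact iterate_sd_mem_small hl m
    · rw [Function.iterate_add_apply]
      exact iterate_sd_mem_small hm l
  | single σ a =>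
    obtain ⟨l, hl⟩ := exists_iterate_sd_single_mem_small hA hB hAB σ
    refine ⟨l, ?_⟩
    rw [← mul_one a, ← smul_eq_mul, ← Finsupp.smul_single, ← Module.End.coe_pow, map_smul,
      Module.End.coe_pow]
    exact Submodule.smul_mem _ _ hl

theorem exists_sub_boundary_mem_small {A B : Set X} (l : ℕ) (c : SingularChain X n)
    (hc : (sd X n)^[l] c ∈ small A B n)
    (hd : ∀ m (h : n = m + 1), boundary X m (h ▸ c) ∈ small A B m) :
    ∃ e : SingularChain X (n + 1), c - boundary X n e ∈ small A B n := by
  induction l generalizing c with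
  | zero => exact ⟨0, by simpa using hc⟩
  | succ l ih =>
    cases n with
    | zero =>
      obtain ⟨e, he⟩ := ih (sd X 0 c) hc (by simp)
      refine ⟨e + sdHomotopy X 0 c, ?_⟩
      rw [map_add, boundary_sdHomotopy_zero]
      convert he using 1
      abel
    | succ n =>
      obtain ⟨e, he⟩ := ih (sd X (n + 1) c) hc (fun m h => by
        obtain rfl : n = m := by lia
        rw [boundary_sd]
        exact sd_mem_small (hd n rfl))
      refine ⟨e + sdHomotopy X (n + 1) c, ?_⟩
      rw [map_add, boundary_sdHomotopy]
      convert Submodule.add_mem _ he (sdHomotopy_mem_small (hd n rfl)) using 1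
      abel

/-- The theorem of small simplices. -/
theorem exists_sub_boundary_mem_small_of_isOpen {A B : Set X} (hA : IsOpen A) (hB : IsOpen B)
    (hAB : A ∪ B = Set.univ) (c : SingularChain X n)
    (hd : ∀ m (h : n = m + 1), boundary X m (h ▸ c) ∈ small A B m) :
    ∃ e : SingularChain X (n + 1), c - boundary X n e ∈ small A B n :=
  have ⟨l, hl⟩ := exists_iterate_sd_mem_small hA hB hAB c
  exists_sub_boundary_mem_small l c hl hd

end SingularChain

/-- The singular chain complex, as a functor. -/
noncomputable def singularComplex : TopCat.{0} ⥤ ChainComplex (ModuleCat.{0} ℤ) ℕ :=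
  TopCat.toSSet ⋙ ((SimplicialObject.whiskering _ _).obj (ModuleCat.free ℤ)) ⋙
    AlgebraicTopology.alternatingFaceMapComplex (ModuleCat ℤ)

theorem ModuleCat.sum_smul_apply {M N : ModuleCat.{0} ℤ} {ι : Type} [Fintype ι] (a : ι → ℤ)
    (f : ι → (M ⟶ N)) (x : M) : (∑ i, a i • f i) x = ∑ i, a i • f i x := by
  simp [ModuleCat.hom_sum, LinearMap.sum_apply]

namespace SingularChain

variable {X Y : Type} [TopologicalSpace X] [TopologicalSpace Y] {n : ℕ}

/-- The chains of the singular chain complex are the singular chains. -/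
noncomputable def equiv (X : Type) [TopologicalSpace X] (n : ℕ) :
    (singularComplex.obj (TopCat.of X)).X n ≃ₗ[ℤ] SingularChain X n :=
  Finsupp.domLCongr ((TopCat.of X).toSSetObjEquiv (Opposite.op (SimplexCategory.mk n)))

theorem equiv_symm_single (σ : C(TopSimplex n, X)) :
    (equiv X n).symm (Finsupp.single σ 1) = ModuleCat.freeMk (R := ℤ)
      (((TopCat.of X).toSSetObjEquiv (Opposite.op (SimplexCategory.mk n))).symm σ) := by
  exact Finsupp.domLCongr_single (R := ℤ)
    ((TopCat.of X).toSSetObjEquiv (Opposite.op (SimplexCategory.mk n))).symm σ 1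

theorem map_equiv_symm (f : C(X, Y)) (c : SingularChain X n) :
    (singularComplex.map (TopCat.ofHom f)).f n ((equiv X n).symm c) =
      (equiv Y n).symm (map f n c) := by
  have : ((singularComplex.map (TopCat.ofHom f)).f n).hom ∘ₗ (equiv X n).symm.toLinearMap =
      (equiv Y n).symm.toLinearMap ∘ₗ map f n := by
    ext σ : 2
    simp only [LinearMap.comp_apply, Finsupp.lsingle_apply, map_single, LinearEquiv.coe_coe,
      equiv_symm_single]
    exact ModuleCat.free_map_apply _ _
  exact LinearMap.congr_fun this c

theorem face_eq_map (i : Fin (n + 2)) (t : TopSimplex n) :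
    face i t = stdSimplex.map i.succAbove t :=
  TopSimplex.affine_map_vertex i.succAbove t

theorem singularComplex_d (X : TopCat.{0}) (n : ℕ) (s : (TopCat.toSSet.obj X).obj
    (Opposite.op (SimplexCategory.mk (n + 1)))) :
    (singularComplex.obj X).d (n + 1) n (ModuleCat.freeMk (R := ℤ) s) =
      ∑ i : Fin (n + 2), (-1 : ℤ) ^ (i : ℕ) •
        (ModuleCat.freeMk (R := ℤ) ((TopCat.toSSet.obj X).map (SimplexCategory.δ i).op s) :
          (ModuleCat.free ℤ).obj _) := by
  have h : (singularComplex.obj X).d (n + 1) n = (∑ i : Fin (n + 2), (-1 : ℤ) ^ (i : ℕ) •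
      (ModuleCat.free ℤ).map ((TopCat.toSSet.obj X).map (SimplexCategory.δ i).op) :
      (ModuleCat.free ℤ).obj _ ⟶ (ModuleCat.free ℤ).obj _) :=
    AlgebraicTopology.alternatingFaceMapComplex_obj_d _ _
  rw [h]
  refine (ModuleCat.sum_smul_apply _ _ _).trans (Finset.sum_congr rfl fun i _ => ?_)
  congr 1
  exact ModuleCat.free_map_apply _ _

theorem d_equiv_symm (c : SingularChain X (n + 1)) :
    (singularComplex.obj (TopCat.of X)).d (n + 1) n ((equiv X (n + 1)).symm c) =
      (equiv X n).symm (boundary X n c) := by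
  have : ((singularComplex.obj (TopCat.of X)).d (n + 1) n).hom ∘ₗ
      (equiv X (n + 1)).symm.toLinearMap = (equiv X n).symm.toLinearMap ∘ₗ boundary X n := by
    ext σ : 2
    simp only [LinearMap.comp_apply, Finsupp.lsingle_apply, boundary_single, LinearEquiv.coe_coe,
      equiv_symm_single, map_sum]
    refine (singularComplex_d _ _ _).trans (Finset.sum_congr rfl fun i _ => ?_)
    rw [map_smul, equiv_symm_single]
    congr 2
    refine (TopCat.toSSetObjEquiv_symm_naturality (X := TopCat.of X) (SimplexCategory.δ i) σ).trans ?_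
    congr 2
    ext1 t
    exact (face_eq_map i t).symm
  exact LinearMap.congr_fun this c

end SingularChain

namespace SingularChain

variable {X Y Z : Type} [TopologicalSpace X] [TopologicalSpace Y] [TopologicalSpace Z] {n : ℕ}

/-- The chain map between singular chain complexes induced by a continuous map. -/
noncomputable abbrev chainMap (f : C(X, Y)) :
    singularComplex.obj (TopCat.of X) ⟶ singularComplex.obj (TopCat.of Y) :=
  singularComplex.map (TopCat.ofHom f)

theorem chainMap_comp (g : C(Y, Z)) (f : C(X, Y)) :
    chainMap (g.comp f) = chainMap f ≫ chainMap g := by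
  rw [← Functor.map_comp]
  rfl

theorem equiv_chainMap (f : C(X, Y)) (c) :
    equiv Y n ((chainMap f).f n c) = map f n (equiv X n c) := by
  rw [← LinearEquiv.eq_symm_apply, ← map_equiv_symm, LinearEquiv.symm_apply_apply]

theorem equiv_d (c) :
    equiv X n ((singularComplex.obj (TopCat.of X)).d (n + 1) n c) =
      boundary X n (equiv X (n + 1) c) := by
  rw [← LinearEquiv.eq_symm_apply, ← d_equiv_symm, LinearEquiv.symm_apply_apply]

theorem map_injective {f : C(X, Y)} (hf : Function.Injective f) :
    Function.Injective (map f n) :=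
  Finsupp.mapDomain_injective fun _ _ h => ContinuousMap.ext fun t => hf (congrArg (· t) h)

/-- The inclusion of a subspace. -/
def incl (A : Set X) : C(A, X) := ⟨Subtype.val, continuous_subtype_val⟩

/-- The inclusion of a subspace in a larger subspace. -/
def inclOfSubset {A B : Set X} (h : A ⊆ B) : C(A, B) := ⟨Set.inclusion h, continuous_inclusion h⟩

theorem incl_injective (A : Set X) : Function.Injective (incl A) := Subtype.val_injective

theorem exists_map_incl_eq_iff (A : Set X) (c : SingularChain X n) :
    (∃ a, map (incl A) n a = c) ↔
      c ∈ Finsupp.supported ℤ ℤ {σ : C(TopSimplex n, X) | Set.range σ ⊆ A} := by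
  constructor
  · rintro ⟨a, rfl⟩
    refine Finsupp.map_mem_supported (S := Set.univ) _ (fun τ _ => ?_) (by simp)
    rw [map_single]
    refine Finsupp.single_mem_supported ℤ _ ?_
    rintro _ ⟨t, rfl⟩
    exact (τ t).2
  · intro hc
    have : Finsupp.supported ℤ ℤ {σ : C(TopSimplex n, X) | Set.range σ ⊆ A} ≤
        LinearMap.range (map (incl A) n) := by
      rw [Finsupp.supported_eq_span_single, Submodule.span_le]
      rintro _ ⟨σ, hσ, rfl⟩
      refine ⟨Finsupp.single ⟨fun t => ⟨σ t, hσ ⟨t, rfl⟩⟩, by fun_prop⟩ 1, ?_⟩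
      rw [map_single]
      rfl
    exact this hc

theorem exists_add_eq_iff (A B : Set X) (c : SingularChain X n) :
    (∃ a b, map (incl A) n a + map (incl B) n b = c) ↔ c ∈ small A B n := by
  rw [small, Set.ofPred_or, Finsupp.supported_union, Submodule.mem_sup]
  simp only [← exists_map_incl_eq_iff]
  constructor
  · rintro ⟨a, b, h⟩
    exact ⟨_, ⟨a, rfl⟩, _, ⟨b, rfl⟩, h⟩
  · rintro ⟨_, ⟨a, rfl⟩, _, ⟨b, rfl⟩, h⟩
    exact ⟨a, b, h⟩

theorem exists_chainMap_add_eq_iff (A B : Set X) (c) :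
    (∃ a b, (chainMap (incl A)).f n a + (chainMap (incl B)).f n b = c) ↔
      equiv X n c ∈ small A B n := by
  rw [← exists_add_eq_iff]
  constructor
  · rintro ⟨a, b, rfl⟩
    exact ⟨equiv _ n a, equiv _ n b, by rw [map_add, equiv_chainMap, equiv_chainMap]⟩
  · rintro ⟨a, b, h⟩
    refine ⟨(equiv _ n).symm a, (equiv _ n).symm b, (equiv X n).injective ?_⟩
    rw [map_add, equiv_chainMap, equiv_chainMap, ← h, LinearEquiv.apply_symm_apply,
      LinearEquiv.apply_symm_apply]

theorem excisive {A B : Set X} (hA : IsOpen A) (hB : IsOpen B) (hAB : A ∪ B = Set.univ) :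
    HomologicalComplex.Excisive (chainMap (inclOfSubset (Set.inter_subset_left (s := A) (t := B))))
      (chainMap (inclOfSubset (Set.inter_subset_right (s := A) (t := B))))
      (chainMap (incl A)) (chainMap (incl B)) where
  comm := by
    rw [← chainMap_comp, ← chainMap_comp]
    rfl
  injective n := by
    intro x y h
    apply (equiv _ n).injective
    refine map_injective (f := inclOfSubset (Set.inter_subset_left (s := A) (t := B)))
      (Set.inclusion_injective Set.inter_subset_left) ?_
    have := congrArg (equiv _ n) h
    rwa [equiv_chainMap, equiv_chainMap] at this
  exists_of_eq n a b h := by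
    have h' := congrArg (equiv _ n) h
    rw [equiv_chainMap, equiv_chainMap] at h'
    obtain ⟨u, hu⟩ : ∃ u, map (incl (A ∩ B)) n u = map (incl A) n (equiv _ n a) := by
      rw [exists_map_incl_eq_iff]
      simp only [Set.subset_inter_iff, Set.ofPred_and]
      rw [Finsupp.supported_inter]
      exact ⟨(exists_map_incl_eq_iff A _).1 ⟨_, rfl⟩, (exists_map_incl_eq_iff B _).1 ⟨_, h'.symm⟩⟩
    refine ⟨(equiv _ n).symm u, ?_, ?_⟩
    · apply (equiv _ n).injective
      apply map_injective (incl_injective A)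
      rw [equiv_chainMap, LinearEquiv.apply_symm_apply, map_map, ← hu]
      rfl
    · apply (equiv _ n).injective
      apply map_injective (incl_injective B)
      rw [equiv_chainMap, LinearEquiv.apply_symm_apply, map_map, ← h', ← hu]
      rfl
  exists_small n c hc := by
    obtain ⟨e, he⟩ := exists_sub_boundary_mem_small_of_isOpen hA hB hAB (equiv X n c)
      (fun m h => by
        subst h
        have := hc m
        rwa [exists_chainMap_add_eq_iff, equiv_d] at this)
    refine ⟨(equiv X (n + 1)).symm e, (exists_chainMap_add_eq_iff A B _).2 ?_⟩
    rwa [map_sub, equiv_d, LinearEquiv.apply_symm_apply]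

end SingularChain

section SingularHomology

variable {X Y Z : Type} [TopologicalSpace X] [TopologicalSpace Y] [TopologicalSpace Z]

/-- The linear map induced by a continuous map on singular homology. -/
noncomputable def singularHomologyMap (d : ℕ) (f : C(X, Y)) : SH d X →ₗ[ℤ] SH d Y :=
  ((singularHomologyFunctor d).map (TopCat.ofHom f)).hom

theorem singularHomologyMap_id (d : ℕ) :
    singularHomologyMap d (ContinuousMap.id X) = LinearMap.id :=
  congrArg ModuleCat.Hom.hom ((singularHomologyFunctor d).map_id (TopCat.of X))

theorem singularHomologyMap_comp (d : ℕ) (g : C(Y, Z)) (f : C(X, Y)) :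
    singularHomologyMap d (g.comp f) = singularHomologyMap d g ∘ₗ singularHomologyMap d f :=
  congrArg ModuleCat.Hom.hom
    ((singularHomologyFunctor d).map_comp (TopCat.ofHom f) (TopCat.ofHom g))

theorem singularHomologyMap_comp_apply (d : ℕ) (g : C(Y, Z)) (f : C(X, Y)) (x : SH d X) :
    singularHomologyMap d (g.comp f) x = singularHomologyMap d g (singularHomologyMap d f x) :=
  LinearMap.congr_fun (singularHomologyMap_comp d g f) x

theorem ContinuousMap.Homotopic.singularHomologyMap_eq {f g : C(X, Y)} (h : f.Homotopic g)
    (d : ℕ) : singularHomologyMap d f = singularHomologyMap d g := by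
  obtain ⟨H⟩ := h
  have H' : TopCat.Homotopy (TopCat.ofHom f) (TopCat.ofHom g) := H
  exact congrArg ModuleCat.Hom.hom ((H'.toSSet.toSimplicialObjectHomotopy.whiskerRight
    (ModuleCat.free ℤ)).map_homology_eq d)

/-- The linear equivalence induced by a homotopy equivalence on singular homology. -/
noncomputable def ContinuousMap.HomotopyEquiv.singularHomologyEquiv
    (e : ContinuousMap.HomotopyEquiv X Y) (d : ℕ) : SH d X ≃ₗ[ℤ] SH d Y :=
  .ofLinearMap (singularHomologyMap d e.toFun) (singularHomologyMap d e.invFun)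
    (by rw [← singularHomologyMap_comp, e.right_inv.singularHomologyMap_eq,
      singularHomologyMap_id])
    (by rw [← singularHomologyMap_comp, e.left_inv.singularHomologyMap_eq,
      singularHomologyMap_id])

theorem ContinuousMap.HomotopyEquiv.bijective_singularHomologyMap
    (e : ContinuousMap.HomotopyEquiv X Y) (d : ℕ) :
    Function.Bijective (singularHomologyMap d e.toFun) :=
  (e.singularHomologyEquiv d).bijective

theorem subsingleton_singularHomology_of_isEmpty [IsEmpty X] (d : ℕ) :
    Subsingleton (SH d X) := by
  have : IsEmpty C(TopSimplex d, X) := ⟨fun σ => isEmptyElim (σ (Classical.arbitrary _))⟩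
  have h1 : Subsingleton (SingularChain X d) := inferInstanceAs (Subsingleton (_ →₀ ℤ))
  have h2 := (SingularChain.equiv X d).injective.subsingleton
  have h3 := (HomologicalComplex.iCycles_injective
    (K := singularComplex.obj (TopCat.of X)) d).subsingleton
  exact (HomologicalComplex.homologyπ_surjective
    (K := singularComplex.obj (TopCat.of X)) d).subsingleton

/-- The singular complex of a point is an alternating constant complex. -/
noncomputable def singularComplexPUnitIso : singularComplex.obj (TopCat.of PUnit) ≅
    ChainComplex.alternatingConst.obj ((ModuleCat.free ℤ).obj PUnit) :=
  (AlgebraicTopology.alternatingFaceMapComplex _).mapIso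
    (((SimplicialObject.whiskering _ _).obj _).mapIso
    (TopCat.toSSetIsoConst (TopCat.of PUnit)) ≪≫ Functor.constComp _ _ _) ≪≫
    AlgebraicTopology.alternatingFaceMapComplexConst.app _

theorem subsingleton_singularHomology_punit (d : ℕ) : Subsingleton (SH (d + 1) PUnit) :=
  ModuleCat.subsingleton_of_isZero
    ((ChainComplex.alternatingConst_exactAt _ (d + 1) d.succ_ne_zero).of_iso
      singularComplexPUnitIso.symm).isZero_homology

/-- The zeroth homology of a point. -/
noncomputable def singularHomologyZeroPUnit : SH 0 PUnit ≃ₗ[ℤ] ℤ :=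
  ((HomologicalComplex.homologyFunctor _ _ 0).mapIso singularComplexPUnitIso ≪≫
    ChainComplex.alternatingConstHomologyZero _).toLinearEquiv ≪≫ₗ
    Finsupp.uniqueLinearEquiv ℤ ℤ PUnit.unit

end SingularHomology

section MayerVietoris

open SingularChain

variable {X Y : Type} [TopologicalSpace X] [TopologicalSpace Y] {A B : Set X}

theorem singularHomologyMap_incl_left_comp_right (d : ℕ) (u : SH d ↥(A ∩ B)) :
    singularHomologyMap d (incl A) (singularHomologyMap d (inclOfSubset Set.inter_subset_left) u) =
      singularHomologyMap d (incl B)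
        (singularHomologyMap d (inclOfSubset Set.inter_subset_right) u) := by
  rw [← singularHomologyMap_comp_apply, ← singularHomologyMap_comp_apply]
  rfl

/-- An open cover of `X` by two sets, together with a map to a space `Y` whose restriction to
each of them is a homology isomorphism. -/
structure IsHomologySuspension (p : C(X, Y)) (A B : Set X) : Prop where
  isOpen_left : IsOpen A
  isOpen_right : IsOpen B
  union_eq : A ∪ B = Set.univ
  bijective_left (d : ℕ) : Function.Bijective (singularHomologyMap d (p.comp (incl A)))
  bijective_right (d : ℕ) : Function.Bijective (singularHomologyMap d (p.comp (incl B)))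

namespace IsHomologySuspension

variable {p : C(X, Y)} (h : IsHomologySuspension p A B) {d : ℕ}

include h

theorem inclOfSubset_left_eq_zero {u : SH d ↥(A ∩ B)}
    (hu : singularHomologyMap d (p.comp (incl (A ∩ B))) u = 0) :
    singularHomologyMap d (inclOfSubset (Set.inter_subset_left (s := A) (t := B))) u = 0 :=
  (injective_iff_map_eq_zero _).1 (h.bijective_left d).1 _ (by
    rw [← singularHomologyMap_comp_apply]
    exact hu)

theorem inclOfSubset_right_eq_zero {u : SH d ↥(A ∩ B)}
    (hu : singularHomologyMap d (p.comp (incl (A ∩ B))) u = 0) :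
    singularHomologyMap d (inclOfSubset (Set.inter_subset_right (s := A) (t := B))) u = 0 :=
  (injective_iff_map_eq_zero _).1 (h.bijective_right d).1 _ (by
    rw [← singularHomologyMap_comp_apply]
    exact hu)

theorem add_eq_zero
    (hI : Function.Surjective (singularHomologyMap d (p.comp (incl (A ∩ B)))))
    {a : SH d A} {b : SH d B}
    (hab : singularHomologyMap d p (singularHomologyMap d (incl A) a +
      singularHomologyMap d (incl B) b) = 0) :
    singularHomologyMap d (incl A) a + singularHomologyMap d (incl B) b = 0 := by
  rw [map_add, ← singularHomologyMap_comp_apply, ← singularHomologyMap_comp_apply] at hab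
  obtain ⟨u, hu⟩ := hI (singularHomologyMap d (p.comp (incl A)) a)
  have ha : singularHomologyMap d (inclOfSubset Set.inter_subset_left) u = a :=
    (h.bijective_left d).1 (by rw [← singularHomologyMap_comp_apply]; exact hu)
  have hb : singularHomologyMap d (inclOfSubset Set.inter_subset_right) u = -b := by
    refine (h.bijective_right d).1 ?_
    rw [← singularHomologyMap_comp_apply, map_neg, ← eq_neg_of_add_eq_zero_left hab]
    exact hu
  rw [← ha, singularHomologyMap_incl_left_comp_right, hb, map_neg, neg_add_cancel]

theorem exists_of_add_eq_zero {a : SH d A} {b : SH d B}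
    (hab : singularHomologyMap d (incl A) a + singularHomologyMap d (incl B) b = 0) :
    ∃ u, singularHomologyMap d (inclOfSubset (Set.inter_subset_left (s := A) (t := B))) u = a :=
  let ⟨u, hu, _⟩ := (excisive h.isOpen_left h.isOpen_right
    h.union_eq).exists_of_homology_add_eq_zero d a b hab
  ⟨u, hu⟩

theorem exists_add_eq_of_zero (x : SH 0 X) :
    ∃ a b, singularHomologyMap 0 (incl A) a + singularHomologyMap 0 (incl B) b = x :=
  (excisive h.isOpen_left h.isOpen_right h.union_eq).exists_of_homology_zero x

theorem exists_boundary (d : ℕ) : ∃ δ : SH (d + 1) X →ₗ[ℤ] SH d ↥(A ∩ B),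
    (∀ x, δ x = 0 ↔ ∃ a b, singularHomologyMap (d + 1) (incl A) a +
      singularHomologyMap (d + 1) (incl B) b = x) ∧
    (∀ u, (∃ x, δ x = u) ↔
      singularHomologyMap d (inclOfSubset (Set.inter_subset_left (s := A) (t := B))) u = 0 ∧
      singularHomologyMap d (inclOfSubset (Set.inter_subset_right (s := A) (t := B))) u = 0) :=
  (excisive h.isOpen_left h.isOpen_right h.union_eq).exists_boundary d

theorem ker_zero_eq_bot
    (hI : Function.Surjective (singularHomologyMap 0 (p.comp (incl (A ∩ B))))) :
    LinearMap.ker (singularHomologyMap 0 p) = ⊥ := by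
  rw [LinearMap.ker_eq_bot']
  intro x hx
  obtain ⟨a, b, rfl⟩ := h.exists_add_eq_of_zero x
  exact h.add_eq_zero hI hx

theorem nonempty_ker_succ_addEquiv
    (hI : Function.Surjective (singularHomologyMap (d + 1) (p.comp (incl (A ∩ B))))) :
    Nonempty (LinearMap.ker (singularHomologyMap (d + 1) p) ≃+
      LinearMap.ker (singularHomologyMap d (p.comp (incl (A ∩ B))))) := by
  obtain ⟨δ, hδ₁, hδ₂⟩ := h.exists_boundary d
  refine ⟨.ofBijective (δ.restrict fun x _ => ?_).toAddMonoidHom ⟨?_, ?_⟩⟩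
  · have := ((hδ₂ (δ x)).1 ⟨x, rfl⟩).1
    have h' := congrArg (singularHomologyMap d (p.comp (incl A))) this
    rw [← singularHomologyMap_comp_apply, map_zero] at h'
    exact h'
  · rw [injective_iff_map_eq_zero]
    rintro ⟨x, hx⟩ hx'
    obtain ⟨a, b, rfl⟩ := (hδ₁ x).1 (congrArg Subtype.val hx')
    exact Subtype.ext (h.add_eq_zero hI hx)
  · rintro ⟨u, hu⟩
    obtain ⟨x, rfl⟩ := (hδ₂ u).2 ⟨h.inclOfSubset_left_eq_zero hu, h.inclOfSubset_right_eq_zero hu⟩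
    obtain ⟨a, ha⟩ := (h.bijective_left (d + 1)).2 (singularHomologyMap (d + 1) p x)
    refine ⟨⟨x - singularHomologyMap (d + 1) (incl A) a, ?_⟩, Subtype.ext ?_⟩
    · rw [LinearMap.mem_ker, map_sub, ← singularHomologyMap_comp_apply, ha, sub_self]
    · change δ (x - singularHomologyMap (d + 1) (incl A) a) = δ x
      rw [map_sub, sub_eq_self, hδ₁]
      exact ⟨a, 0, by rw [map_zero, add_zero]⟩

theorem exists_add_eq [IsEmpty ↥(A ∩ B)] (x : SH d X) :
    ∃ a b, singularHomologyMap d (incl A) a + singularHomologyMap d (incl B) b = x := by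
  cases d with
  | zero => exact h.exists_add_eq_of_zero x
  | succ d =>
    obtain ⟨δ, hδ, -⟩ := h.exists_boundary d
    have := subsingleton_singularHomology_of_isEmpty (X := ↥(A ∩ B)) d
    exact (hδ x).1 (Subsingleton.elim _ _)

theorem nonempty_ker_addEquiv_of_isEmpty [IsEmpty ↥(A ∩ B)] :
    Nonempty (LinearMap.ker (singularHomologyMap d p) ≃+ SH d Y) := by
  let eA := LinearEquiv.ofBijective _ (h.bijective_left d)
  let eB := LinearEquiv.ofBijective _ (h.bijective_right d)
  have hA (y) : singularHomologyMap d p (singularHomologyMap d (incl A) (eA.symm y)) = y := by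
    rw [← singularHomologyMap_comp_apply]
    exact eA.apply_symm_apply y
  have hB (y) : singularHomologyMap d p (singularHomologyMap d (incl B) (eB.symm y)) = y := by
    rw [← singularHomologyMap_comp_apply]
    exact eB.apply_symm_apply y
  let f : SH d Y →ₗ[ℤ] SH d X :=
    singularHomologyMap d (incl A) ∘ₗ eA.symm.toLinearMap -
      singularHomologyMap d (incl B) ∘ₗ eB.symm.toLinearMap
  have hf (y) : f y = singularHomologyMap d (incl A) (eA.symm y) -
      singularHomologyMap d (incl B) (eB.symm y) := rfl
  refine ⟨.symm (.ofBijective (f.codRestrict _ fun y => ?_).toAddMonoidHom ⟨?_, ?_⟩)⟩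
  · rw [LinearMap.mem_ker, hf, map_sub, hA, hB, sub_self]
  · rw [injective_iff_map_eq_zero]
    intro y hy
    have hy' : f y = 0 := congrArg Subtype.val hy
    rw [hf, sub_eq_add_neg, ← map_neg] at hy'
    obtain ⟨u, hu⟩ := h.exists_of_add_eq_zero hy'
    have := subsingleton_singularHomology_of_isEmpty (X := ↥(A ∩ B)) d
    rw [Subsingleton.elim u 0, map_zero] at hu
    exact eA.symm.map_eq_zero_iff.1 hu.symm
  · rintro ⟨x, hx⟩
    obtain ⟨a, b, rfl⟩ := h.exists_add_eq x
    rw [LinearMap.mem_ker, map_add, ← singularHomologyMap_comp_apply,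
      ← singularHomologyMap_comp_apply] at hx
    refine ⟨eA a, Subtype.ext ?_⟩
    change f (eA a) = _
    have hb : eB.symm (eA a) = -b := by
      rw [LinearEquiv.symm_apply_eq, map_neg]
      exact eq_neg_of_add_eq_zero_left hx
    rw [hf, eA.symm_apply_apply, hb, map_neg, sub_neg_eq_add]

end IsHomologySuspension

theorem nonempty_singularHomology_addEquiv_prod_ker {p : C(X, Y)} {s : C(Y, X)}
    (hs : p.comp s = ContinuousMap.id Y) (d : ℕ) :
    Nonempty (SH d X ≃+ SH d Y × LinearMap.ker (singularHomologyMap d p)) := by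
  have hs' : singularHomologyMap d p ∘ₗ singularHomologyMap d s = LinearMap.id := by
    rw [← singularHomologyMap_comp, hs, singularHomologyMap_id]
  have hps (y) : singularHomologyMap d p (singularHomologyMap d s y) = y :=
    LinearMap.congr_fun hs' y
  refine ⟨.symm (.ofBijective ((singularHomologyMap d s).toAddMonoidHom.coprod
    (LinearMap.ker (singularHomologyMap d p)).subtype.toAddMonoidHom) ⟨?_, fun x => ?_⟩)⟩
  · rw [injective_iff_map_eq_zero]
    rintro ⟨y, k, hk⟩ h
    have h : singularHomologyMap d s y + k = 0 := h
    have h' := congrArg (singularHomologyMap d p) h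
    rw [map_add, hps, LinearMap.mem_ker.1 hk, add_zero, map_zero] at h'
    subst h'
    simpa using h
  · refine ⟨⟨singularHomologyMap d p x, ⟨x - singularHomologyMap d s (singularHomologyMap d p x),
      ?_⟩⟩, ?_⟩
    · rw [LinearMap.mem_ker, map_sub, hps, sub_self]
    · simp

end MayerVietoris

section Suspension

open SingularChain

/-- The complement of the origin. -/
abbrev Punctured (V : Type) [Zero V] : Type := {v : V // v ≠ 0}

namespace Punctured

/-- The complement of a closed half-line in each fibre of `Y × ((V × ℝ) ∖ {0}) → Y`. -/
def slitFiber (Y V : Type) [Zero V] (s : ℝ) : Set (Y × Punctured (V × ℝ)) :=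
  {q | q.2.1.1 ≠ 0 ∨ 0 < s * q.2.1.2}

theorem slitFiber_union_slitFiber_neg {Y V : Type} [Zero V] :
    slitFiber Y V 1 ∪ slitFiber Y V (-1) = Set.univ := by
  rw [Set.eq_univ_iff_forall]
  rintro ⟨y, ⟨v, r⟩, h⟩
  by_cases hv : v = 0
  · have hr : r ≠ 0 := by
      rintro rfl
      exact h (by rw [hv]; rfl)
    rcases lt_or_gt_of_ne hr with hr | hr
    · exact Or.inr (Or.inr (by simpa using hr))
    · exact Or.inl (Or.inr (by simpa using hr))
  · exact Or.inl (Or.inl hv)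

theorem mem_slitFiber_inter_iff {Y V : Type} [Zero V] (q : Y × Punctured (V × ℝ)) :
    q ∈ slitFiber Y V 1 ∩ slitFiber Y V (-1) ↔ q.2.1.1 ≠ 0 := by
  refine ⟨?_, fun h => ⟨Or.inl h, Or.inl h⟩⟩
  rintro ⟨h | h, h' | h'⟩
  · exact h
  · exact h
  · exact h'
  · linarith

variable {Y V : Type} [TopologicalSpace Y] [NormedAddCommGroup V]

theorem isOpen_slitFiber (s : ℝ) : IsOpen (slitFiber Y V s) :=
  (isOpen_ne_fun (f := fun q : Y × Punctured (V × ℝ) => q.2.1.1) (g := fun _ => 0)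
    (by fun_prop) (by fun_prop)).union
  (isOpen_lt (f := fun _ : Y × Punctured (V × ℝ) => 0) (g := fun q => s * q.2.1.2)
    (by fun_prop) (by fun_prop))

/-- The point of `slitFiber Y V s` with given coordinates. -/
def slitFiberMk {s : ℝ} (y : Y) (v : V) (r : ℝ) (h : v ≠ 0 ∨ 0 < s * r) : slitFiber Y V s :=
  ⟨(y, ⟨(v, r), by
    rintro h0
    rw [Prod.mk_eq_zero] at h0
    rcases h with h | h
    · exact h h0.1
    · rw [h0.2, mul_zero] at h
      exact h.false⟩), h⟩

/-- The complement of a line in each fibre of `Y × ((V × ℝ) ∖ {0}) → Y` retracts to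
`Y × (V ∖ {0})`. -/
def slitFiberInterHomotopyEquiv :
    ContinuousMap.HomotopyEquiv ↥(slitFiber Y V 1 ∩ slitFiber Y V (-1)) (Y × Punctured V) where
  toFun := ⟨fun q => (q.1.1, ⟨q.1.2.1.1, (mem_slitFiber_inter_iff _).1 q.2⟩), by fun_prop⟩
  invFun := ⟨fun q => ⟨(q.1, ⟨(q.2.1, 0), fun h => q.2.2 (Prod.mk_eq_zero.1 h).1⟩),
    (mem_slitFiber_inter_iff _).2 q.2.2⟩, by fun_prop⟩
  left_inv := ⟨{
    toFun := fun tq => ⟨(tq.2.1.1, ⟨(tq.2.1.2.1.1, tq.1 * tq.2.1.2.1.2),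
      fun h => (mem_slitFiber_inter_iff _).1 tq.2.2 (Prod.mk_eq_zero.1 h).1⟩),
      (mem_slitFiber_inter_iff _).2 ((mem_slitFiber_inter_iff tq.2.1).1 tq.2.2)⟩
    continuous_toFun := by fun_prop
    map_zero_left := fun q => by simp
    map_one_left := fun q => by simp }⟩
  right_inv := by
    convert ContinuousMap.Homotopic.refl _
    rfl

theorem surjective_singularHomologyMap_of_comp_eq_id {X Y : Type} [TopologicalSpace X]
    [TopologicalSpace Y] {p : C(X, Y)} {s : C(Y, X)} (hs : p.comp s = ContinuousMap.id Y)
    (d : ℕ) : Function.Surjective (singularHomologyMap d p) := fun y =>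
  ⟨singularHomologyMap d s y, by
    rw [← singularHomologyMap_comp_apply, hs, singularHomologyMap_id, LinearMap.id_apply]⟩

theorem surjective_singularHomologyMap_slitFiber_inter [Nontrivial V] (d : ℕ) :
    Function.Surjective (singularHomologyMap d ((ContinuousMap.fst :
      C(Y × Punctured (V × ℝ), Y)).comp (incl (slitFiber Y V 1 ∩ slitFiber Y V (-1))))) := by
  obtain ⟨v, hv⟩ := exists_ne (0 : V)
  exact surjective_singularHomologyMap_of_comp_eq_id (s := slitFiberInterHomotopyEquiv.invFun.comp
    ⟨fun y => (y, ⟨v, hv⟩), by fun_prop⟩) rfl d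

variable [NormedSpace ℝ V]

/-- The projection from `slitFiber Y V s` to `Y` has star-shaped fibres. -/
def slitFiberHomotopyEquiv {s : ℝ} (hs : s ≠ 0) :
    ContinuousMap.HomotopyEquiv (slitFiber Y V s) Y where
  toFun := ContinuousMap.fst.comp (incl (slitFiber Y V s))
  invFun := ⟨fun y => slitFiberMk y 0 s (Or.inr (mul_self_pos.2 hs)), by
    unfold slitFiberMk
    fun_prop⟩
  left_inv := ⟨{
    toFun := fun tq => slitFiberMk tq.2.1.1 ((tq.1 : ℝ) • tq.2.1.2.1.1)
      (tq.1 * tq.2.1.2.1.2 + (1 - tq.1) * s) (by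
        obtain ⟨⟨t, ht0, ht1⟩, ⟨y, ⟨v, r⟩, _⟩, h⟩ := tq
        have hss : 0 < s * s := mul_self_pos.2 hs
        rcases ht0.eq_or_lt with rfl | ht
        · right
          simpa using hss
        · refine h.imp (fun h => smul_ne_zero ht.ne' h) (fun h => ?_)
          change 0 < s * r at h
          change 0 < s * (t * r + (1 - t) * s)
          nlinarith [mul_pos ht h, mul_nonneg (sub_nonneg.2 ht1) hss.le])
    continuous_toFun := by
      unfold slitFiberMk
      fun_prop
    map_zero_left := by
      rintro ⟨⟨y, ⟨v, r⟩, _⟩, h⟩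
      simp [slitFiberMk, incl]
    map_one_left := by
      rintro ⟨⟨y, ⟨v, r⟩, _⟩, h⟩
      simp [slitFiberMk] }⟩
  right_inv := by
    convert ContinuousMap.Homotopic.refl _
    rfl

theorem isHomologySuspension :
    IsHomologySuspension (ContinuousMap.fst : C(Y × Punctured (V × ℝ), Y))
      (slitFiber Y V 1) (slitFiber Y V (-1)) where
  isOpen_left := isOpen_slitFiber 1
  isOpen_right := isOpen_slitFiber (-1)
  union_eq := slitFiber_union_slitFiber_neg
  bijective_left := (slitFiberHomotopyEquiv one_ne_zero).bijective_singularHomologyMap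
  bijective_right :=
    (slitFiberHomotopyEquiv (neg_ne_zero.2 one_ne_zero)).bijective_singularHomologyMap

/-- The kernel of the projection of the product with a punctured vector space. -/
noncomputable abbrev homologyKer (Y V : Type) [TopologicalSpace Y] [NormedAddCommGroup V]
    (d : ℕ) : Submodule ℤ (SH d (Y × Punctured V)) :=
  LinearMap.ker (singularHomologyMap d (ContinuousMap.fst : C(Y × Punctured V, Y)))

theorem nonempty_ker_addEquiv {X X' Y : Type} [TopologicalSpace X] [TopologicalSpace X']
    [TopologicalSpace Y] (e : ContinuousMap.HomotopyEquiv X X') (p : C(X', Y)) (d : ℕ) :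
    Nonempty (LinearMap.ker (singularHomologyMap d (p.comp e.toFun)) ≃+
      LinearMap.ker (singularHomologyMap d p)) := by
  have he := e.bijective_singularHomologyMap d
  refine ⟨.ofBijective ((singularHomologyMap d e.toFun).restrict fun x hx => ?_).toAddMonoidHom
    ⟨fun x y hxy => Subtype.ext (he.1 (congrArg Subtype.val hxy)), ?_⟩⟩
  · rwa [LinearMap.mem_ker, singularHomologyMap_comp_apply] at hx
  · rintro ⟨x', hx'⟩
    obtain ⟨x, rfl⟩ := he.2 x'
    refine ⟨⟨x, ?_⟩, rfl⟩
    rwa [LinearMap.mem_ker, singularHomologyMap_comp_apply]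

theorem nonempty_homologyKer_addEquiv_of_linearEquiv {W : Type} [NormedAddCommGroup W]
    [NormedSpace ℝ W] (e : V ≃L[ℝ] W) (d : ℕ) :
    Nonempty (homologyKer Y V d ≃+ homologyKer Y W d) :=
  nonempty_ker_addEquiv (((Homeomorph.refl Y).prodCongr (e.toHomeomorph.subtype fun _ =>
    (map_ne_zero_iff e e.injective).symm)).toHomotopyEquiv) ContinuousMap.fst d

theorem homologyKer_prod_zero [Nontrivial V] : homologyKer Y (V × ℝ) 0 = ⊥ :=
  isHomologySuspension.ker_zero_eq_bot (surjective_singularHomologyMap_slitFiber_inter 0)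

theorem nonempty_homologyKer_prod_addEquiv [Nontrivial V] (d : ℕ) :
    Nonempty (homologyKer Y (V × ℝ) (d + 1) ≃+ homologyKer Y V d) := by
  obtain ⟨e⟩ := isHomologySuspension.nonempty_ker_succ_addEquiv
    (surjective_singularHomologyMap_slitFiber_inter (Y := Y) (V := V) (d + 1))
  obtain ⟨e'⟩ := nonempty_ker_addEquiv (slitFiberInterHomotopyEquiv (Y := Y) (V := V))
    ContinuousMap.fst d
  exact ⟨e.trans e'⟩

theorem nonempty_homologyKer_prod_addEquiv_of_subsingleton [Subsingleton V] (d : ℕ) :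
    Nonempty (homologyKer Y (V × ℝ) d ≃+ SH d Y) := by
  have : IsEmpty ↥(slitFiber Y V 1 ∩ slitFiber Y V (-1)) :=
    ⟨fun q => (mem_slitFiber_inter_iff _).1 q.2 (Subsingleton.elim _ _)⟩
  exact isHomologySuspension.nonempty_ker_addEquiv_of_isEmpty

/-- Splitting off a coordinate of a Euclidean space. -/
noncomputable def euclideanSpaceSuccEquiv (n : ℕ) :
    EuclideanSpace ℝ (Fin (n + 1)) ≃L[ℝ] EuclideanSpace ℝ (Fin n) × ℝ :=
  ContinuousLinearEquiv.ofFinrankEq (by simp)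

theorem nonempty_homologyKer_euclideanSpace_addEquiv (n d : ℕ) :
    Nonempty (homologyKer Y (EuclideanSpace ℝ (Fin (n + 1))) (n + d) ≃+ SH d Y) := by
  induction n with
  | zero =>
    obtain ⟨e⟩ := nonempty_homologyKer_addEquiv_of_linearEquiv (Y := Y)
      (euclideanSpaceSuccEquiv 0) (0 + d)
    obtain ⟨e'⟩ := nonempty_homologyKer_prod_addEquiv_of_subsingleton (Y := Y)
      (V := EuclideanSpace ℝ (Fin 0)) (0 + d)
    rw [Nat.zero_add] at e e' ⊢
    exact ⟨e.trans e'⟩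
  | succ n ih =>
    obtain ⟨e⟩ := nonempty_homologyKer_addEquiv_of_linearEquiv (Y := Y)
      (euclideanSpaceSuccEquiv (n + 1)) (n + d + 1)
    obtain ⟨e'⟩ := nonempty_homologyKer_prod_addEquiv (Y := Y)
      (V := EuclideanSpace ℝ (Fin (n + 1))) (n + d)
    obtain ⟨e''⟩ := ih
    rw [Nat.succ_add]
    exact ⟨(e.trans e').trans e''⟩

theorem subsingleton_homologyKer_euclideanSpace {n d : ℕ} (h : d < n) :
    Subsingleton (homologyKer Y (EuclideanSpace ℝ (Fin (n + 1))) d) := by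
  induction n generalizing d with
  | zero => exact absurd h d.not_lt_zero
  | succ n ih =>
    obtain ⟨e⟩ := nonempty_homologyKer_addEquiv_of_linearEquiv (Y := Y)
      (euclideanSpaceSuccEquiv (n + 1)) d
    refine @Equiv.subsingleton _ _ e.toEquiv ?_
    cases d with
    | zero =>
      rw [homologyKer_prod_zero]
      infer_instance
    | succ d =>
      obtain ⟨e'⟩ := nonempty_homologyKer_prod_addEquiv (Y := Y)
        (V := EuclideanSpace ℝ (Fin (n + 1))) d
      exact @Equiv.subsingleton _ _ e'.toEquiv (ih (Nat.lt_of_succ_lt_succ h))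

end Punctured

end Suspension

section Rank

/-- An abelian group is free of rank `r`. -/
def IsFreeOfRank (M : Type) [AddCommGroup M] (r : ℕ) : Prop := Nonempty (M ≃+ (Fin r → ℤ))

namespace IsFreeOfRank

variable {M M' : Type} [AddCommGroup M] [AddCommGroup M'] {r s : ℕ}

theorem congr (e : M ≃+ M') (h : IsFreeOfRank M r) : IsFreeOfRank M' r :=
  let ⟨f⟩ := h
  ⟨e.symm.trans f⟩

theorem of_subsingleton [Subsingleton M] : IsFreeOfRank M 0 :=
  have : Unique M := uniqueOfSubsingleton 0
  ⟨AddEquiv.ofUnique⟩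

theorem prod (h : IsFreeOfRank M r) (h' : IsFreeOfRank M' s) : IsFreeOfRank (M × M') (r + s) :=
  let ⟨f⟩ := h
  let ⟨g⟩ := h'
  ⟨(f.prodCongr g).trans ((LinearEquiv.sumArrowLequivProdArrow _ _ ℤ ℤ).symm ≪≫ₗ
    LinearEquiv.funCongrLeft ℤ ℤ finSumFinEquiv.symm).toAddEquiv⟩

theorem nonempty_linearEquiv [Module ℤ M] (h : IsFreeOfRank M r) :
    Nonempty (M ≃ₗ[ℤ] (Fin r → ℤ)) :=
  let ⟨f⟩ := h
  ⟨{ f with map_smul' := fun n x => map_intCast_smul f ℤ ℤ n x }⟩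

end IsFreeOfRank

end Rank

namespace Punctured

/-- Splitting off a factor of a power. -/
def piFinSuccHomeomorph (Z : Type) [TopologicalSpace Z] (k : ℕ) :
    (Fin (k + 1) → Z) ≃ₜ (Fin k → Z) × Z where
  toFun f := (Fin.tail f, f 0)
  invFun f := Fin.cons f.2 f.1
  left_inv f := by simp
  right_inv f := by simp
  continuous_toFun := by unfold Fin.tail; fun_prop
  continuous_invFun := by fun_prop

theorem isFreeOfRank_singularHomology_pi (n k : ℕ) :
    (∀ j, IsFreeOfRank (SH (j * (n + 1))
      (Fin k → Punctured (EuclideanSpace ℝ (Fin (n + 2))))) (k.choose j)) ∧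
    ∀ d, ¬ (n + 1) ∣ d →
      IsFreeOfRank (SH d (Fin k → Punctured (EuclideanSpace ℝ (Fin (n + 2))))) 0 := by
  induction k with
  | zero =>
    let e := (Homeomorph.homeomorphOfUnique PUnit
      (Fin 0 → Punctured (EuclideanSpace ℝ (Fin (n + 2))))).toHomotopyEquiv
    have hpos (d : ℕ) (hd : d ≠ 0) : IsFreeOfRank
        (SH d (Fin 0 → Punctured (EuclideanSpace ℝ (Fin (n + 2))))) 0 := by
      obtain ⟨d, rfl⟩ := Nat.exists_eq_succ_of_ne_zero hd
      have := subsingleton_singularHomology_punit d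
      exact IsFreeOfRank.of_subsingleton.congr (e.singularHomologyEquiv (d + 1)).toAddEquiv
    refine ⟨fun j => ?_, fun d hd => hpos d fun h => hd (h ▸ dvd_zero _)⟩
    cases j with
    | zero =>
      rw [Nat.zero_mul]
      exact ⟨((e.singularHomologyEquiv 0).symm ≪≫ₗ singularHomologyZeroPUnit ≪≫ₗ
        (LinearEquiv.funUnique (Fin 1) ℤ ℤ).symm).toAddEquiv⟩
    | succ j => exact hpos _ (by positivity)
  | succ k ih =>
    obtain ⟨ih₁, ih₂⟩ := ih
    let X := Fin k → Punctured (EuclideanSpace ℝ (Fin (n + 2)))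
    obtain ⟨v, hv⟩ := exists_ne (0 : EuclideanSpace ℝ (Fin (n + 2)))
    have key (d r s : ℕ) (hr : IsFreeOfRank (SH d X) r)
        (hs : IsFreeOfRank (homologyKer X (EuclideanSpace ℝ (Fin (n + 2))) d) s) :
        IsFreeOfRank (SH d (Fin (k + 1) → Punctured (EuclideanSpace ℝ (Fin (n + 2))))) (r + s) := by
      obtain ⟨e⟩ := nonempty_singularHomology_addEquiv_prod_ker
        (p := (ContinuousMap.fst : C(X × Punctured (EuclideanSpace ℝ (Fin (n + 2))), X)))
        (s := ⟨fun y => (y, ⟨v, hv⟩), by fun_prop⟩) rfl d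
      exact (hr.prod hs).congr (e.symm.trans
        ((piFinSuccHomeomorph _ k).symm.toHomotopyEquiv.singularHomologyEquiv d).toAddEquiv)
    have hlt (d : ℕ) (hd : d < n + 1) :
        IsFreeOfRank (homologyKer X (EuclideanSpace ℝ (Fin (n + 2))) d) 0 :=
      have := subsingleton_homologyKer_euclideanSpace (Y := X) hd
      .of_subsingleton
    have hge (d r : ℕ) (hr : IsFreeOfRank (SH d X) r) :
        IsFreeOfRank (homologyKer X (EuclideanSpace ℝ (Fin (n + 2))) (n + 1 + d)) r :=
      let ⟨e⟩ := nonempty_homologyKer_euclideanSpace_addEquiv (Y := X) (n + 1) d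
      hr.congr e.symm
    refine ⟨fun j => ?_, fun d hd => ?_⟩
    · cases j with
      | zero => simpa only [Nat.choose_zero_right] using key _ _ _ (ih₁ 0) (hlt _ (by simp))
      | succ j =>
        rw [Nat.choose_succ_succ, add_comm (k.choose j)]
        refine key _ _ _ (ih₁ (j + 1)) ?_
        rw [Nat.succ_mul, add_comm]
        exact hge _ _ (ih₁ j)
    · refine key d 0 0 (ih₂ d hd) ?_
      rcases lt_or_ge d (n + 1) with h | h
      · exact hlt d h
      · obtain ⟨d, rfl⟩ := Nat.exists_eq_add_of_le h
        exact hge _ _ (ih₂ d fun h' => hd (Nat.dvd_add (dvd_refl _) h'))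

/-- The radial projection to the unit sphere is a homotopy equivalence. -/
noncomputable def homotopyEquivSphere (V : Type) [NormedAddCommGroup V] [NormedSpace ℝ V] :
    ContinuousMap.HomotopyEquiv (Punctured V) (Metric.sphere (0 : V) 1) where
  toFun := ⟨fun v => ⟨‖v.1‖⁻¹ • v.1, by
    rw [mem_sphere_zero_iff_norm, norm_smul, norm_inv, norm_norm,
      inv_mul_cancel₀ (norm_ne_zero_iff.2 v.2)]⟩, by
    refine Continuous.subtype_mk (.smul (.inv₀ (by fun_prop) fun v => ?_) (by fun_prop)) _
    exact norm_ne_zero_iff.2 v.2⟩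
  invFun := ⟨fun v => ⟨v.1, ne_zero_of_mem_unit_sphere v⟩, by fun_prop⟩
  left_inv := ⟨{
    toFun := fun tv => ⟨((1 - tv.1 : ℝ) * ‖tv.2.1‖⁻¹ + tv.1) • tv.2.1, smul_ne_zero (by
      obtain ⟨⟨t, ht0, ht1⟩, v, hv⟩ := tv
      have := inv_pos.2 (norm_pos_iff.2 hv)
      rcases ht0.eq_or_lt with rfl | ht
      · simpa using hv
      · exact (add_pos_of_nonneg_of_pos (mul_nonneg (sub_nonneg.2 ht1) this.le) ht).ne')
      tv.2.2⟩
    continuous_toFun := by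
      refine Continuous.subtype_mk (.smul (.add (.mul (by fun_prop)
        (.inv₀ (by fun_prop) fun tv => norm_ne_zero_iff.2 tv.2.2)) (by fun_prop)) (by fun_prop)) _
    map_zero_left := fun v => by simp
    map_one_left := fun v => by simp }⟩
  right_inv := by
    convert ContinuousMap.Homotopic.refl _
    ext v
    simp

end Punctured

section Tree

namespace SimpleGraph

variable {V : Type} (G : SimpleGraph V) (E : Type) [TopologicalSpace E]

/-- The maps from the vertices of a graph which separate adjacent vertices. -/
abbrev ChromaticConf : Type := {x : V → E // ∀ i j, G.Adj i j → x i ≠ x j}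

variable {G E} in
theorem ChromaticConf.continuous_apply (v : V) : Continuous fun x : G.ChromaticConf E => x.1 v :=
  (_root_.continuous_apply v).comp continuous_subtype_val

variable [AddCommGroup E] [IsTopologicalAddGroup E]

/-- A leaf of a graph moves freely in the complement of its neighbour. -/
noncomputable def chromaticConfHomeomorphOfLeaf {l w : V} (hlw : G.Adj l w)
    (hl : ∀ v, G.Adj l v → v = w) : G.ChromaticConf E ≃ₜ
      (G.induce ({l}ᶜ : Set V)).ChromaticConf E × {y : E // y ≠ 0} where
  toFun x := (⟨fun v => x.1 v.1, fun i j hij => x.2 i j hij⟩,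
    ⟨x.1 l - x.1 w, sub_ne_zero.2 (x.2 l w hlw)⟩)
  invFun x := ⟨fun v => open Classical in if h : v = l then x.1.1 ⟨w, Set.mem_compl_singleton_iff.2 hlw.ne'⟩ + x.2.1
      else x.1.1 ⟨v, Set.mem_compl_singleton_iff.2 h⟩, fun i j hij => by
    by_cases hi : i = l
    · have hj : j ≠ l := fun hj => hij.ne (hi.trans hj.symm)
      subst hi
      obtain rfl := hl j hij
      simpa [hj] using x.2.2
    · by_cases hj : j = l
      · subst hj
        obtain rfl := hl i hij.symm
        simpa [hi] using x.2.2
      · simpa only [dif_neg hi, dif_neg hj] using x.1.2 ⟨i, hi⟩ ⟨j, hj⟩ hij⟩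
  left_inv x := by
    ext v
    by_cases hv : v = l
    · simp [hv]
    · simp [hv]
  right_inv x := by
    have hw : w ≠ l := hlw.ne'
    refine Prod.ext (Subtype.ext (funext fun v => ?_)) (Subtype.ext ?_)
    · exact dif_neg v.2
    · simp [hw]
  continuous_toFun :=
    (Continuous.subtype_mk (continuous_pi fun _ => ChromaticConf.continuous_apply _) _).prodMk
      (((ChromaticConf.continuous_apply l).sub (ChromaticConf.continuous_apply w)).subtype_mk _)
  continuous_invFun := by
    refine Continuous.subtype_mk (continuous_pi fun v => ?_) _
    by_cases hv : v = l
    · simp only [dif_pos hv]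
      exact ((ChromaticConf.continuous_apply _).comp continuous_fst).add
        (continuous_subtype_val.comp continuous_snd)
    · simp only [dif_neg hv]
      exact (ChromaticConf.continuous_apply _).comp continuous_fst

variable {G}

theorem IsTree.nonempty_chromaticConf_homeomorph [Finite V] (hG : G.IsTree) {n : ℕ}
    (hn : Nat.card V = n + 1) :
    Nonempty (G.ChromaticConf E ≃ₜ E × (Fin n → {y : E // y ≠ 0})) := by
  induction n generalizing V with
  | zero =>
    obtain ⟨_, ⟨v⟩⟩ := Nat.card_eq_one_iff_unique.1 hn
    exact ⟨{
      toFun := fun x => (x.1 v, Fin.elim0)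
      invFun := fun x => ⟨fun _ => x.1, fun i j hij => absurd (Subsingleton.elim i j) hij.ne⟩
      left_inv := fun x => Subtype.ext (funext fun i => congrArg x.1 (Subsingleton.elim v i))
      right_inv := fun x => Prod.ext rfl (Subsingleton.elim _ _)
      continuous_toFun := (ChromaticConf.continuous_apply v).prodMk continuous_const
      continuous_invFun := by fun_prop }⟩
  | succ n ih =>
    classical
    have := Fintype.ofFinite V
    have : Nontrivial V := Finite.one_lt_card_iff_nontrivial.1 (by omega)
    obtain ⟨l, hl⟩ := hG.exists_vert_degree_one_of_nontrivial
    obtain ⟨w, hlw, hw⟩ := degree_eq_one_iff_existsUnique_adj.1 hl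
    obtain ⟨e⟩ := ih (G := G.induce ({l}ᶜ : Set V))
      ⟨hG.connected.induce_compl_singleton_of_degree_eq_one hl, hG.isAcyclic.induce _⟩ (by
        have := Set.ncard_compl ({l} : Set V)
        rw [Set.ncard_singleton] at this
        rw [Nat.card_coe_set_eq]
        omega)
    exact ⟨((G.chromaticConfHomeomorphOfLeaf E hlw hw).trans
      (e.prodCongr (Homeomorph.refl _))).trans ((Homeomorph.prodAssoc _ _ _).trans
      ((Homeomorph.refl E).prodCongr (Punctured.piFinSuccHomeomorph _ n).symm))⟩

end SimpleGraph

end Tree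

theorem stmt3 (m N : ℕ) (hm : 2 ≤ m) (hN : 1 ≤ N)
    (T : SimpleGraph (Fin m)) (hT : T.IsTree) :
    Nonempty (chromConf N m T ≃ₜ
      (EuclideanSpace ℝ (Fin N) ×
        (Fin (m - 1) → {y : EuclideanSpace ℝ (Fin N) // y ≠ 0}))) ∧
    Nonempty (ContinuousMap.HomotopyEquiv (chromConf N m T)
      (Fin (m - 1) → Metric.sphere (0 : EuclideanSpace ℝ (Fin N)) 1)) ∧
    (2 ≤ N →
      (∀ d : ℕ, Module.Free ℤ (SH d (chromConf N m T)) ∧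
        Module.Finite ℤ (SH d (chromConf N m T))) ∧
      (∀ j : ℕ, j ≤ m - 1 →
        Module.finrank ℤ (SH (j * (N - 1)) (chromConf N m T)) = (m - 1).choose j) ∧
      (∀ d : ℕ, (∀ j : ℕ, j ≤ m - 1 → d ≠ j * (N - 1)) →
        Module.finrank ℤ (SH d (chromConf N m T)) = 0)) := by
  obtain ⟨e⟩ := hT.nonempty_chromaticConf_homeomorph (EuclideanSpace ℝ (Fin N)) (n := m - 1)
    (by rw [Nat.card_fin]; omega)
  obtain ⟨e₁⟩ : Nonempty (ContinuousMap.HomotopyEquiv (EuclideanSpace ℝ (Fin N)) PUnit.{1}) :=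
    ContractibleSpace.hequiv _ _
  let e₂ : ContinuousMap.HomotopyEquiv (chromConf N m T)
      (Fin (m - 1) → Punctured (EuclideanSpace ℝ (Fin N))) :=
    e.toHomotopyEquiv.trans ((e₁.prodCongr (.refl _)).trans
      (Homeomorph.punitProd _).toHomotopyEquiv)
  refine ⟨⟨e⟩, ⟨e₂.trans (.piCongrRight fun _ => Punctured.homotopyEquivSphere _)⟩, fun hN' => ?_⟩
  obtain ⟨n, rfl⟩ := Nat.exists_eq_add_of_le' hN'
  obtain ⟨h₁, h₂⟩ := Punctured.isFreeOfRank_singularHomology_pi n (m - 1)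
  have hfree {d r : ℕ} (h : IsFreeOfRank
      (SH d (Fin (m - 1) → Punctured (EuclideanSpace ℝ (Fin (n + 2))))) r) :
      (Module.Free ℤ (SH d (chromConf (n + 2) m T)) ∧
        Module.Finite ℤ (SH d (chromConf (n + 2) m T))) ∧
        Module.finrank ℤ (SH d (chromConf (n + 2) m T)) = r := by
    obtain ⟨f⟩ := (h.congr (e₂.singularHomologyEquiv d).symm.toAddEquiv).nonempty_linearEquiv
    exact ⟨⟨.of_equiv f.symm, .equiv f.symm⟩, by rw [f.finrank_eq, Module.finrank_fin_fun]⟩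
  refine ⟨fun d => ?_, fun j _ => (hfree (h₁ j)).2, fun d hd => ?_⟩
  · by_cases hd : n + 1 ∣ d
    · obtain ⟨j, rfl⟩ := hd
      rw [mul_comm]
      exact (hfree (h₁ j)).1
    · exact (hfree (h₂ d hd)).1
  · by_cases hd' : n + 1 ∣ d
    · obtain ⟨j, rfl⟩ := hd'
      have hj : m - 1 < j := lt_of_not_ge fun hj => hd j hj (mul_comm _ _)
      rw [mul_comm, (hfree (h₁ j)).2, Nat.choose_eq_zero_of_lt hj]
    · exact (hfree (h₂ d hd')).2
end

section
/- Let Γ be a finite simple graph on m vertices and N ≥ 2. Then only finitely many of the groups H_d(Conf_Γ(ℝ^N); ℤ) are nonzero, each has finite rank, and Σ_{d≥0} (−1)^d · rank H_d(Conf_Γ(ℝ^N); ℤ) = (−1)^{Nm} χ_Γ((−1)^N). -/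
/-!
STATEMENT 4: For a finite simple graph Γ on m vertices and N ≥ 2, the homology of
Conf_Γ(ℝ^N) is finitely supported and of finite rank in each degree, and its Euler
characteristic equals (−1)^{Nm} χ_Γ((−1)^N).
-/

open CategoryTheory

set_option linter.unusedSectionVars false

namespace ChromConf

/-- The family `H` of `R`-modules is finitely generated, vanishes in large degrees and has
Euler characteristic `e`. -/
def HasEuler (R : Type) [CommRing R] (H : ℕ → Type) [∀ n, AddCommGroup (H n)]
    [∀ n, Module R (H n)] (e : ℤ) : Prop :=
  (∀ n, Module.Finite R (H n)) ∧ ∃ D, (∀ n, D ≤ n → Subsingleton (H n)) ∧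
    ∑ n ∈ Finset.range D, (-1 : ℤ) ^ n * Module.finrank R (H n) = e

section Euler

variable {R : Type} [CommRing R] [IsDomain R] [IsNoetherianRing R]
  {H H₁ H₂ H₃ : ℕ → Type}
  [∀ n, AddCommGroup (H n)] [∀ n, Module R (H n)]
  [∀ n, AddCommGroup (H₁ n)] [∀ n, Module R (H₁ n)]
  [∀ n, AddCommGroup (H₂ n)] [∀ n, Module R (H₂ n)]
  [∀ n, AddCommGroup (H₃ n)] [∀ n, Module R (H₃ n)]

lemma sum_eq_of_subsingleton {D D' : ℕ} (hD : ∀ n, D ≤ n → Subsingleton (H n)) (h : D ≤ D') :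
    ∑ n ∈ Finset.range D', (-1 : ℤ) ^ n * Module.finrank R (H n) =
      ∑ n ∈ Finset.range D, (-1 : ℤ) ^ n * Module.finrank R (H n) := by
  refine (Finset.sum_subset (Finset.range_mono h) fun n _ hn ↦ ?_).symm
  have := hD n (by simpa using hn)
  simp [Module.finrank_zero_of_subsingleton]

lemma HasEuler.congr {e : ℤ} (h : HasEuler R H₁ e) (f : ∀ n, H₁ n ≃ₗ[R] H₂ n) :
    HasEuler R H₂ e := by
  obtain ⟨h1, D, h2, h3⟩ := h
  refine ⟨fun n ↦ have := h1 n; Module.Finite.equiv (f n), D,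
    fun n hn ↦ have := h2 n hn; (f n).symm.injective.subsingleton, ?_⟩
  rw [← h3]
  exact Finset.sum_congr rfl fun n _ ↦ by rw [(f n).finrank_eq]

lemma HasEuler.zero (h : ∀ n, Subsingleton (H n)) : HasEuler R H 0 :=
  ⟨fun n ↦ have := h n; inferInstance, 0, fun n _ ↦ h n, by simp⟩

lemma HasEuler.finsum {e : ℤ} (h : HasEuler R H e) :
    ∑ᶠ n, (-1 : ℤ) ^ n * (Module.finrank R (H n) : ℤ) = e := by
  obtain ⟨-, D, h2, h3⟩ := h
  rw [← h3]
  refine finsum_eq_sum_of_support_subset _ fun n hn ↦ ?_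
  by_contra hlt
  have := h2 n (by simpa using hlt)
  exact hn (by simp [Module.finrank_zero_of_subsingleton])

lemma finite_of_exact {A B C : Type} [AddCommGroup A] [Module R A] [AddCommGroup B] [Module R B]
    [AddCommGroup C] [Module R C] {f : A →ₗ[R] B} {g : B →ₗ[R] C} (h : Function.Exact f g)
    [Module.Finite R A] [Module.Finite R C] : Module.Finite R B := by
  have e := (LinearMap.exact_iff.mp h)
  have : Module.Finite R (LinearMap.ker g) := by rw [e]; infer_instance
  have : Module.Finite R (B ⧸ LinearMap.ker g) := Module.Finite.equiv g.quotKerEquivRange.symm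
  exact Module.Finite.of_submodule_quotient (LinearMap.ker g)

lemma subsingleton_of_exact {A B C : Type} [AddCommGroup A] [Module R A] [AddCommGroup B]
    [Module R B] [AddCommGroup C] [Module R C] {f : A →ₗ[R] B} {g : B →ₗ[R] C}
    (h : Function.Exact f g) (hA : Subsingleton A) (hC : Subsingleton C) : Subsingleton B := by
  refine subsingleton_of_forall_eq 0 fun b ↦ ?_
  obtain ⟨a, rfl⟩ := (h b).mp (Subsingleton.elim _ _)
  rw [Subsingleton.elim a 0, map_zero]

lemma finrank_eq_range_add_range {A B C : Type} [AddCommGroup A] [Module R A] [AddCommGroup B]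
    [Module R B] [AddCommGroup C] [Module R C] [Module.Finite R B]
    {f : A →ₗ[R] B} {g : B →ₗ[R] C} (h : Function.Exact f g) :
    Module.finrank R B = Module.finrank R (LinearMap.range f) +
      Module.finrank R (LinearMap.range g) := by
  rw [← Submodule.finrank_quotient_add_finrank (LinearMap.ker g), g.quotKerEquivRange.finrank_eq,
    LinearMap.exact_iff.mp h, add_comm]

/-- A long exact sequence of abelian groups. -/
structure LongExact (a : ∀ n, H₁ n →ₗ[R] H₂ n) (b : ∀ n, H₂ n →ₗ[R] H₃ n)
    (c : ∀ n, H₃ (n + 1) →ₗ[R] H₁ n) : Prop where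
  exact₁ : ∀ n, Function.Exact (c n) (a n)
  exact₂ : ∀ n, Function.Exact (a n) (b n)
  exact₃ : ∀ n, Function.Exact (b (n + 1)) (c n)
  surj : Function.Surjective (b 0)

variable {a : ∀ n, H₁ n →ₗ[R] H₂ n} {b : ∀ n, H₂ n →ₗ[R] H₃ n} {c : ∀ n, H₃ (n + 1) →ₗ[R] H₁ n}

lemma LongExact.sum_eq (h : LongExact a b c) {D : ℕ} (hD : ∀ n, D ≤ n → Subsingleton (H₃ n))
    (f₁ : ∀ n, Module.Finite R (H₁ n)) (f₂ : ∀ n, Module.Finite R (H₂ n))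
    (f₃ : ∀ n, Module.Finite R (H₃ n)) :
    ∑ n ∈ Finset.range D, (-1 : ℤ) ^ n * Module.finrank R (H₂ n) =
      ∑ n ∈ Finset.range D, (-1 : ℤ) ^ n * Module.finrank R (H₁ n) +
      ∑ n ∈ Finset.range D, (-1 : ℤ) ^ n * Module.finrank R (H₃ n) := by
  have key : ∀ D, ∑ n ∈ Finset.range (D + 1), (-1 : ℤ) ^ n * Module.finrank R (H₁ n) +
      ∑ n ∈ Finset.range (D + 1), (-1 : ℤ) ^ n * Module.finrank R (H₃ n) =
      ∑ n ∈ Finset.range (D + 1), (-1 : ℤ) ^ n * Module.finrank R (H₂ n) +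
        (-1) ^ D * Module.finrank R (LinearMap.range (c D)) := by
    intro D
    have r1 := fun n ↦ have := f₁ n; finrank_eq_range_add_range (h.exact₁ n)
    have r2 := fun n ↦ have := f₂ n; finrank_eq_range_add_range (h.exact₂ n)
    have r3 := fun n ↦ have := f₃ (n + 1); finrank_eq_range_add_range (h.exact₃ n)
    induction D with
    | zero =>
      have : Module.finrank R (LinearMap.range (b 0)) = Module.finrank R (H₃ 0) := by
        rw [LinearMap.range_eq_top.mpr h.surj]
        exact (LinearEquiv.ofTop _ rfl).finrank_eq
      simp [r1, r2, ← this]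
      ring
    | succ D ih =>
      rw [Finset.sum_range_succ, Finset.sum_range_succ _ (D + 1), Finset.sum_range_succ _ (D + 1),
        add_add_add_comm, ih, r1, r2, r3]
      push_cast
      ring
  cases D with
  | zero => simp
  | succ D =>
    have k := key D
    have := hD (D + 1) le_rfl
    have h3 : Module.finrank R (LinearMap.range (c D)) = 0 := by
      have := (c D).surjective_rangeRestrict.subsingleton
      exact Module.finrank_zero_of_subsingleton
    rw [h3] at k
    simpa using k.symm

lemma LongExact.left (h : LongExact a b c) {e₂ e₃ : ℤ} (h₂ : HasEuler R H₂ e₂)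
    (h₃ : HasEuler R H₃ e₃) : HasEuler R H₁ (e₂ - e₃) := by
  obtain ⟨f₂, D₂, s₂, rfl⟩ := h₂
  obtain ⟨f₃, D₃, s₃, rfl⟩ := h₃
  have f₁ : ∀ n, Module.Finite R (H₁ n) := fun n ↦ finite_of_exact (h.exact₁ n)
  refine ⟨f₁, max D₂ D₃, fun n hn ↦ subsingleton_of_exact (h.exact₁ n) (s₃ _ (by omega))
    (s₂ _ (by omega)), ?_⟩
  rw [← sum_eq_of_subsingleton s₂ (le_max_left D₂ D₃),
    ← sum_eq_of_subsingleton s₃ (le_max_right D₂ D₃),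
    h.sum_eq (fun n hn ↦ s₃ _ (by omega)) f₁ f₂ f₃, add_sub_cancel_right]

lemma LongExact.middle (h : LongExact a b c) {e₁ e₃ : ℤ} (h₁ : HasEuler R H₁ e₁)
    (h₃ : HasEuler R H₃ e₃) : HasEuler R H₂ (e₁ + e₃) := by
  obtain ⟨f₁, D₁, s₁, rfl⟩ := h₁
  obtain ⟨f₃, D₃, s₃, rfl⟩ := h₃
  have f₂ : ∀ n, Module.Finite R (H₂ n) := fun n ↦ finite_of_exact (h.exact₂ n)
  refine ⟨f₂, max D₁ D₃, fun n hn ↦ subsingleton_of_exact (h.exact₂ n) (s₁ _ (by omega))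
    (s₃ _ (by omega)), ?_⟩
  rw [← sum_eq_of_subsingleton s₁ (le_max_left D₁ D₃),
    ← sum_eq_of_subsingleton s₃ (le_max_right D₁ D₃),
    h.sum_eq (fun n hn ↦ s₃ _ (by omega)) f₁ f₂ f₃]

lemma LongExact.right (h : LongExact a b c) {e₁ e₂ : ℤ} (h₁ : HasEuler R H₁ e₁)
    (h₂ : HasEuler R H₂ e₂) : HasEuler R H₃ (e₂ - e₁) := by
  obtain ⟨f₁, D₁, s₁, rfl⟩ := h₁
  obtain ⟨f₂, D₂, s₂, rfl⟩ := h₂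
  have f₃ : ∀ n, Module.Finite R (H₃ n)
    | 0 => Module.Finite.of_surjective (b 0) h.surj
    | n + 1 => finite_of_exact (h.exact₃ n)
  have s₃ : ∀ n, max D₁ D₂ + 1 ≤ n → Subsingleton (H₃ n)
    | 0, hn => by omega
    | n + 1, hn => subsingleton_of_exact (h.exact₃ n) (s₂ _ (by omega)) (s₁ _ (by omega))
  refine ⟨f₃, max D₁ D₂ + 1, s₃, ?_⟩
  rw [← sum_eq_of_subsingleton s₁ (show D₁ ≤ max D₁ D₂ + 1 by omega),
    ← sum_eq_of_subsingleton s₂ (show D₂ ≤ max D₁ D₂ + 1 by omega),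
    h.sum_eq s₃ f₁ f₂ f₃, add_sub_cancel_left]

end Euler

section Complex

variable {R : Type} [CommRing R]

/-- A sequence of modules with a differential lowering the degree. -/
structure Cx (R : Type) [CommRing R] where
  /-- The terms. -/
  M : ℕ → Type
  [grp : ∀ n, AddCommGroup (M n)]
  [mod : ∀ n, Module R (M n)]
  /-- The differential. -/
  d : ∀ n, M (n + 1) →ₗ[R] M n
  d_d : ∀ n x, d n (d (n + 1) x) = 0

attribute [instance] Cx.grp Cx.mod

/-- The associated object of Mathlib's category of chain complexes. -/
noncomputable def Cx.toChain (K : Cx R) : ChainComplex (ModuleCat R) ℕ :=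
  ChainComplex.of (fun n ↦ ModuleCat.of R (K.M n)) (fun n ↦ ModuleCat.ofHom (K.d n))
    (fun n ↦ by ext x; exact K.d_d n x)

lemma Cx.toChain_d (K : Cx R) (n : ℕ) :
    K.toChain.d (n + 1) n = ModuleCat.ofHom (K.d n) :=
  ChainComplex.of_d (fun n ↦ ModuleCat.of R (K.M n)) (fun n ↦ ModuleCat.ofHom (K.d n)) n

/-- The homology of `K`. -/
abbrev Cx.H (K : Cx R) (n : ℕ) : Type := K.toChain.homology n

/-- A chain map. -/
structure CxHom (K L : Cx R) where
  /-- The components. -/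
  f : ∀ n, K.M n →ₗ[R] L.M n
  comm : ∀ n x, L.d n (f (n + 1) x) = f n (K.d n x)

/-- The associated morphism of chain complexes. -/
noncomputable def CxHom.toChain {K L : Cx R} (φ : CxHom K L) : K.toChain ⟶ L.toChain :=
  ChainComplex.ofHom (fun n ↦ ModuleCat.ofHom (φ.f n)) (fun n ↦ by
    rw [Cx.toChain_d, Cx.toChain_d]
    ext x
    exact φ.comm n x)

lemma exists_longExact {K L N : Cx R} (φ : CxHom K L) (ψ : CxHom L N)
    (hφ : ∀ n, Function.Injective (φ.f n)) (hψ : ∀ n, Function.Surjective (ψ.f n))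
    (h : ∀ n, Function.Exact (φ.f n) (ψ.f n)) :
    ∃ (a : ∀ n, K.H n →ₗ[R] L.H n) (b : ∀ n, L.H n →ₗ[R] N.H n)
      (c : ∀ n, N.H (n + 1) →ₗ[R] K.H n), LongExact a b c := by
  let S : ShortComplex (ChainComplex (ModuleCat R) ℕ) :=
    ShortComplex.mk φ.toChain ψ.toChain (by
      ext n x
      exact (h n).apply_apply_eq_zero x)
  have hS : S.ShortExact := by
    refine HomologicalComplex.shortExact_of_degreewise_shortExact _ fun n ↦ ?_
    refine ModuleCat.shortComplex_shortExact _ (h n) (hφ n) (hψ n)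
  refine ⟨fun n ↦ (HomologicalComplex.homologyMap S.f n).hom,
    fun n ↦ (HomologicalComplex.homologyMap S.g n).hom,
    fun n ↦ (hS.δ (n + 1) n (by simp)).hom, fun n ↦ ?_, fun n ↦ ?_, fun n ↦ ?_, ?_⟩
  · exact (ShortComplex.ShortExact.moduleCat_exact_iff_function_exact _).mp
      (hS.homology_exact₁ (n + 1) n (by simp))
  · exact (ShortComplex.ShortExact.moduleCat_exact_iff_function_exact _).mp
      (hS.homology_exact₂ n)
  · exact (ShortComplex.ShortExact.moduleCat_exact_iff_function_exact _).mp
      (hS.homology_exact₃ (n + 1) n (by simp))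
  · have : Epi (S.g.f 0) := (ModuleCat.epi_iff_surjective _).mpr (hψ 0)
    exact (ModuleCat.epi_iff_surjective _).mp
      (HomologicalComplex.epi_homologyMap_of_epi_of_not_rel S.g 0 (by simp))

lemma Cx.subsingleton_H (K : Cx R) (h0 : Subsingleton (K.M 0))
    (h : ∀ n x, K.d n x = 0 → ∃ y, K.d (n + 1) y = x) (n : ℕ) : Subsingleton (K.H n) := by
  rw [← ModuleCat.isZero_iff_subsingleton, ← HomologicalComplex.exactAt_iff_isZero_homology]
  cases n with
  | zero =>
    refine ShortComplex.exact_of_isZero_X₂ _ ?_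
    exact (ModuleCat.isZero_iff_subsingleton (M := ModuleCat.of R (K.M 0))).mpr h0
  | succ n =>
    rw [HomologicalComplex.exactAt_iff' _ (n + 2) (n + 1) n (by simp) (by simp),
      ShortComplex.moduleCat_exact_iff]
    intro x hx
    change (K.toChain.d (n + 1) n).hom x = 0 at hx
    rw [Cx.toChain_d] at hx
    obtain ⟨y, hy⟩ := h n x hx
    refine ⟨y, ?_⟩
    change (K.toChain.d (n + 2) (n + 1)).hom y = x
    rw [Cx.toChain_d]
    exact hy

/-- A subcomplex. -/
@[ext]
structure SubCx (K : Cx R) where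
  /-- The terms. -/
  P : ∀ n, Submodule R (K.M n)
  d_mem : ∀ n x, x ∈ P (n + 1) → K.d n x ∈ P n

namespace SubCx

variable {K : Cx R}

/-- A subcomplex, as a complex. -/
noncomputable def toCx (P : SubCx K) : Cx R where
  M n := P.P n
  d n := (K.d n).restrict (P.d_mem n)
  d_d n x := Subtype.ext (K.d_d n x)

/-- The intersection of two subcomplexes. -/
def inf (P Q : SubCx K) : SubCx K where
  P n := P.P n ⊓ Q.P n
  d_mem n _ hx := ⟨P.d_mem n _ hx.1, Q.d_mem n _ hx.2⟩

/-- The sum of two subcomplexes. -/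
def sup (P Q : SubCx K) : SubCx K where
  P n := P.P n ⊔ Q.P n
  d_mem n x hx := by
    obtain ⟨y, hy, z, hz, rfl⟩ := Submodule.mem_sup.mp hx
    rw [map_add]
    exact Submodule.add_mem_sup (P.d_mem n y hy) (Q.d_mem n z hz)

end SubCx

/-- The direct sum of two complexes. -/
noncomputable def Cx.prod (K L : Cx R) : Cx R where
  M n := K.M n × L.M n
  d n := (K.d n).prodMap (L.d n)
  d_d n x := Prod.ext (K.d_d n x.1) (L.d_d n x.2)

/-- The quotient of a complex by a subcomplex. -/
noncomputable def Cx.quot (K : Cx R) (P : SubCx K) : Cx R where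
  M n := K.M n ⧸ P.P n
  d n := (P.P (n + 1)).mapQ (P.P n) (K.d n) (P.d_mem n)
  d_d n x := by
    obtain ⟨x, rfl⟩ := Submodule.Quotient.mk_surjective _ x
    simp [K.d_d]

variable [IsDomain R] [IsNoetherianRing R]

lemma Cx.hasEuler_prod {K L : Cx R} {a b : ℤ} (hK : HasEuler R K.H a) (hL : HasEuler R L.H b) :
    HasEuler R (K.prod L).H (a + b) := by
  let φ : CxHom K (K.prod L) := ⟨fun n ↦ LinearMap.inl R _ _, fun n x ↦
    Prod.ext rfl (map_zero (L.d n))⟩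
  let ψ : CxHom (K.prod L) L := ⟨fun n ↦ LinearMap.snd R _ _, fun n x ↦ rfl⟩
  obtain ⟨_, _, _, h⟩ := exists_longExact φ ψ (fun n ↦ LinearMap.inl_injective)
    (fun n ↦ LinearMap.snd_surjective) (fun n ↦ .inl_snd)
  exact h.middle hK hL

namespace SubCx

variable {K : Cx R} (P Q : SubCx K)

lemma mayerVietoris :
    ∃ (a : ∀ n, (P.inf Q).toCx.H n →ₗ[R] (P.toCx.prod Q.toCx).H n)
      (b : ∀ n, (P.toCx.prod Q.toCx).H n →ₗ[R] (P.sup Q).toCx.H n)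
      (c : ∀ n, (P.sup Q).toCx.H (n + 1) →ₗ[R] (P.inf Q).toCx.H n), LongExact a b c := by
  let φ : CxHom (P.inf Q).toCx (P.toCx.prod Q.toCx) :=
    ⟨fun n ↦ (Submodule.inclusion inf_le_left).prod (Submodule.inclusion inf_le_right),
      fun n x ↦ rfl⟩
  let ψ : CxHom (P.toCx.prod Q.toCx) (P.sup Q).toCx :=
    ⟨fun n ↦ LinearMap.codRestrict (P.P n ⊔ Q.P n)
        ((P.P n).subtype ∘ₗ LinearMap.fst R (P.P n) (Q.P n) -
          (Q.P n).subtype ∘ₗ LinearMap.snd R (P.P n) (Q.P n))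
        (fun x ↦ sub_mem (Submodule.mem_sup_left x.1.2) (Submodule.mem_sup_right x.2.2)),
      fun n x ↦ Subtype.ext (map_sub (K.d n) (x.1.1 : K.M (n + 1)) x.2.1)⟩
  have hψ : ∀ n (x : (P.toCx.prod Q.toCx).M n), ψ.f n x = 0 ↔ x.1.1 = x.2.1 := fun n x ↦
    ⟨fun h ↦ sub_eq_zero.mp (congrArg Subtype.val h), fun h ↦ Subtype.ext (sub_eq_zero.mpr h)⟩
  refine exists_longExact φ ψ (fun n x y h ↦ ?_) (fun n x ↦ ?_) fun n x ↦ ⟨fun h ↦ ?_, ?_⟩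
  · exact Subtype.ext (congrArg (fun z : P.P n × Q.P n ↦ (z.1 : K.M n)) h)
  · obtain ⟨y, hy, z, hz, hx⟩ := Submodule.mem_sup.mp x.2
    exact ⟨(⟨y, hy⟩, ⟨-z, neg_mem hz⟩), Subtype.ext ((sub_neg_eq_add y z).trans hx)⟩
  · rw [hψ] at h
    exact ⟨⟨x.1.1, x.1.2, h ▸ x.2.2⟩, Prod.ext rfl (Subtype.ext h)⟩
  · rintro ⟨y, rfl⟩
    exact (hψ n _).mpr rfl

variable {P Q}

lemma hasEuler_inf {a b c : ℤ} (hP : HasEuler R P.toCx.H a) (hQ : HasEuler R Q.toCx.H b)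
    (h : HasEuler R (P.sup Q).toCx.H c) : HasEuler R (P.inf Q).toCx.H (a + b - c) := by
  obtain ⟨_, _, _, hex⟩ := mayerVietoris P Q
  exact hex.left (Cx.hasEuler_prod hP hQ) h

lemma hasEuler_sup {a b c : ℤ} (hP : HasEuler R P.toCx.H a) (hQ : HasEuler R Q.toCx.H b)
    (h : HasEuler R (P.inf Q).toCx.H c) : HasEuler R (P.sup Q).toCx.H (a + b - c) := by
  obtain ⟨_, _, _, hex⟩ := mayerVietoris P Q
  exact hex.right h (Cx.hasEuler_prod hP hQ)

lemma hasEuler_iff_of_deform (hPQ : ∀ n, P.P n ≤ Q.P n) (h0 : Q.P 0 ≤ P.P 0)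
    (h : ∀ n, ∀ x ∈ Q.P (n + 1), K.d n x ∈ P.P n → ∃ y ∈ Q.P (n + 2),
      x - K.d (n + 1) y ∈ P.P (n + 1)) {e : ℤ} :
    HasEuler R P.toCx.H e ↔ HasEuler R Q.toCx.H e := by
  let P' : SubCx Q.toCx := ⟨fun n ↦ (P.P n).comap (Q.P n).subtype, fun n x hx ↦ P.d_mem n x.1 hx⟩
  let φ : CxHom P.toCx Q.toCx := ⟨fun n ↦ Submodule.inclusion (hPQ n), fun n x ↦ rfl⟩
  let ψ : CxHom Q.toCx (Q.toCx.quot P') := ⟨fun n ↦ Submodule.mkQ _, fun n x ↦ rfl⟩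
  obtain ⟨_, _, _, hex⟩ := exists_longExact φ ψ (fun n ↦ Submodule.inclusion_injective (hPQ n))
    (fun n ↦ Submodule.mkQ_surjective _) (fun n x ↦ by
      change (Submodule.Quotient.mk x : _ ⧸ P'.P n) = 0 ↔ _
      rw [Submodule.Quotient.mk_eq_zero]
      exact ⟨fun hx ↦ ⟨⟨x.1, hx⟩, rfl⟩, fun ⟨y, hy⟩ ↦ hy ▸ y.2⟩)
  have hz : HasEuler R (Q.toCx.quot P').H 0 := by
    refine HasEuler.zero (Cx.subsingleton_H _ ?_ fun n x hx ↦ ?_)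
    · exact Submodule.Quotient.subsingleton_iff.mpr (eq_top_iff.mpr fun x _ ↦ h0 x.2)
    · obtain ⟨x, rfl⟩ := Submodule.Quotient.mk_surjective _ x
      have hx' := (Submodule.Quotient.mk_eq_zero (P'.P n)).mp hx
      obtain ⟨y, hy, hxy⟩ := h n x.1 x.2 hx'
      refine ⟨Submodule.Quotient.mk ⟨y, hy⟩, ?_⟩
      refine ((Submodule.Quotient.eq _).mpr ?_).symm
      exact hxy
  refine ⟨fun hP ↦ ?_, fun hQ ↦ ?_⟩
  · simpa using hex.middle hP hz
  · simpa using hex.left hQ hz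

end SubCx

end Complex

section Tuples

variable (R : Type) [CommRing R] {X Y : Type}

/-- The boundary of ordered chains, i.e. of linear combinations of tuples of points. -/
noncomputable def bd (k : ℕ) : ((Fin (k + 2) → X) →₀ R) →ₗ[R] ((Fin (k + 1) → X) →₀ R) :=
  ∑ i : Fin (k + 2), (-1 : R) ^ (i : ℕ) • Finsupp.lmapDomain R R (· ∘ i.succAbove)

/-- The cone with apex `b`. -/
noncomputable def cone (b : X) (k : ℕ) :
    ((Fin (k + 1) → X) →₀ R) →ₗ[R] ((Fin (k + 2) → X) →₀ R) :=
  Finsupp.lmapDomain R R (Fin.cons (α := fun _ ↦ X) b)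

lemma bd_single (k : ℕ) (w : Fin (k + 2) → X) :
    bd R k (.single w 1) =
      ∑ i : Fin (k + 2), (-1 : R) ^ (i : ℕ) • Finsupp.single (w ∘ i.succAbove) 1 := by
  simp only [bd, LinearMap.sum_apply, LinearMap.smul_apply, Finsupp.lmapDomain_apply,
    Finsupp.mapDomain_single]

@[simp]
lemma cone_single (b : X) (k : ℕ) (w : Fin (k + 1) → X) :
    cone R b k (.single w 1) = .single (Fin.cons b w) 1 := by
  simp [cone]

lemma cons_comp_succ_succAbove (b : X) (k : ℕ) (w : Fin (k + 2) → X) (i : Fin (k + 2)) :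
    (Fin.cons b w : Fin (k + 3) → X) ∘ i.succ.succAbove = Fin.cons b (w ∘ i.succAbove) := by
  ext j
  cases j using Fin.cases <;> simp

lemma bd_cone (b : X) (k : ℕ) (c : (Fin (k + 2) → X) →₀ R) :
    bd R (k + 1) (cone R b (k + 1) c) = c - cone R b k (bd R k c) := by
  suffices h : bd R (k + 1) ∘ₗ cone R b (k + 1) = LinearMap.id - cone R b k ∘ₗ bd R k from
    LinearMap.congr_fun h c
  clear c
  refine Finsupp.lhom_ext' fun w ↦ LinearMap.ext_ring ?_
  simp only [LinearMap.comp_apply, Finsupp.lsingle_apply, cone_single, bd_single,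
    LinearMap.sub_apply, LinearMap.id_apply, map_sum, map_smul, Fin.sum_univ_succ (n := k + 2),
    cons_comp_succ_succAbove, Fin.val_succ, pow_succ, mul_neg_one, neg_smul,
    Finset.sum_neg_distrib, Fin.val_zero, pow_zero, one_smul, sub_eq_add_neg]
  rfl

lemma bd_cone_zero (b : X) (w : Fin 1 → X) :
    bd R 0 (cone R b 0 (.single w 1)) = .single w 1 - .single (fun _ ↦ b) 1 := by
  rw [cone_single, bd_single, Fin.sum_univ_two]
  simp only [Fin.val_zero, pow_zero, one_smul, Fin.val_one, pow_one, neg_smul, sub_eq_add_neg]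
  congr! 3
  ext i
  fin_cases i
  rfl

lemma bd_cone_bd_zero (b : X) (c : (Fin 2 → X) →₀ R) :
    bd R 0 (cone R b 0 (bd R 0 c)) = bd R 0 c := by
  suffices h : bd R 0 ∘ₗ cone R b 0 ∘ₗ bd R 0 = bd R 0 from LinearMap.congr_fun h c
  clear c
  refine Finsupp.lhom_ext' fun w ↦ LinearMap.ext_ring ?_
  simp only [LinearMap.comp_apply, Finsupp.lsingle_apply]
  rw [bd_single, Fin.sum_univ_two]
  simp only [map_add, map_neg, bd_cone_zero, Fin.val_zero, pow_zero, one_smul, Fin.val_one,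
    pow_one, neg_smul]
  abel

lemma bd_bd (k : ℕ) (c : (Fin (k + 3) → X) →₀ R) : bd R k (bd R (k + 1) c) = 0 := by
  suffices h : bd R k ∘ₗ bd R (k + 1) = (0 : ((Fin (k + 3) → X) →₀ R) →ₗ[R] _) from
    LinearMap.congr_fun h c
  clear c
  refine Finsupp.lhom_ext' fun w ↦ LinearMap.ext_ring ?_
  simp only [LinearMap.comp_apply, Finsupp.lsingle_apply, LinearMap.zero_apply]
  rw [← Fin.cons_self_tail w, ← cone_single, bd_cone, map_sub]
  induction k with
  | zero => rw [bd_cone_bd_zero, sub_self]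
  | succ k ih =>
    have := ih (Fin.tail w)
    rw [← map_sub, ← bd_cone, cone_single, Fin.cons_self_tail] at this
    rw [bd_cone, this, map_zero, sub_zero, sub_self]

variable (β : ∀ k, (Fin (k + 1) → X) → X)

/-- Barycentric subdivision of ordered chains, with respect to the choice `β` of barycenters. -/
noncomputable def sd : ∀ k, ((Fin (k + 1) → X) →₀ R) →ₗ[R] ((Fin (k + 1) → X) →₀ R)
  | 0 => LinearMap.id
  | k + 1 => Finsupp.linearCombination R fun w ↦
      cone R (β (k + 1) w) k (sd k (bd R k (.single w 1)))

/-- The chain homotopy between barycentric subdivision and the identity. -/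
noncomputable def sdHomotopy : ∀ k, ((Fin (k + 1) → X) →₀ R) →ₗ[R] ((Fin (k + 2) → X) →₀ R)
  | 0 => 0
  | k + 1 => Finsupp.linearCombination R fun w ↦
      cone R (β (k + 1) w) (k + 1) (.single w 1 - sdHomotopy k (bd R k (.single w 1)))

lemma sd_single (k : ℕ) (w : Fin (k + 2) → X) : sd R β (k + 1) (.single w 1) =
    cone R (β (k + 1) w) k (sd R β k (bd R k (.single w 1))) := by
  simp [sd]

lemma sdHomotopy_single (k : ℕ) (w : Fin (k + 2) → X) : sdHomotopy R β (k + 1) (.single w 1) =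
    cone R (β (k + 1) w) (k + 1)
      (.single w 1 - sdHomotopy R β k (bd R k (.single w 1))) := by
  simp [sdHomotopy]

lemma bd_sd (k : ℕ) (c : (Fin (k + 2) → X) →₀ R) :
    bd R k (sd R β (k + 1) c) = sd R β k (bd R k c) := by
  suffices h : bd R k ∘ₗ sd R β (k + 1) = sd R β k ∘ₗ bd R k from LinearMap.congr_fun h c
  clear c
  refine Finsupp.lhom_ext' fun w ↦ LinearMap.ext_ring ?_
  simp only [LinearMap.comp_apply, Finsupp.lsingle_apply, sd_single]
  induction k with
  | zero => exact bd_cone_bd_zero R _ _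
  | succ k ih =>
    have ih' : bd R k ∘ₗ sd R β (k + 1) = sd R β k ∘ₗ bd R k :=
      Finsupp.lhom_ext' fun w ↦ LinearMap.ext_ring (by
        simpa only [LinearMap.comp_apply, Finsupp.lsingle_apply, sd_single] using ih w)
    have := LinearMap.congr_fun ih' (bd R (k + 1) (.single w 1))
    simp only [LinearMap.comp_apply, bd_bd, map_zero] at this
    rw [bd_cone, this, map_zero, sub_zero]

lemma bd_sdHomotopy (k : ℕ) (c : (Fin (k + 2) → X) →₀ R) :
    bd R (k + 1) (sdHomotopy R β (k + 1) c) + sdHomotopy R β k (bd R k c) =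
      c - sd R β (k + 1) c := by
  suffices h : bd R (k + 1) ∘ₗ sdHomotopy R β (k + 1) + sdHomotopy R β k ∘ₗ bd R k =
    LinearMap.id - sd R β (k + 1) from LinearMap.congr_fun h c
  clear c
  induction k with
  | zero =>
    refine Finsupp.lhom_ext' fun w ↦ LinearMap.ext_ring ?_
    simp only [LinearMap.comp_apply, LinearMap.add_apply, LinearMap.sub_apply, LinearMap.id_apply,
      Finsupp.lsingle_apply, sd_single, sdHomotopy_single, bd_cone]
    simp [sdHomotopy, sd]
  | succ k ih =>
    refine Finsupp.lhom_ext' fun w ↦ LinearMap.ext_ring ?_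
    have := LinearMap.congr_fun ih (bd R (k + 1) (.single w 1))
    simp only [LinearMap.comp_apply, LinearMap.add_apply, LinearMap.sub_apply, LinearMap.id_apply,
      bd_bd, map_zero, add_zero] at this
    simp only [LinearMap.comp_apply, LinearMap.add_apply, LinearMap.sub_apply, LinearMap.id_apply,
      Finsupp.lsingle_apply, sd_single R β (k + 1), sdHomotopy_single R β (k + 1), bd_cone,
      map_sub, this]
    abel

variable {β} {β' : ∀ k, (Fin (k + 1) → Y) → Y}

/-- The map induced on ordered chains. -/
noncomputable def mapTuples (f : X → Y) (k : ℕ) :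
    ((Fin (k + 1) → X) →₀ R) →ₗ[R] ((Fin (k + 1) → Y) →₀ R) :=
  Finsupp.lmapDomain R R (f ∘ ·)

@[simp]
lemma mapTuples_single (f : X → Y) (k : ℕ) (w : Fin (k + 1) → X) :
    mapTuples R f k (.single w 1) = .single (f ∘ w) 1 := by
  simp [mapTuples]

lemma mapTuples_cone (f : X → Y) (k : ℕ) (b : X) (c : (Fin (k + 1) → X) →₀ R) :
    mapTuples R f (k + 1) (cone R b k c) = cone R (f b) k (mapTuples R f k c) := by
  suffices h : mapTuples R f (k + 1) ∘ₗ cone R b k = cone R (f b) k ∘ₗ mapTuples R f k from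
    LinearMap.congr_fun h c
  clear c
  refine Finsupp.lhom_ext' fun w ↦ LinearMap.ext_ring ?_
  simp only [LinearMap.comp_apply, Finsupp.lsingle_apply, cone_single, mapTuples_single,
    Fin.comp_cons]

lemma mapTuples_bd (f : X → Y) (k : ℕ) (c : (Fin (k + 2) → X) →₀ R) :
    mapTuples R f k (bd R k c) = bd R k (mapTuples R f (k + 1) c) := by
  suffices h : mapTuples R f k ∘ₗ bd R k = bd R k ∘ₗ mapTuples R f (k + 1) from
    LinearMap.congr_fun h c
  clear c
  refine Finsupp.lhom_ext' fun w ↦ LinearMap.ext_ring ?_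
  simp only [LinearMap.comp_apply, Finsupp.lsingle_apply, mapTuples_single, bd_single, map_sum,
    map_smul, Function.comp_assoc]

lemma mapTuples_sd {f : X → Y} (hf : ∀ k w, f (β k w) = β' k (f ∘ w)) (k : ℕ)
    (c : (Fin (k + 1) → X) →₀ R) :
    mapTuples R f k (sd R β k c) = sd R β' k (mapTuples R f k c) := by
  suffices h : mapTuples R f k ∘ₗ sd R β k = sd R β' k ∘ₗ mapTuples R f k from
    LinearMap.congr_fun h c
  clear c
  induction k with
  | zero => rfl
  | succ k ih =>
    refine Finsupp.lhom_ext' fun w ↦ LinearMap.ext_ring ?_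
    have := LinearMap.congr_fun ih (bd R k (.single w 1))
    simp only [LinearMap.comp_apply] at this
    simp only [LinearMap.comp_apply, Finsupp.lsingle_apply, sd_single, mapTuples_single,
      mapTuples_cone, this, mapTuples_bd, hf]

lemma mapTuples_sdHomotopy {f : X → Y} (hf : ∀ k w, f (β k w) = β' k (f ∘ w)) (k : ℕ)
    (c : (Fin (k + 1) → X) →₀ R) :
    mapTuples R f (k + 1) (sdHomotopy R β k c) = sdHomotopy R β' k (mapTuples R f k c) := by
  suffices h : mapTuples R f (k + 1) ∘ₗ sdHomotopy R β k =
    sdHomotopy R β' k ∘ₗ mapTuples R f k from LinearMap.congr_fun h c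
  clear c
  induction k with
  | zero => simp [sdHomotopy]
  | succ k ih =>
    refine Finsupp.lhom_ext' fun w ↦ LinearMap.ext_ring ?_
    have := LinearMap.congr_fun ih (bd R k (.single w 1))
    simp only [LinearMap.comp_apply] at this
    simp only [LinearMap.comp_apply, Finsupp.lsingle_apply, sdHomotopy_single, mapTuples_single,
      mapTuples_cone, this, mapTuples_bd, hf, map_sub]

end Tuples

section Simplex

/-- The standard `n`-simplex. -/
abbrev Simp (n : ℕ) : Type := stdSimplex ℝ (Fin (n + 1))

variable {k l n : ℕ}

/-- The affine map between standard simplices with prescribed values at the vertices. -/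
noncomputable def aff (w : Fin (k + 1) → Simp n) : C(Simp k, Simp n) where
  toFun t := ⟨∑ i, t.1 i • (w i).1, (convex_stdSimplex ℝ _).sum_mem (fun i _ ↦ t.2.1 i) t.2.2
    fun i _ ↦ (w i).2⟩
  continuous_toFun := Continuous.subtype_mk (continuous_finsetSum _ fun i _ ↦
    ((continuous_apply i).comp continuous_subtype_val).smul continuous_const) _

lemma aff_coe (w : Fin (k + 1) → Simp n) (t : Simp k) : (aff w t).1 = ∑ i, t.1 i • (w i).1 := rfl

lemma aff_vertex : aff (fun i : Fin (n + 1) ↦ stdSimplex.vertex i) = ContinuousMap.id (Simp n) := by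
  ext t j
  change (aff (fun i : Fin (n + 1) ↦ stdSimplex.vertex i) t).1 j = t.1 j
  simp [aff_coe, Pi.single_apply]

lemma aff_apply_vertex (w : Fin (k + 1) → Simp n) (i : Fin (k + 1)) :
    aff w (stdSimplex.vertex i) = w i := by
  refine Subtype.ext ?_
  simp [aff_coe, Pi.single_apply]

lemma aff_aff (u : Fin (l + 1) → Simp n) (w : Fin (k + 1) → Simp l) :
    aff (aff u ∘ w) = (aff u).comp (aff w) := by
  refine ContinuousMap.ext fun t ↦ Subtype.ext ?_
  simp only [aff_coe, ContinuousMap.comp_apply, Function.comp_apply, Finset.smul_sum,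
    Finset.sum_apply, Pi.smul_apply, smul_eq_mul, Finset.sum_smul, smul_smul]
  exact Finset.sum_comm

/-- The `i`-th face inclusion. -/
noncomputable def face (i : Fin (n + 2)) : C(Simp n, Simp (n + 1)) :=
  ⟨stdSimplex.map i.succAbove, stdSimplex.continuous_map _⟩

lemma aff_comp_face (w : Fin (k + 2) → Simp n) (i : Fin (k + 2)) :
    (aff w).comp (face i) = aff (w ∘ i.succAbove) := by
  refine ContinuousMap.ext fun t ↦ Subtype.ext ?_
  have h : ∀ j, (face i t).1 j = ∑ x with i.succAbove x = j, t.1 x := fun j ↦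
    FunOnFinite.linearMap_apply_apply ..
  simp only [aff_coe, ContinuousMap.comp_apply, h, Function.comp_apply]
  rw [Fin.sum_univ_succAbove _ i]
  simp [Fin.succAbove_ne, Finset.filter_eq']

lemma dist_aff_le (w : Fin (k + 1) → Simp n) {x : Simp n} {r : ℝ} (h : ∀ i, dist x (w i) ≤ r)
    (t : Simp k) : dist x (aff w t) ≤ r := by
  rw [dist_comm]
  refine (convex_closedBall x.1 r).sum_mem (fun i _ ↦ t.2.1 i) t.2.2 fun i _ ↦ ?_
  rw [Metric.mem_closedBall, dist_comm]
  exact h i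

/-- The barycenter of a tuple of points. -/
noncomputable def bary (k : ℕ) (w : Fin (k + 1) → Simp n) : Simp n := aff w stdSimplex.barycenter

lemma dist_bary_le (w : Fin (k + 1) → Simp n) {r : ℝ} (h : ∀ i j, dist (w i) (w j) ≤ r)
    (j : Fin (k + 1)) : dist (bary k w) (w j) ≤ k / (k + 1) * r := by
  have hb : (bary k w).1 - (w j).1 = (k + 1 : ℝ)⁻¹ • ∑ i, ((w i).1 - (w j).1) := by
    have hk : (k + 1 : ℝ) ≠ 0 := by positivity
    have : (bary k w).1 = ∑ i, (k + 1 : ℝ)⁻¹ • (w i).1 := by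
      simp [bary, aff_coe]
    rw [this, Finset.sum_sub_distrib, smul_sub, ← Finset.smul_sum, Finset.sum_const,
      Finset.card_univ, Fintype.card_fin, ← Nat.cast_smul_eq_nsmul ℝ, smul_smul]
    push_cast
    rw [inv_mul_cancel₀ hk, one_smul]
  rw [Subtype.dist_eq, dist_eq_norm, hb, norm_smul, Fin.sum_univ_succAbove _ j, sub_self, zero_add,
    Real.norm_of_nonneg (by positivity), div_eq_inv_mul, mul_assoc]
  gcongr
  refine (norm_sum_le _ _).trans ?_
  refine (Finset.sum_le_sum (g := fun _ ↦ r) fun i _ ↦ ?_).trans (by simp)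
  rw [← dist_eq_norm]
  exact h _ _

variable (R : Type) [CommRing R]

/-- Barycentric subdivision decreases the diameters of simplices. -/
lemma sd_single_mem (k : ℕ) (w : Fin (k + 1) → Simp n) {r : ℝ} (h : ∀ i j, dist (w i) (w j) ≤ r) :
    sd R bary k (.single w 1) ∈ Finsupp.supported R R {u : Fin (k + 1) → Simp n |
      (∀ x s, (∀ j, dist x (w j) ≤ s) → ∀ i, dist x (u i) ≤ s) ∧
      ∀ i j, dist (u i) (u j) ≤ k / (k + 1) * r} := by
  have hr : 0 ≤ r := dist_nonneg.trans (h 0 0)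
  induction k with
  | zero =>
    refine Finsupp.single_mem_supported R 1 ⟨fun x s hs ↦ hs, fun i j ↦ ?_⟩
    rw [Fin.fin_one_eq_zero i, Fin.fin_one_eq_zero j]
    simp
  | succ k ih =>
    rw [sd_single, bd_single, map_sum, map_sum]
    refine sum_mem fun i _ ↦ ?_
    rw [map_smul, map_smul]
    refine Submodule.smul_mem _ _ ?_
    have hi := ih (w ∘ i.succAbove) fun _ _ ↦ h _ _
    have hle : (k : ℝ) / (k + 1) ≤ ((k + 1 : ℕ) : ℝ) / ((k + 1 : ℕ) + 1) := by
      rw [div_le_div_iff₀ (by positivity) (by positivity)]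
      push_cast
      nlinarith
    refine Finsupp.supported_comap_lmapDomain R R (Fin.cons (α := fun _ ↦ Simp n) _) _
      (Finsupp.supported_mono (fun u hu ↦ ?_) hi)
    have hb : ∀ x s, (∀ j, dist x (w j) ≤ s) → dist x (bary (k + 1) w) ≤ s :=
      fun x s hs ↦ dist_aff_le w hs _
    have hbu : ∀ j, dist (bary (k + 1) w) (u j) ≤ ((k + 1 : ℕ) : ℝ) / ((k + 1 : ℕ) + 1) * r :=
      hu.1 _ _ fun j ↦ dist_bary_le w h _
    refine ⟨fun x s hs ↦ Fin.cases (hb x s hs) (hu.1 x s fun j ↦ hs _), ?_⟩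
    refine Fin.cases (Fin.cases ?_ hbu) fun i ↦ Fin.cases ?_ fun j ↦ ?_
    · simpa using by positivity
    · rw [dist_comm]
      exact hbu i
    · exact (hu.2 i j).trans (by gcongr)

lemma map_mem_of_supported {α M : Type} [AddCommGroup M] [Module R M] {s : Set α}
    (g : (α →₀ R) →ₗ[R] M) {P : Submodule R M} (h : ∀ a ∈ s, g (.single a 1) ∈ P) {c : α →₀ R}
    (hc : c ∈ Finsupp.supported R R s) : g c ∈ P := by
  suffices Finsupp.supported R R s ≤ P.comap g from this hc
  rw [Finsupp.supported_eq_span_single, Submodule.span_le]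
  rintro _ ⟨a, ha, rfl⟩
  exact h a ha

lemma sd_iterate_mem (k : ℕ) {r : ℝ} (m : ℕ) {c : (Fin (k + 1) → Simp n) →₀ R}
    (hc : c ∈ Finsupp.supported R R {u : Fin (k + 1) → Simp n | ∀ i j, dist (u i) (u j) ≤ r}) :
    (sd R bary k)^[m] c ∈ Finsupp.supported R R
      {u : Fin (k + 1) → Simp n | ∀ i j, dist (u i) (u j) ≤ (k / (k + 1)) ^ m * r} := by
  induction m with
  | zero => simpa using hc
  | succ m ih =>
    rw [Function.iterate_succ_apply', pow_succ', mul_assoc]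
    exact map_mem_of_supported R _ (fun w hw ↦
      Finsupp.supported_mono (fun u hu ↦ hu.2) (sd_single_mem R k w hw)) ih

end Simplex

section Singular

variable (R : Type) [CommRing R] {E : Type} [TopologicalSpace E] {k n : ℕ}

/-- The tuple of vertices of the standard simplex. -/
noncomputable def vertices (n : ℕ) : Fin (n + 1) → Simp n := fun i ↦ stdSimplex.vertex i

lemma aff_vertices : aff (vertices n) = ContinuousMap.id (Simp n) := aff_vertex

lemma aff_comp_vertices (w : Fin (k + 1) → Simp n) : aff w ∘ vertices k = w :=
  funext (aff_apply_vertex w)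

/-- The singular chain attached to an ordered chain in a simplex by means of a singular simplex. -/
noncomputable def push (σ : C(Simp n, E)) (k : ℕ) :
    ((Fin (k + 1) → Simp n) →₀ R) →ₗ[R] (C(Simp k, E) →₀ R) :=
  Finsupp.lmapDomain R R fun w ↦ σ.comp (aff w)

@[simp]
lemma push_single (σ : C(Simp n, E)) (k : ℕ) (w : Fin (k + 1) → Simp n) :
    push R σ k (.single w 1) = .single (σ.comp (aff w)) 1 := by
  simp [push]

lemma push_vertices (σ : C(Simp n, E)) : push R σ n (.single (vertices n) 1) = .single σ 1 := by
  rw [push_single, aff_vertices, ContinuousMap.comp_id]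

lemma push_comp_aff (σ : C(Simp n, E)) {l : ℕ} (u : Fin (l + 1) → Simp n) (k : ℕ)
    (c : (Fin (k + 1) → Simp l) →₀ R) :
    push R (σ.comp (aff u)) k c = push R σ k (mapTuples R (aff u) k c) := by
  suffices h : push R (σ.comp (aff u)) k = push R σ k ∘ₗ mapTuples R (aff u) k from
    LinearMap.congr_fun h c
  refine Finsupp.lhom_ext' fun w ↦ LinearMap.ext_ring ?_
  simp [aff_aff, ContinuousMap.comp_assoc]

variable (E) in
/-- The boundary of singular chains. -/
noncomputable def singBd (n : ℕ) : (C(Simp (n + 1), E) →₀ R) →ₗ[R] (C(Simp n, E) →₀ R) :=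
  ∑ i : Fin (n + 2), (-1 : R) ^ (i : ℕ) • Finsupp.lmapDomain R R (ContinuousMap.comp · (face i))

lemma singBd_single (σ : C(Simp (n + 1), E)) : singBd R E n (.single σ 1) =
    ∑ i : Fin (n + 2), (-1 : R) ^ (i : ℕ) • Finsupp.single (σ.comp (face i)) 1 := by
  simp only [singBd, LinearMap.sum_apply, LinearMap.smul_apply, Finsupp.lmapDomain_apply,
    Finsupp.mapDomain_single]

lemma singBd_push (σ : C(Simp n, E)) (k : ℕ) (c : (Fin (k + 2) → Simp n) →₀ R) :
    singBd R E k (push R σ (k + 1) c) = push R σ k (bd R k c) := by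
  suffices h : singBd R E k ∘ₗ push R σ (k + 1) = push R σ k ∘ₗ bd R k from
    LinearMap.congr_fun h c
  refine Finsupp.lhom_ext' fun w ↦ LinearMap.ext_ring ?_
  simp only [LinearMap.comp_apply, Finsupp.lsingle_apply, push_single, singBd_single, bd_single,
    map_sum, map_smul, ContinuousMap.comp_assoc, aff_comp_face]

lemma singBd_singBd (n : ℕ) (c : C(Simp (n + 2), E) →₀ R) :
    singBd R E n (singBd R E (n + 1) c) = 0 := by
  suffices h : singBd R E n ∘ₗ singBd R E (n + 1) = 0 from LinearMap.congr_fun h c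
  refine Finsupp.lhom_ext' fun σ ↦ LinearMap.ext_ring ?_
  simp only [LinearMap.comp_apply, Finsupp.lsingle_apply]
  rw [← push_vertices, singBd_push, singBd_push, bd_bd, map_zero, LinearMap.zero_apply]

variable (E) in
/-- The singular chain complex. -/
noncomputable def singCx : Cx R where
  M n := C(Simp n, E) →₀ R
  d n := singBd R E n
  d_d n := singBd_singBd R n

variable (E) in
/-- Barycentric subdivision of singular chains. -/
noncomputable def singSd (n : ℕ) : (C(Simp n, E) →₀ R) →ₗ[R] (C(Simp n, E) →₀ R) :=
  Finsupp.linearCombination R fun σ ↦ push R σ n (sd R bary n (.single (vertices n) 1))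

variable (E) in
/-- The homotopy between barycentric subdivision and the identity. -/
noncomputable def singHomotopy (n : ℕ) : (C(Simp n, E) →₀ R) →ₗ[R] (C(Simp (n + 1), E) →₀ R) :=
  Finsupp.linearCombination R fun σ ↦
    push R σ (n + 1) (sdHomotopy R bary n (.single (vertices n) 1))

lemma aff_bary (u : Fin (k + 1) → Simp n) (l : ℕ) (w : Fin (l + 1) → Simp k) :
    aff u (bary l w) = bary l (aff u ∘ w) := by
  rw [bary, bary, aff_aff]
  rfl

lemma singSd_push (σ : C(Simp n, E)) (k : ℕ) (c : (Fin (k + 1) → Simp n) →₀ R) :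
    singSd R E k (push R σ k c) = push R σ k (sd R bary k c) := by
  suffices h : singSd R E k ∘ₗ push R σ k = push R σ k ∘ₗ sd R bary k from
    LinearMap.congr_fun h c
  refine Finsupp.lhom_ext' fun w ↦ LinearMap.ext_ring ?_
  simp only [LinearMap.comp_apply, Finsupp.lsingle_apply, push_single, singSd,
    Finsupp.linearCombination_single, one_smul, push_comp_aff]
  rw [mapTuples_sd R (aff_bary w), mapTuples_single, aff_comp_vertices]

lemma singHomotopy_push (σ : C(Simp n, E)) (k : ℕ) (c : (Fin (k + 1) → Simp n) →₀ R) :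
    singHomotopy R E k (push R σ k c) = push R σ (k + 1) (sdHomotopy R bary k c) := by
  suffices h : singHomotopy R E k ∘ₗ push R σ k = push R σ (k + 1) ∘ₗ sdHomotopy R bary k from
    LinearMap.congr_fun h c
  refine Finsupp.lhom_ext' fun w ↦ LinearMap.ext_ring ?_
  simp only [LinearMap.comp_apply, Finsupp.lsingle_apply, push_single, singHomotopy,
    Finsupp.linearCombination_single, one_smul, push_comp_aff]
  rw [mapTuples_sdHomotopy R (aff_bary w), mapTuples_single, aff_comp_vertices]

lemma singSd_iterate_single (m : ℕ) (σ : C(Simp n, E)) :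
    (singSd R E n)^[m] (.single σ 1) =
      push R σ n ((sd R bary n)^[m] (.single (vertices n) 1)) := by
  induction m with
  | zero => exact (push_vertices R σ).symm
  | succ m ih => rw [Function.iterate_succ_apply', ih, singSd_push, Function.iterate_succ_apply']

lemma singBd_singSd (n : ℕ) (c : C(Simp (n + 1), E) →₀ R) :
    singBd R E n (singSd R E (n + 1) c) = singSd R E n (singBd R E n c) := by
  suffices h : singBd R E n ∘ₗ singSd R E (n + 1) = singSd R E n ∘ₗ singBd R E n from
    LinearMap.congr_fun h c
  refine Finsupp.lhom_ext' fun σ ↦ LinearMap.ext_ring ?_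
  simp only [LinearMap.comp_apply, Finsupp.lsingle_apply]
  rw [← push_vertices, singBd_push, singSd_push, singBd_push, singSd_push, bd_sd]

lemma singBd_singHomotopy (n : ℕ) (c : C(Simp (n + 1), E) →₀ R) :
    singBd R E (n + 1) (singHomotopy R E (n + 1) c) + singHomotopy R E n (singBd R E n c) =
      c - singSd R E (n + 1) c := by
  suffices h : singBd R E (n + 1) ∘ₗ singHomotopy R E (n + 1) + singHomotopy R E n ∘ₗ singBd R E n =
    LinearMap.id - singSd R E (n + 1) from LinearMap.congr_fun h c
  refine Finsupp.lhom_ext' fun σ ↦ LinearMap.ext_ring ?_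
  simp only [LinearMap.comp_apply, LinearMap.add_apply, LinearMap.sub_apply, LinearMap.id_apply,
    Finsupp.lsingle_apply]
  rw [← push_vertices, singBd_push, singSd_push, singHomotopy_push, singHomotopy_push,
    singBd_push, ← map_add, ← map_sub, bd_sdHomotopy]

/-- The singular chains in `U`. -/
noncomputable def chainsIn (U : Set E) (n : ℕ) : Submodule R (C(Simp n, E) →₀ R) :=
  Finsupp.supported R R {σ : C(Simp n, E) | ∀ t, σ t ∈ U}

lemma single_mem_chainsIn {U : Set E} {σ : C(Simp n, E)} (hσ : ∀ t, σ t ∈ U) :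
    Finsupp.single σ 1 ∈ chainsIn R U n :=
  Finsupp.single_mem_supported R 1 hσ

/-- The subcomplex of singular chains in `U`. -/
noncomputable def singSub (U : Set E) : SubCx (singCx R E) where
  P n := chainsIn R U n
  d_mem n c hc := by
    refine map_mem_of_supported R (singBd R E n) (fun σ hσ ↦ ?_) hc
    rw [singBd_single]
    exact sum_mem fun i _ ↦ Submodule.smul_mem _ _
      (Finsupp.single_mem_supported R 1 fun t ↦ hσ (face i t))

variable {R}

lemma push_mem {U : Set E} {σ : C(Simp n, E)} {s : Set (Fin (k + 1) → Simp n)}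
    (hσ : ∀ w ∈ s, ∀ t, σ (aff w t) ∈ U) {c : (Fin (k + 1) → Simp n) →₀ R}
    (hc : c ∈ Finsupp.supported R R s) : push R σ k c ∈ chainsIn R U k := by
  refine map_mem_of_supported R _ (fun w hw ↦ ?_) hc
  rw [push_single]
  exact Finsupp.single_mem_supported R 1 (hσ w hw)

lemma singSd_mem {U : Set E} {c : C(Simp n, E) →₀ R} (hc : c ∈ chainsIn R U n) :
    singSd R E n c ∈ chainsIn R U n := by
  refine map_mem_of_supported R _ (fun σ hσ ↦ ?_) hc
  rw [← push_vertices, singSd_push]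
  exact push_mem (s := Set.univ) (fun w _ t ↦ hσ _) (by simp [Finsupp.supported_univ])

lemma singHomotopy_mem {U : Set E} {c : C(Simp n, E) →₀ R} (hc : c ∈ chainsIn R U n) :
    singHomotopy R E n c ∈ chainsIn R U (n + 1) := by
  refine map_mem_of_supported R _ (fun σ hσ ↦ ?_) hc
  rw [← push_vertices, singHomotopy_push]
  exact push_mem (s := Set.univ) (fun w _ t ↦ hσ _) (by simp [Finsupp.supported_univ])

variable {U V : Set E}

lemma map_mem_sup (f : ∀ n, (C(Simp n, E) →₀ R) →ₗ[R] (C(Simp (n + k), E) →₀ R))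
    (hf : ∀ U n c, c ∈ chainsIn R U n → f n c ∈ chainsIn R U (n + k))
    {c : C(Simp n, E) →₀ R} (hc : c ∈ chainsIn R U n ⊔ chainsIn R V n) :
    f n c ∈ chainsIn R U (n + k) ⊔ chainsIn R V (n + k) := by
  obtain ⟨a, ha, b, hb, rfl⟩ := Submodule.mem_sup.mp hc
  rw [map_add]
  exact Submodule.add_mem_sup (hf U n a ha) (hf V n b hb)

lemma exists_singSd_single_mem (hU : IsOpen U) (hV : IsOpen V) {σ : C(Simp n, E)}
    (hσ : ∀ t, σ t ∈ U ∪ V) :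
    ∃ m, (singSd R E n)^[m] (.single σ 1) ∈ chainsIn R U n ⊔ chainsIn R V n := by
  obtain ⟨δ, hδ, hball⟩ := lebesgue_number_lemma_of_metric (s := (Set.univ : Set (Simp n)))
    (c := fun b : Bool ↦ σ ⁻¹' (if b then U else V)) isCompact_univ
    (fun b ↦ by cases b <;> simp [hU.preimage σ.continuous, hV.preimage σ.continuous])
    (fun t _ ↦ by simpa [or_comm] using hσ t)
  have hq : (n : ℝ) / (n + 1) < 1 := by
    rw [div_lt_one (by positivity)]
    linarith
  obtain ⟨r, hr⟩ : ∃ r, ∀ i j, dist (vertices n i) (vertices n j) ≤ r :=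
    ⟨Metric.diam (Set.univ : Set (Simp n)), fun i j ↦
      Metric.dist_le_diam_of_mem isCompact_univ.isBounded trivial trivial⟩
  have hlim : Filter.Tendsto (fun m : ℕ ↦ ((n : ℝ) / (n + 1)) ^ m * r) Filter.atTop (nhds 0) := by
    simpa using (tendsto_pow_atTop_nhds_zero_of_lt_one (by positivity) hq).mul_const r
  obtain ⟨m, hm⟩ := (hlim.eventually (gt_mem_nhds hδ)).exists
  refine ⟨m, ?_⟩
  rw [singSd_iterate_single]
  refine map_mem_of_supported R _ (fun w hw ↦ ?_)
    (sd_iterate_mem R n m (Finsupp.single_mem_supported R 1 hr))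
  rw [push_single]
  obtain ⟨b, hb⟩ := hball (w 0) trivial
  have hmem : ∀ t, σ (aff w t) ∈ (if b then U else V) := fun t ↦ hb (by
    rw [Metric.mem_ball, dist_comm]
    exact (dist_aff_le w (fun i ↦ hw 0 i) t).trans_lt hm)
  cases b
  · exact Submodule.mem_sup_right (Finsupp.single_mem_supported R 1 (by simpa using hmem))
  · exact Submodule.mem_sup_left (Finsupp.single_mem_supported R 1 (by simpa using hmem))

lemma singSd_iterate_mem_sup {c : C(Simp n, E) →₀ R} {m m' : ℕ} (hm : m ≤ m')
    (hc : (singSd R E n)^[m] c ∈ chainsIn R U n ⊔ chainsIn R V n) :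
    (singSd R E n)^[m'] c ∈ chainsIn R U n ⊔ chainsIn R V n := by
  induction m', hm using Nat.le_induction with
  | base => exact hc
  | succ m' _ ih =>
    rw [Function.iterate_succ_apply']
    exact map_mem_sup (k := 0) (singSd R E) (fun _ _ _ ↦ singSd_mem) ih

lemma exists_singSd_mem (hU : IsOpen U) (hV : IsOpen V) {c : C(Simp n, E) →₀ R}
    (hc : c ∈ chainsIn R (U ∪ V) n) :
    ∃ m, (singSd R E n)^[m] c ∈ chainsIn R U n ⊔ chainsIn R V n := by
  let S : Submodule R (C(Simp n, E) →₀ R) :=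
    { carrier := {c | ∃ m, (singSd R E n)^[m] c ∈ chainsIn R U n ⊔ chainsIn R V n}
      zero_mem' := ⟨0, zero_mem _⟩
      add_mem' := by
        rintro a b ⟨m, hm⟩ ⟨m', hm'⟩
        refine ⟨max m m', ?_⟩
        rw [iterate_map_add]
        exact add_mem (singSd_iterate_mem_sup (le_max_left _ _) hm)
          (singSd_iterate_mem_sup (le_max_right _ _) hm')
      smul_mem' := by
        rintro r c ⟨m, hm⟩
        refine ⟨m, ?_⟩
        rw [← Module.End.pow_apply] at hm ⊢
        rw [map_smul]
        exact Submodule.smul_mem _ _ hm }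
  exact map_mem_of_supported R LinearMap.id (P := S)
    (fun σ hσ ↦ exists_singSd_single_mem hU hV hσ) hc

lemma exists_singBd_sub_mem (m : ℕ) {c : C(Simp (n + 1), E) →₀ R}
    (hc : c ∈ chainsIn R (U ∪ V) (n + 1))
    (hd : singBd R E n c ∈ chainsIn R U n ⊔ chainsIn R V n)
    (hm : (singSd R E (n + 1))^[m] c ∈ chainsIn R U (n + 1) ⊔ chainsIn R V (n + 1)) :
    ∃ y ∈ chainsIn R (U ∪ V) (n + 2),
      c - singBd R E (n + 1) y ∈ chainsIn R U (n + 1) ⊔ chainsIn R V (n + 1) := by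
  induction m generalizing c with
  | zero => exact ⟨0, zero_mem _, by simpa using hm⟩
  | succ m ih =>
    obtain ⟨y, hy, h⟩ := ih (singSd_mem hc) (by
      rw [singBd_singSd]
      exact map_mem_sup (k := 0) (singSd R E) (fun _ _ _ ↦ singSd_mem) hd) hm
    refine ⟨y + singHomotopy R E (n + 1) c, add_mem hy (singHomotopy_mem hc), ?_⟩
    have := map_mem_sup (k := 1) (singHomotopy R E) (fun _ _ _ ↦ singHomotopy_mem) hd
    convert add_mem h this using 1
    rw [map_add, ← sub_eq_iff_eq_add'.mpr (singBd_singHomotopy R n c).symm]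
    abel

lemma chainsIn_zero_union_le :
    chainsIn R (U ∪ V) 0 ≤ chainsIn R U 0 ⊔ chainsIn R V 0 := by
  intro c hc
  refine map_mem_of_supported R LinearMap.id (fun σ hσ ↦ ?_) hc
  have ht : ∀ t, t = (default : Simp 0) := fun t ↦ Subsingleton.elim _ _
  rcases hσ default with h | h
  · exact Submodule.mem_sup_left (single_mem_chainsIn R fun t ↦ ht t ▸ h)
  · exact Submodule.mem_sup_right (single_mem_chainsIn R fun t ↦ ht t ▸ h)

lemma hasEuler_small (hU : IsOpen U) (hV : IsOpen V) {e : ℤ} [IsDomain R] [IsNoetherianRing R] :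
    HasEuler R ((singSub R U).sup (singSub R V)).toCx.H e ↔
      HasEuler R (singSub R (U ∪ V)).toCx.H e := by
  refine SubCx.hasEuler_iff_of_deform (fun n ↦ sup_le ?_ ?_) (fun c hc ↦ ?_) fun n c hc hd ↦ ?_
  · exact Finsupp.supported_mono fun σ hσ t ↦ .inl (hσ t)
  · exact Finsupp.supported_mono fun σ hσ t ↦ .inr (hσ t)
  · exact chainsIn_zero_union_le hc
  · obtain ⟨m, hm⟩ := exists_singSd_mem hU hV hc
    exact exists_singBd_sub_mem m hc hd hm

lemma singSub_inter : singSub R (U ∩ V) = (singSub R U).inf (singSub R V) := by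
  ext1
  funext n
  change Finsupp.supported R R _ = Finsupp.supported R R _ ⊓ Finsupp.supported R R _
  rw [← Finsupp.supported_inter]
  congr 1
  ext σ
  exact forall_and

lemma hasEuler_inter [IsDomain R] [IsNoetherianRing R] (hU : IsOpen U) (hV : IsOpen V) {a b c : ℤ}
    (ha : HasEuler R (singSub R U).toCx.H a) (hb : HasEuler R (singSub R V).toCx.H b)
    (hc : HasEuler R (singSub R (U ∪ V)).toCx.H c) :
    HasEuler R (singSub R (U ∩ V)).toCx.H (a + b - c) := by
  rw [singSub_inter]
  exact SubCx.hasEuler_inf ha hb ((hasEuler_small hU hV).mpr hc)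

lemma hasEuler_union [IsDomain R] [IsNoetherianRing R] (hU : IsOpen U) (hV : IsOpen V) {a b c : ℤ}
    (ha : HasEuler R (singSub R U).toCx.H a) (hb : HasEuler R (singSub R V).toCx.H b)
    (hc : HasEuler R (singSub R (U ∩ V)).toCx.H c) :
    HasEuler R (singSub R (U ∪ V)).toCx.H (a + b - c) := by
  rw [singSub_inter] at hc
  exact (hasEuler_small hU hV).mp (SubCx.hasEuler_sup ha hb hc)

end Singular

/-- The singular simplices contained in `U`. -/
abbrev simplicesIn {E : Type} [TopologicalSpace E] (U : Set E) (n : ℕ) : Set C(Simp n, E) :=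
  {s | ∀ t, s t ∈ U}

section Compare

open Simplicial Opposite

variable (R : Type) [CommRing R] {E : Type} [TopologicalSpace E]

/-- The singular chain complex. -/
noncomputable def singChains : TopCat ⥤ ChainComplex (ModuleCat R) ℕ :=
  TopCat.toSSet ⋙ ((SimplicialObject.whiskering _ _).obj (ModuleCat.free R)) ⋙
    AlgebraicTopology.alternatingFaceMapComplex (ModuleCat R)

/-- Singular simplices of a subspace are singular simplices of the ambient space with image in it. -/
noncomputable def simplexEquiv (U : Set E) (n : ℕ) :
    (TopCat.toSSet.obj (TopCat.of U)) _⦋n⦌ ≃ simplicesIn U n :=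
  (TopCat.toSSetObjEquiv (TopCat.of U) (op ⦋n⦌)).trans
    { toFun s := ⟨(ContinuousMap.mk (Subtype.val : U → E)).comp s, fun t ↦ (s t).2⟩
      invFun s := ⟨fun t ↦ ⟨s.1 t, s.2 t⟩, by fun_prop⟩
      left_inv _ := rfl
      right_inv _ := rfl }

lemma simplexEquiv_δ (U : Set E) (n : ℕ) (i : Fin (n + 2))
    (x : (TopCat.toSSet.obj (TopCat.of U)) _⦋n + 1⦌) :
    (simplexEquiv U n ((TopCat.toSSet.obj (TopCat.of U)).δ i x)).1 =
      (simplexEquiv U (n + 1) x).1.comp (face i) := by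
  ext t
  exact congrArg Subtype.val (TopCat.toSSetObjEquiv_δ_apply x i t)

/-- Singular chains of a subspace are singular chains of the ambient space supported in it. -/
noncomputable def chainEquiv (U : Set E) (n : ℕ) :
    ((TopCat.toSSet.obj (TopCat.of U)) _⦋n⦌ →₀ R) ≃ₗ[R] chainsIn R U n :=
  (Finsupp.domLCongr (simplexEquiv U n)).trans (Finsupp.supportedEquivFinsupp _).symm

lemma chainEquiv_single (U : Set E) (n : ℕ) (x : (TopCat.toSSet.obj (TopCat.of U)) _⦋n⦌) (r : R) :
    (chainEquiv R U n (.single x r)).1 = .single (simplexEquiv U n x).1 r := by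
  change ((Finsupp.supportedEquivFinsupp (R := R) (simplicesIn U n)).symm
    (Finsupp.domLCongr (R := R) (simplexEquiv U n) (.single x r))).1 = _
  rw [Finsupp.domLCongr_single]
  exact Finsupp.supportedEquivFinsupp_symm_single _ _ _

lemma hom_sum_zsmul_apply {A B : ModuleCat R} {n : ℕ} (f : Fin n → (A ⟶ B)) (y : A) :
    (∑ i : Fin n, (-1 : ℤ) ^ (i : ℕ) • f i).hom y = ∑ i : Fin n, (-1 : R) ^ (i : ℕ) • (f i).hom y := by
  rw [ModuleCat.hom_sum, LinearMap.sum_apply]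
  refine Finset.sum_congr rfl fun i _ ↦ ?_
  rw [ModuleCat.hom_zsmul, LinearMap.smul_apply, ← Int.cast_smul_eq_zsmul R]
  push_cast
  rfl

lemma singChains_d_single (X : TopCat.{0}) (n : ℕ) (x : (TopCat.toSSet.obj X) _⦋n + 1⦌) :
    (((singChains R).obj X).d (n + 1) n).hom (Finsupp.single x (1 : R)) =
      ∑ i : Fin (n + 2), (-1 : R) ^ (i : ℕ) • Finsupp.single ((TopCat.toSSet.obj X).δ i x) (1 : R) := by
  have h : ((singChains R).obj X).d (n + 1) n = ∑ i : Fin (n + 2), (-1 : ℤ) ^ (i : ℕ) •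
      (ModuleCat.free R).map ((TopCat.toSSet.obj X).δ i) :=
    AlgebraicTopology.AlternatingFaceMapComplex.obj_d_eq _ n
  rw [h]
  refine (hom_sum_zsmul_apply R _ _).trans (Finset.sum_congr rfl fun i _ ↦ ?_)
  exact congrArg _ Finsupp.mapDomain_single

/-- The singular chain complex of a subspace is a subcomplex of that of the ambient space. -/
noncomputable def singChainsIso (U : Set E) :
    (singChains R).obj (TopCat.of U) ≅ (singSub R U).toCx.toChain :=
  HomologicalComplex.Hom.isoOfComponents (fun n ↦ (chainEquiv R U n).toModuleIso) (by
    rintro _ n rfl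
    refine ModuleCat.hom_ext ?_
    refine Finsupp.lhom_ext' fun x ↦ LinearMap.ext_ring (Subtype.ext ?_)
    rw [Cx.toChain_d]
    change singBd R E n (chainEquiv R U (n + 1) (.single x 1)).1 =
      (chainEquiv R U n ((((singChains R).obj (TopCat.of U)).d (n + 1) n).hom (.single x 1))).1
    rw [chainEquiv_single, singBd_single, singChains_d_single, map_sum, Submodule.coe_sum]
    refine Finset.sum_congr rfl fun i _ ↦ ?_
    rw [map_smul, Submodule.coe_smul, chainEquiv_single, simplexEquiv_δ])

end Compare

section Contractible

variable (R : Type) [CommRing R] {E : Type} [TopologicalSpace E]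

lemma singChains_homologyMap_eq {X Y : TopCat.{0}} {f g : X ⟶ Y} (h : TopCat.Homotopy f g) (n : ℕ) :
    HomologicalComplex.homologyMap ((singChains R).map f) n =
      HomologicalComplex.homologyMap ((singChains R).map g) n :=
  (h.toSSet.toSimplicialObjectHomotopy.whiskerRight (ModuleCat.free R)).map_homology_eq n

/-- The singular homology of homotopy equivalent spaces. -/
noncomputable def singHomologyIso {X Y : Type} [TopologicalSpace X] [TopologicalSpace Y]
    (e : ContinuousMap.HomotopyEquiv X Y) (n : ℕ) :
    ((singChains R).obj (TopCat.of X)).homology n ≅ ((singChains R).obj (TopCat.of Y)).homology n where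
  hom := HomologicalComplex.homologyMap ((singChains R).map (TopCat.ofHom e.toFun)) n
  inv := HomologicalComplex.homologyMap ((singChains R).map (TopCat.ofHom e.invFun)) n
  hom_inv_id := by
    obtain ⟨h⟩ := e.left_inv
    rw [← HomologicalComplex.homologyMap_comp, ← Functor.map_comp]
    have := singChains_homologyMap_eq R
      (f := TopCat.ofHom e.toFun ≫ TopCat.ofHom e.invFun) (g := 𝟙 _) h n
    rw [this, CategoryTheory.Functor.map_id, HomologicalComplex.homologyMap_id]
  inv_hom_id := by
    obtain ⟨h⟩ := e.right_inv
    rw [← HomologicalComplex.homologyMap_comp, ← Functor.map_comp]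
    have := singChains_homologyMap_eq R
      (f := TopCat.ofHom e.invFun ≫ TopCat.ofHom e.toFun) (g := 𝟙 _) h n
    rw [this, CategoryTheory.Functor.map_id, HomologicalComplex.homologyMap_id]

/-- The simplicial module of singular chains of a point. -/
noncomputable def freeToSSetPointIso :
    ((SimplicialObject.whiskering _ _).obj (ModuleCat.free R)).obj
      (TopCat.toSSet.obj (TopCat.of Unit)) ≅
      (Functor.const SimplexCategoryᵒᵖ).obj ((ModuleCat.free R).obj Unit) :=
  ((SimplicialObject.whiskering _ _).obj (ModuleCat.free R)).mapIso
      (TopCat.toSSetIsoConst (TopCat.of Unit)) ≪≫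
    NatIso.ofComponents (fun _ ↦ Iso.refl _) (fun f ↦ by
      change (ModuleCat.free R).map (𝟙 _) ≫ 𝟙 _ = 𝟙 _ ≫ 𝟙 _
      rw [CategoryTheory.Functor.map_id])

/-- The singular chain complex of a point. -/
noncomputable def singChainsPointIso :
    (singChains R).obj (TopCat.of Unit) ≅
      ChainComplex.alternatingConst.obj ((ModuleCat.free R).obj Unit) :=
  (AlgebraicTopology.alternatingFaceMapComplex (ModuleCat R)).mapIso (freeToSSetPointIso R) ≪≫
    AlgebraicTopology.alternatingFaceMapComplexConst.app ((ModuleCat.free R).obj Unit)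

lemma hasEuler_point [IsDomain R] [IsNoetherianRing R] :
    HasEuler R (fun n ↦ ((singChains R).obj (TopCat.of Unit)).homology n) 1 := by
  suffices h : HasEuler R (fun n ↦ (ChainComplex.alternatingConst.obj
      ((ModuleCat.free R).obj Unit)).homology n) 1 from
    h.congr fun n ↦ ((HomologicalComplex.homologyFunctor _ _ n).mapIso
      (singChainsPointIso R)).symm.toLinearEquiv
  have e : (Unit →₀ R) ≃ₗ[R] (ChainComplex.alternatingConst.obj
      ((ModuleCat.free R).obj Unit)).homology 0 :=
    (ChainComplex.alternatingConstHomologyZero ((ModuleCat.free R).obj Unit)).symm.toLinearEquiv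
  have hs : ∀ n, 1 ≤ n → Subsingleton ((ChainComplex.alternatingConst.obj
      ((ModuleCat.free R).obj Unit)).homology n) := fun n hn ↦ by
    rw [← ModuleCat.isZero_iff_subsingleton, ← HomologicalComplex.exactAt_iff_isZero_homology]
    exact ChainComplex.alternatingConst_exactAt _ n (by omega)
  refine ⟨fun n ↦ ?_, 1, hs, ?_⟩
  · cases n with
    | zero => exact Module.Finite.equiv e
    | succ n =>
      have := hs (n + 1) (by omega)
      infer_instance
  · simp [← e.finrank_eq]

lemma hasEuler_of_contractible [IsDomain R] [IsNoetherianRing R] (U : Set E)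
    [ContractibleSpace U] : HasEuler R (singSub R U).toCx.H 1 :=
  (hasEuler_point R).congr fun n ↦
    ((singHomologyIso R (ContractibleSpace.hequiv_unit U).some n).symm ≪≫
      (HomologicalComplex.homologyFunctor _ _ n).mapIso (singChainsIso R U)).toLinearEquiv

lemma hasEuler_empty [IsDomain R] [IsNoetherianRing R] : HasEuler R (singSub R (∅ : Set E)).toCx.H 0 := by
  have hs : ∀ n, Subsingleton (chainsIn R (∅ : Set E) n) := fun n ↦ by
    have : {s : C(Simp n, E) | ∀ t, s t ∈ (∅ : Set E)} = ∅ := by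
      ext s
      simp only [Set.mem_empty_iff_false, Set.mem_ofPred_eq, iff_false, not_forall]
      exact ⟨Classical.arbitrary _, not_false⟩
    rw [chainsIn, this, Finsupp.supported_empty]
    infer_instance
  exact HasEuler.zero fun n ↦ Cx.subsingleton_H _ (hs 0)
    (fun n x _ ↦ ⟨0, (hs (n + 1)).elim _ _⟩) n

end Contractible

section Subspace

variable {R : Type} [CommRing R] [IsDomain R] [IsNoetherianRing R]
variable {E : Type} [NormedAddCommGroup E] [NormedSpace ℝ E] [FiniteDimensional ℝ E]

/-- The complement of the half of the subspace `W` where `f ≤ 0`. -/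
def halfCompl (W : Submodule ℝ E) (f : E →ₗ[ℝ] ℝ) : Set E := {x | ¬ (x ∈ W ∧ f x ≤ 0)}

lemma isOpen_halfCompl (W : Submodule ℝ E) (f : E →ₗ[ℝ] ℝ) : IsOpen (halfCompl W f) := by
  refine IsClosed.isOpen_compl (s := {x | x ∈ W ∧ f x ≤ 0}) (self := ?_)
  exact W.closed_of_finiteDimensional.inter
    (isClosed_le (LinearMap.continuous_of_finiteDimensional f) continuous_const)

lemma starConvex_halfCompl {W : Submodule ℝ E} {f : E →ₗ[ℝ] ℝ} {p : E} (hp : p ∈ W)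
    (hf : 0 < f p) : StarConvex ℝ p (halfCompl W f) := by
  rintro x hx a b ha hb hab ⟨h1, h2⟩
  rcases hb.eq_or_lt with rfl | hb
  · obtain rfl : a = 1 := by linarith
    simp at h2
    linarith
  · refine hx ⟨?_, ?_⟩
    · have : b • x ∈ W := by simpa using W.sub_mem h1 (W.smul_mem a hp)
      exact (W.smul_mem_iff hb.ne').mp this
    · simp only [map_add, map_smul, smul_eq_mul] at h2
      by_contra! h
      nlinarith [mul_pos hb h, mul_nonneg ha hf.le]

lemma hasEuler_halfCompl {W : Submodule ℝ E} {f : E →ₗ[ℝ] ℝ} {p : E} (hp : p ∈ W)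
    (hf : 0 < f p) : HasEuler R (singSub R (halfCompl W f)).toCx.H 1 := by
  have : ContractibleSpace (halfCompl W f) :=
    (starConvex_halfCompl hp hf).contractibleSpace ⟨p, fun h ↦ h.2.not_gt hf⟩
  exact hasEuler_of_contractible R _

lemma hasEuler_compl_inf_ker {W : Submodule ℝ E} {f : E →ₗ[ℝ] ℝ} {p : E} (hp : p ∈ W)
    (hf : 0 < f p) {e : ℤ} (h : HasEuler R (singSub R (W : Set E)ᶜ).toCx.H e) :
    HasEuler R (singSub R ((W ⊓ LinearMap.ker f : Submodule ℝ E) : Set E)ᶜ).toCx.H (1 + 1 - e) := by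
  have h1 : (W : Set E)ᶜ = halfCompl W f ∩ halfCompl W (-f) := by
    ext x
    have := le_total (f x) 0
    simp only [halfCompl, Set.mem_compl_iff, Set.mem_inter_iff, Set.mem_ofPred_eq, SetLike.mem_coe,
      LinearMap.neg_apply, Left.neg_nonpos_iff]
    tauto
  have h2 : ((W ⊓ LinearMap.ker f : Submodule ℝ E) : Set E)ᶜ =
      halfCompl W f ∪ halfCompl W (-f) := by
    ext x
    have := le_antisymm_iff (a := f x) (b := 0)
    simp only [halfCompl, Set.mem_compl_iff, Set.mem_union, Set.mem_ofPred_eq, SetLike.mem_coe,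
      LinearMap.neg_apply, Left.neg_nonpos_iff, Submodule.mem_inf, LinearMap.mem_ker]
    tauto
  rw [h2]
  rw [h1] at h
  exact hasEuler_union (isOpen_halfCompl W f) (isOpen_halfCompl W (-f)) (hasEuler_halfCompl hp hf)
    (hasEuler_halfCompl (p := -p) (W.neg_mem hp) (by simpa using hf)) h

/-- The Euler characteristic of the complement of a linear subspace. -/
lemma hasEuler_compl (W : Submodule ℝ E) (c : ℕ) (hc : Module.finrank ℝ W + c = Module.finrank ℝ E) :
    HasEuler R (singSub R (W : Set E)ᶜ).toCx.H (1 - (-1) ^ c) := by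
  induction c generalizing W with
  | zero =>
    obtain rfl : W = ⊤ := Submodule.eq_top_of_finrank_eq hc
    rw [Submodule.top_coe, Set.compl_univ]
    simpa using hasEuler_empty R (E := E)
  | succ c ih =>
    obtain ⟨p, hp⟩ : ∃ p, p ∉ W := by
      by_contra! h
      obtain rfl : W = ⊤ := eq_top_iff.mpr fun x _ ↦ h x
      rw [finrank_top] at hc
      omega
    obtain ⟨f, hfp, hf⟩ := W.exists_le_ker_of_notMem hp
    have hp1 : p ∈ W ⊔ ℝ ∙ p := Submodule.mem_sup_right (Submodule.mem_span_singleton_self p)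
    have hW : (W ⊔ ℝ ∙ p) ⊓ LinearMap.ker (f p • f) = W := by
      refine le_antisymm ?_ (le_inf le_sup_left fun x hx ↦ ?_)
      · rintro x ⟨hx, hx0⟩
        obtain ⟨w, hw, _, hs, rfl⟩ := Submodule.mem_sup.mp hx
        obtain ⟨t, rfl⟩ := Submodule.mem_span_singleton.mp hs
        have h0 : f w = 0 := hf hw
        have : t = 0 := by simpa [h0, hfp] using hx0
        simpa [this] using hw
      · have h0 : f x = 0 := hf hx
        simp [h0]
    have h := hasEuler_compl_inf_ker (f := f p • f) (R := R) hp1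
      (by rw [LinearMap.smul_apply]; exact mul_self_pos.mpr hfp) (ih (W ⊔ ℝ ∙ p) ?_)
    · rw [hW] at h
      convert h using 1
      ring
    · have h1 := Submodule.finrank_sup_add_finrank_inf_eq W (ℝ ∙ p)
      have hp0 : p ≠ 0 := fun h ↦ hp (h ▸ W.zero_mem)
      rw [((Submodule.disjoint_span_singleton' hp0).mpr hp).eq_bot, finrank_bot,
        finrank_span_singleton hp0] at h1
      omega

end Subspace

/-- The singular homology of `U` is finitely generated with Euler characteristic `e`. -/
def HasEulerChar {E : Type} [TopologicalSpace E] (U : Set E) (e : ℤ) : Prop :=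
  HasEuler ℤ (singSub ℤ U).toCx.H e

section Arrangement

variable {ι : Type} [Fintype ι] (X : Type)

/-- The tuples which are constant along the relation `r`. -/
def diag (r : ι → ι → Prop) : Set (ι → X) := {x | ∀ i j, r i j → x i = x j}

/-- The complement of the union of the diagonals given by the relations in `L`. -/
def arr (L : List (ι → ι → Prop)) : Set (ι → X) := {x | ∀ r ∈ L, x ∉ diag X r}

lemma arr_nil : arr X ([] : List (ι → ι → Prop)) = Set.univ := by simp [arr]

lemma arr_singleton (r : ι → ι → Prop) : arr X [r] = (diag X r)ᶜ := by
  ext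
  simp [arr]

lemma arr_cons (r : ι → ι → Prop) (L : List (ι → ι → Prop)) :
    arr X (r :: L) = arr X L ∩ arr X [r] := by
  ext
  simp [arr, and_comm]

lemma diag_or (r s : ι → ι → Prop) :
    diag X (fun i j ↦ s i j ∨ r i j) = diag X s ∩ diag X r := by
  ext
  simp [diag, or_imp, forall_and]

lemma arr_map_or (r : ι → ι → Prop) (L : List (ι → ι → Prop)) :
    arr X (L.map fun s i j ↦ s i j ∨ r i j) = arr X L ∪ arr X [r] := by
  ext x
  by_cases h : x ∈ diag X r <;> simp [arr, diag_or, h]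

/-- The tuples constant along `r` are the functions on the quotient. -/
def diagEquiv (r : ι → ι → Prop) : (Quot r → X) ≃ diag X r where
  toFun y := ⟨fun i ↦ y (Quot.mk r i), fun _ _ h ↦ congrArg y (Quot.sound h)⟩
  invFun x := Quot.lift x.1 x.2
  left_inv y := by
    ext ⟨i⟩
    rfl
  right_inv x := rfl

lemma card_quot_le (r : ι → ι → Prop) : Nat.card (Quot r) ≤ Fintype.card ι := by
  rw [← Nat.card_eq_fintype_card]
  exact Nat.card_le_card_of_surjective _ Quot.mk_surjective

lemma ncard_diag (r : ι → ι → Prop) (k : ℕ) : (diag (Fin k) r).ncard = k ^ Nat.card (Quot r) := by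
  rw [← Nat.card_coe_set_eq, ← Nat.card_congr (diagEquiv (Fin k) r), Nat.card_fun, Nat.card_fin]

variable (V : Type) [NormedAddCommGroup V] [NormedSpace ℝ V] [FiniteDimensional ℝ V]

/-- The tuples constant along a relation form a linear subspace. -/
def diagSubmodule (r : ι → ι → Prop) : Submodule ℝ (ι → V) where
  carrier := diag V r
  zero_mem' _ _ _ := rfl
  add_mem' hx hy i j h := congrArg₂ (· + ·) (hx i j h) (hy i j h)
  smul_mem' c _ hx i j h := congrArg (c • ·) (hx i j h)

lemma finrank_diagSubmodule (r : ι → ι → Prop) :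
    Module.finrank ℝ (diagSubmodule V r) = Nat.card (Quot r) * Module.finrank ℝ V := by
  let e : (Quot r → V) ≃ₗ[ℝ] diagSubmodule V r :=
    { diagEquiv V r with
      map_add' _ _ := rfl
      map_smul' _ _ := rfl }
  have := Fintype.ofFinite (Quot r)
  rw [← e.finrank_eq, Module.finrank_pi_fintype]
  simp

lemma isOpen_arr (L : List (ι → ι → Prop)) : IsOpen (arr V L) := by
  induction L with
  | nil => rw [arr_nil]; exact isOpen_univ
  | cons r L ih =>
    rw [arr_cons, arr_singleton]
    exact ih.inter (diagSubmodule V r).closed_of_finiteDimensional.isOpen_compl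

open Polynomial in
/-- The polynomial `P` counts the points of the arrangement complement and determines its Euler
characteristic. -/
def Good (L : List (ι → ι → Prop)) (P : ℤ[X]) : Prop :=
  (∀ k : ℕ, P.eval (k : ℤ) = (arr (Fin k) L).ncard) ∧
    HasEulerChar (arr V L) ((-1) ^ (Module.finrank ℝ V * Fintype.card ι) *
      P.eval ((-1) ^ Module.finrank ℝ V))

lemma good_nil : Good V ([] : List (ι → ι → Prop)) (.X ^ Fintype.card ι) := by
  refine ⟨fun k ↦ ?_, ?_⟩
  · rw [arr_nil, Set.ncard_univ, Nat.card_fun, Nat.card_fin]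
    simp
  · rw [arr_nil]
    have : ContractibleSpace (Set.univ : Set (ι → V)) :=
      convex_univ.contractibleSpace Set.univ_nonempty
    have h : HasEulerChar (Set.univ : Set (ι → V)) 1 := hasEuler_of_contractible ℤ _
    convert h
    simp [← pow_mul, ← pow_add]

lemma good_singleton (r : ι → ι → Prop) :
    Good V [r] (.X ^ Fintype.card ι - .X ^ Nat.card (Quot r)) := by
  refine ⟨fun k ↦ ?_, ?_⟩
  · have := Set.ncard_add_ncard_compl (diag (Fin k) r)
    rw [ncard_diag, Nat.card_fun, Nat.card_fin, Nat.card_eq_fintype_card (α := ι)] at this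
    rw [arr_singleton]
    simp only [Polynomial.eval_sub, Polynomial.eval_pow, Polynomial.eval_X]
    rw [sub_eq_iff_eq_add']
    exact_mod_cast this.symm
  · obtain ⟨c, hc⟩ := Nat.exists_eq_add_of_le (card_quot_le r)
    rw [arr_singleton]
    have h : HasEulerChar (diag V r)ᶜ _ :=
      hasEuler_compl (R := ℤ) (diagSubmodule V r) (c * Module.finrank ℝ V) (by
        rw [finrank_diagSubmodule, Module.finrank_pi_fintype]
        simp [hc, add_mul])
    convert h using 1
    · simp only [Polynomial.eval_sub, Polynomial.eval_pow, Polynomial.eval_X, hc]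
      have h : ∀ a : ℕ, ((-1 : ℤ) ^ a) ^ 2 = 1 := fun a ↦ by rw [← pow_mul', pow_mul]; simp
      have h1 := h (Module.finrank ℝ V * Nat.card (Quot r))
      have h2 := h (Module.finrank ℝ V * c)
      rw [mul_add, pow_add, ← pow_mul, ← pow_mul, mul_add, pow_add, mul_comm c]
      generalize (-1 : ℤ) ^ (Module.finrank ℝ V * Nat.card (Quot r)) = a at *
      generalize (-1 : ℤ) ^ (Module.finrank ℝ V * c) = b at *
      linear_combination (b ^ 2 - b) * h1 + h2

lemma Good.cons {L : List (ι → ι → Prop)} {r : ι → ι → Prop} {P Q T : Polynomial ℤ}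
    (hP : Good V L P) (hQ : Good V [r] Q) (hT : Good V (L.map fun s i j ↦ s i j ∨ r i j) T) :
    Good V (r :: L) (P + Q - T) := by
  refine ⟨fun k ↦ ?_, ?_⟩
  · have := Set.ncard_union_add_ncard_inter (arr (Fin k) L) (arr (Fin k) [r])
    rw [Polynomial.eval_sub, Polynomial.eval_add, hP.1, hQ.1, hT.1, arr_cons _ r L, arr_map_or]
    omega
  · have h := hT.2
    rw [arr_map_or] at h
    rw [arr_cons]
    have h' : HasEulerChar (arr V L ∩ arr V [r]) _ :=
      hasEuler_inter (isOpen_arr V L) (isOpen_arr V [r]) hP.2 hQ.2 h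
    convert h' using 1
    rw [Polynomial.eval_sub, Polynomial.eval_add]
    ring

lemma exists_good (L : List (ι → ι → Prop)) : ∃ P, Good V L P := by
  induction hn : L.length generalizing L with
  | zero =>
    obtain rfl := List.length_eq_zero_iff.mp hn
    exact ⟨_, good_nil V⟩
  | succ n ih =>
    obtain ⟨r, L, rfl⟩ := List.exists_cons_of_length_eq_add_one hn
    simp only [List.length_cons, Nat.add_right_cancel_iff] at hn
    obtain ⟨P, hP⟩ := ih L hn
    obtain ⟨T, hT⟩ := ih (L.map fun s i j ↦ s i j ∨ r i j) (by simpa using hn)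
    exact ⟨_, hP.cons V (good_singleton V r) hT⟩

lemma exists_arr_eq (G : SimpleGraph ι) : ∃ L : List (ι → ι → Prop),
    ∀ X : Type, arr X L = {x | ∀ i j, G.Adj i j → x i ≠ x j} := by
  classical
  refine ⟨((Finset.univ.filter fun p : ι × ι ↦ G.Adj p.1 p.2).toList.map
    fun p i j ↦ i = p.1 ∧ j = p.2), fun X ↦ ?_⟩
  ext x
  simp only [arr, diag, List.mem_map, Finset.mem_toList, Finset.mem_filter, Finset.mem_univ,
    true_and, Set.mem_ofPred_eq]
  constructor
  · intro h i j hij hx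
    refine h _ ⟨(i, j), hij, rfl⟩ ?_
    rintro _ _ ⟨rfl, rfl⟩
    exact hx
  · rintro h _ ⟨p, hp, rfl⟩ hx
    exact h _ _ hp (hx _ _ ⟨rfl, rfl⟩)

end Arrangement

/-- The Euler characteristic of a chromatic configuration space. -/
lemma hasEuler_chromConf (m N : ℕ) (G : SimpleGraph (Fin m)) (P : Polynomial ℤ)
    (hP : ∀ k : ℕ, P.eval (k : ℤ) =
      Nat.card {f : Fin m → Fin k // ∀ i j, G.Adj i j → f i ≠ f j}) :
    HasEuler ℤ (fun d ↦ SH d (chromConf N m G)) ((-1) ^ (N * m) * P.eval ((-1 : ℤ) ^ N)) := by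
  obtain ⟨L, hL⟩ := exists_arr_eq G
  obtain ⟨Q, hQ, h⟩ := exists_good (EuclideanSpace ℝ (Fin N)) L
  obtain rfl : P = Q := Polynomial.eq_of_infinite_eval_eq _ _
    ((Set.infinite_range_of_injective Nat.cast_injective).mono (by
      rintro _ ⟨k, rfl⟩
      change P.eval (k : ℤ) = Q.eval (k : ℤ)
      rw [hP, hQ, hL]
      rfl))
  rw [hL, finrank_euclideanSpace_fin, Fintype.card_fin] at h
  exact h.congr fun d ↦ ((HomologicalComplex.homologyFunctor _ _ d).mapIso
    (singChainsIso ℤ _)).symm.toLinearEquiv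

end ChromConf

theorem stmt4 (m N : ℕ) (hN : 2 ≤ N)
    (G : SimpleGraph (Fin m))
    (P : Polynomial ℤ)
    (hP : ∀ k : ℕ, P.eval (k : ℤ) =
      Nat.card {f : Fin m → Fin k // ∀ i j, G.Adj i j → f i ≠ f j}) :
    (∃ D : ℕ, ∀ d : ℕ, D ≤ d → Subsingleton (SH d (chromConf N m G))) ∧
    (∀ d : ℕ, Module.Finite ℤ (SH d (chromConf N m G))) ∧
    (∑ᶠ d : ℕ, (-1 : ℤ) ^ d * (Module.finrank ℤ (SH d (chromConf N m G)) : ℤ)) =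
      (-1) ^ (N * m) * P.eval ((-1 : ℤ) ^ N) := by
  have h := ChromConf.hasEuler_chromConf m N G P hP
  exact ⟨h.2.imp fun D hD ↦ hD.1, h.1, h.finsum⟩
end

section
/- Let C_m be the cycle graph on m ≥ 3 vertices and let 2 ≤ k ≤ m. Then the number of bond partitions of C_m with exactly k blocks equals binom(m, k). -/
/-!
STATEMENT 6: For the cycle graph C_m on m ≥ 3 vertices and 2 ≤ k ≤ m, the number
of bond partitions of C_m with exactly k blocks equals binom(m, k).
-/

/-- A setoid (equivalently, a partition of the vertex set) is a bond partition of
`G` if each of its equivalence classes induces a connected subgraph of `G`. -/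
def IsBondPartition {m : ℕ} (G : SimpleGraph (Fin m)) (s : Setoid (Fin m)) : Prop :=
  ∀ c ∈ s.classes, (G.induce c).Connected

open SimpleGraph

/-- If every orbit of `σ` meets `T`, there is a retraction onto `T` sending each point to the
first point of `T` on its orbit. -/
theorem exists_first_hit {α : Type*} (σ : α → α) (T : Set α) (h : ∀ i, ∃ t, σ^[t] i ∈ T) :
    ∃ f : α → α, (∀ i ∈ T, f i = i) ∧ (∀ i ∉ T, f i = f (σ i)) ∧ ∀ i, f i ∈ T := by
  classical
  refine ⟨fun i => σ^[Nat.find (h i)] i, fun i hi => ?_, fun i hi => ?_,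
    fun i => Nat.find_spec (h i)⟩
  · have : Nat.find (h i) = 0 := by simpa using hi
    simp [this]
  · have h2 : Nat.find (h i) = Nat.find (h (σ i)) + 1 :=
      Nat.find_comp_succ (h i) (h (σ i)) hi
    simp only [h2, Function.iterate_succ_apply]

/-- A predicate holding on `T` and pulled back along `σ` off `T` holds at every point whose
orbit meets `T`. -/
theorem first_hit_induction {α : Type*} {σ : α → α} {T : Set α} {P : α → Prop}
    (h : ∀ i, ∃ t, σ^[t] i ∈ T) (base : ∀ i ∈ T, P i) (step : ∀ i ∉ T, P (σ i) → P i) (i : α) :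
    P i := by
  obtain ⟨t, ht⟩ := h i
  induction t generalizing i with
  | zero => exact base i ht
  | succ t ih =>
    by_cases hi : i ∈ T
    · exact base i hi
    · exact step i hi (ih (σ i) ht)

open scoped Fin.CommRing in
theorem exists_iterate_add_one_eq {n : ℕ} (i j : Fin (n + 1)) : ∃ t, (· + 1)^[t] i = j := by
  refine ⟨(j - i).val, ?_⟩
  have h : (j - i).val • (1 : Fin (n + 1)) = j - i :=
    (nsmul_one (j - i).val).trans (Fin.cast_val_eq_self _)
  rw [add_right_iterate, h]
  exact add_sub_cancel i j

theorem exists_iterate_add_one_mem {n : ℕ} {T : Set (Fin (n + 1))} (hT : T.Nonempty)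
    (i : Fin (n + 1)) : ∃ t, (· + 1)^[t] i ∈ T := by
  obtain ⟨j, hj⟩ := hT
  obtain ⟨t, rfl⟩ := exists_iterate_add_one_eq i j
  exact ⟨t, hj⟩

theorem ncard_classes_ker {α β : Type*} (f : α → β) :
    (Setoid.ker f).classes.ncard = (Set.range f).ncard := by
  rw [← Nat.card_coe_set_eq, ← Nat.card_coe_set_eq]
  exact Nat.card_congr
    ((Setoid.quotientEquivClasses _).symm.trans (Setoid.quotientKerEquivRange f))

/-- The vertices `i` of the cycle at which a partition separates `i` from `i + 1`. -/
def Setoid.cuts {n : ℕ} (s : Setoid (Fin (n + 1))) : Set (Fin (n + 1)) :=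
  {i | ¬ s i (i + 1)}

theorem Setoid.cuts_nonempty {n : ℕ} {s : Setoid (Fin (n + 1))} (h : 2 ≤ s.classes.ncard) :
    s.cuts.Nonempty := by
  by_contra hne
  have hs : ∀ i, s i (i + 1) := fun i => by
    by_contra hi
    exact hne ⟨i, hi⟩
  have htop : ∀ i j, s i j := fun i j => by
    obtain ⟨t, rfl⟩ := exists_iterate_add_one_eq i j
    induction t with
    | zero => exact s.refl i
    | succ t ih =>
      rw [Function.iterate_succ_apply']
      exact s.trans ih (hs _)
  have hsub : s.classes.Subsingleton := by
    rintro _ ⟨x, rfl⟩ _ ⟨y, rfl⟩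
    ext z
    simp [htop z x, htop z y]
  have := Set.ncard_le_one_iff_subsingleton.2 hsub
  omega

/-- A bond partition of the cycle with at least two blocks is the kernel of the map sending each
vertex to the next cut. -/
theorem IsBondPartition.eq_ker {n : ℕ} {s : Setoid (Fin (n + 2))}
    (hs : IsBondPartition (cycleGraph (n + 2)) s) (hne : s.cuts.Nonempty)
    {f : Fin (n + 2) → Fin (n + 2)} (hf : ∀ i ∈ s.cuts, f i = i)
    (hf' : ∀ i ∉ s.cuts, f i = f (i + 1)) : s = Setoid.ker f := by
  have hsf : ∀ i, s i (f i) :=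
    first_hit_induction (exists_iterate_add_one_mem hne)
      (fun i hi => by rw [hf i hi]) fun i hi h => by
        rw [hf' i hi]
        exact s.trans (not_not.1 hi) h
  have hstep : ∀ u v, s u v → v = u + 1 → f u = f v := by
    rintro u _ huv rfl
    exact hf' u (not_not.2 huv)
  ext i j
  refine ⟨fun hij => ?_, fun hij => ?_⟩
  · have hwalk : ∀ a b : {x | s x j}, ((cycleGraph (n + 2)).induce {x | s x j}).Walk a b →
        f a = f b := by
      intro a b w
      induction w with
      | nil => rfl
      | @cons u v _ huv _ ih =>
        rw [← ih]
        have huv' : s u v := s.trans u.2 (s.symm v.2)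
        rcases cycleGraph_adj.1 (induce_adj.1 huv) with h | h
        · exact (hstep v u (s.symm huv') (sub_eq_iff_eq_add'.1 h)).symm
        · exact hstep u v huv' (sub_eq_iff_eq_add'.1 h)
    obtain ⟨w⟩ := (hs _ (s.mem_classes j)).preconnected ⟨i, hij⟩ ⟨j, s.refl j⟩
    exact hwalk _ _ w
  · have hij' : f i = f j := hij
    have := hsf i
    rw [hij'] at this
    exact s.trans this (s.symm (hsf j))

section FirstHit

variable {n : ℕ} {T : Set (Fin (n + 2))} {f : Fin (n + 2) → Fin (n + 2)}

theorem isBondPartition_ker_of_first_hit (hne : T.Nonempty) (hf : ∀ i ∈ T, f i = i)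
    (hf' : ∀ i ∉ T, f i = f (i + 1)) (hmem : ∀ i, f i ∈ T) :
    IsBondPartition (cycleGraph (n + 2)) (Setoid.ker f) := by
  rintro _ ⟨y, rfl⟩
  have hy : f (f y) = f y := hf _ (hmem y)
  have hreach : ∀ x (hx : f x = f y),
      ((cycleGraph (n + 2)).induce {x | f x = f y}).Reachable ⟨x, hx⟩ ⟨f y, hy⟩ := by
    refine first_hit_induction (exists_iterate_add_one_mem hne) ?_ ?_
    · intro i hi hx
      have : i = f y := (hf i hi).symm.trans hx
      subst this
      rfl
    · intro i hi ih hx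
      refine Reachable.trans (Adj.reachable ?_) (ih ((hf' i hi).symm.trans hx))
      rw [induce_adj, cycleGraph_adj]
      right
      simp
  exact (connected_iff_exists_forall_reachable _).2 ⟨⟨f y, hy⟩, fun x => (hreach x x.2).symm⟩

theorem cuts_ker_of_first_hit (hT : T.Nontrivial) (hf : ∀ i ∈ T, f i = i)
    (hf' : ∀ i ∉ T, f i = f (i + 1)) : (Setoid.ker f).cuts = T := by
  ext i
  refine ⟨fun hi => by_contra fun hiT => hi (hf' i hiT), fun hi (h : f i = f (i + 1)) => ?_⟩
  rw [hf i hi] at h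
  have hconst : ∀ t, f ((· + 1)^[t] i) = i := by
    intro t
    induction t with
    | zero => exact hf i hi
    | succ t ih =>
      rw [Function.iterate_succ_apply']
      by_cases hx : (· + 1)^[t] i ∈ T
      · rw [← hf _ hx, ih, ← h]
      · rw [← hf' _ hx, ih]
  obtain ⟨j, hj, hji⟩ := hT.exists_ne i
  obtain ⟨t, rfl⟩ := exists_iterate_add_one_eq i j
  exact hji ((hf _ hj).symm.trans (hconst t))

theorem ncard_classes_ker_of_first_hit (hf : ∀ i ∈ T, f i = i) (hmem : ∀ i, f i ∈ T) :
    (Setoid.ker f).classes.ncard = T.ncard := by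
  rw [ncard_classes_ker]
  congr 1
  exact Set.Subset.antisymm (Set.range_subset_iff.2 hmem) fun i hi => ⟨i, hf i hi⟩

end FirstHit

theorem stmt6 (m k : ℕ) (hm : 3 ≤ m) (hk : 2 ≤ k) (hkm : k ≤ m) :
    Nat.card {s : Setoid (Fin m) //
        IsBondPartition (SimpleGraph.cycleGraph m) s ∧ s.classes.ncard = k} =
      m.choose k := by
  obtain ⟨n, rfl⟩ : ∃ n, m = n + 2 := ⟨m - 2, by omega⟩
  have hcard : Nat.card {T : Set (Fin (n + 2)) // T.ncard = k} = (n + 2).choose k := by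
    have h : {T : Set (Fin (n + 2)) | T.ncard = k}.ncard = (n + 2).choose k := by
      simpa [Set.ncard_univ] using
        Set.ncard_powerset_ncard (Set.finite_univ (α := Fin (n + 2))) k
    rwa [← Nat.card_coe_set_eq] at h
  rw [← hcard]
  have hker : ∀ s : Setoid (Fin (n + 2)), IsBondPartition (cycleGraph (n + 2)) s →
      s.classes.ncard = k → ∀ f : Fin (n + 2) → Fin (n + 2), (∀ i ∈ s.cuts, f i = i) →
      (∀ i ∉ s.cuts, f i = f (i + 1)) → s = Setoid.ker f := fun s hs hsk f hf hf' =>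
    hs.eq_ker (Setoid.cuts_nonempty (hk.trans hsk.ge)) hf hf'
  have hhit : ∀ T : Set (Fin (n + 2)), T.Nonempty → _ := fun T hT =>
    exists_first_hit (· + 1) T (exists_iterate_add_one_mem hT)
  refine Nat.card_eq_of_bijective (fun s => ⟨s.1.cuts, ?_⟩) ⟨?_, ?_⟩
  · obtain ⟨s, hs, hsk⟩ := s
    obtain ⟨f, hf, hf', hmem⟩ := hhit _ (Setoid.cuts_nonempty (hk.trans hsk.ge))
    rw [← ncard_classes_ker_of_first_hit hf hmem, ← hker s hs hsk f hf hf', hsk]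
  · rintro ⟨s, hs, hsk⟩ ⟨s', hs', hsk'⟩ h
    have h' : s.cuts = s'.cuts := congrArg Subtype.val h
    obtain ⟨f, hf, hf', -⟩ := hhit _ (Setoid.cuts_nonempty (hk.trans hsk.ge))
    refine Subtype.ext ((hker s hs hsk f hf hf').trans (hker s' hs' hsk' f ?_ ?_).symm)
    · exact h' ▸ hf
    · exact h' ▸ hf'
  · rintro ⟨T, hT⟩
    have hT2 : T.Nontrivial := (Set.one_lt_ncard_iff_nontrivial).1 (by omega)
    obtain ⟨f, hf, hf', hmem⟩ := hhit T hT2.nonempty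
    exact ⟨⟨Setoid.ker f, isBondPartition_ker_of_first_hit hT2.nonempty hf hf' hmem,
      (ncard_classes_ker_of_first_hit hf hmem).trans hT⟩,
      Subtype.ext (cuts_ker_of_first_hit hT2 hf hf')⟩
end
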